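/- arXiv:1810.08374 — 8 statements merged into one kernel-verified Lean document; each statement's English description precedes it below -/
import Mathlib

section
/- Let X be a Cantor space with a fixed compatible metric d, and K a divisible dynamical simplex on X. Let 𝒯 be a KR-partition of X associated to K with at least two columns, and let ε > 0. Then there exists a KR-partition 𝒮 of X associated to K such that: (1) 𝒮 refines 𝒯; (2) the base and the top of 𝒮 both have d-diameter less than ε; (3) all columns of 𝒮 have the same height, each column of 𝒮 contains at least one copy of every column of 𝒯, and no two columns of 𝒮 are 𝒯-twins. -/
open MeasureTheory Set
open scoped ENNReal NNReal

/-- `K` is a dynamical simplex: nonempty, compact, convex, all its elements are atomless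
with full support, and it has the Glasner–Weiss property. -/
def IsDynSimplex {X : Type*} [TopologicalSpace X] [MeasurableSpace X] [OpensMeasurableSpace X]
    (K : Set (ProbabilityMeasure X)) : Prop :=
  K.Nonempty ∧ IsCompact K ∧
    (∀ μ ∈ K, ∀ ν ∈ K, ∀ t : ℝ≥0∞, t ≤ 1 →
      ∃ σ ∈ K, (σ : Measure X) = t • (μ : Measure X) + (1 - t) • (ν : Measure X)) ∧
    (∀ μ ∈ K, NoAtoms (μ : Measure X)) ∧
    (∀ μ ∈ K, (μ : Measure X).IsOpenPosMeasure) ∧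
    (∀ U V : Set X, IsClopen U → IsClopen V →
      (∀ μ ∈ K, (μ : Measure X) U < (μ : Measure X) V) →
      ∃ W : Set X, IsClopen W ∧ W ⊆ V ∧
        ∀ μ ∈ K, (μ : Measure X) W = (μ : Measure X) U)

/-- `K` is divisible: for every clopen `U` and every `n ≥ 1` there is a clopen `V ⊆ U`
of measure `μ(U)/n` for every `μ ∈ K`. -/
def Divisible {X : Type*} [TopologicalSpace X] [MeasurableSpace X]
    (K : Set (ProbabilityMeasure X)) : Prop :=
  ∀ U : Set X, IsClopen U → ∀ n : ℕ, 1 ≤ n →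
    ∃ V : Set X, IsClopen V ∧ V ⊆ U ∧
      ∀ μ ∈ K, (μ : Measure X) V = (μ : Measure X) U / n

/-- A KR-partition of `X` associated to `K`: a finite partition of `X` into nonempty clopen
sets `atom i j` (`i` a column index, `j` a level of that column) such that, within each
column, all levels have the same measure for every `μ ∈ K`. -/
structure KRPartition (X : Type*) [TopologicalSpace X] [MeasurableSpace X]
    (K : Set (ProbabilityMeasure X)) where
  n : ℕ
  npos : 0 < n
  height : Fin n → ℕ
  height_pos : ∀ i, 0 < height i
  atom : (i : Fin n) → Fin (height i) → Set X
  clopen : ∀ i j, IsClopen (atom i j)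
  nonempty : ∀ i j, (atom i j).Nonempty
  disj : ∀ p q : (i : Fin n) × Fin (height i), p ≠ q →
    Disjoint (atom p.1 p.2) (atom q.1 q.2)
  cover : ⋃ (i) (j), atom i j = Set.univ
  measure_eq : ∀ (i : Fin n) (j k : Fin (height i)), ∀ μ ∈ K,
    (μ : Measure X) (atom i j) = (μ : Measure X) (atom i k)

namespace KRPartition

variable {X : Type*} [TopologicalSpace X] [MeasurableSpace X] {K : Set (ProbabilityMeasure X)}

/-- The base of a KR-partition: the union of the bottom levels of its columns. -/
def base (T : KRPartition X K) : Set X :=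
  ⋃ i, T.atom i ⟨0, T.height_pos i⟩

/-- The top of a KR-partition: the union of the top levels of its columns. -/
def top (T : KRPartition X K) : Set X :=
  ⋃ i, T.atom i ⟨T.height i - 1, Nat.sub_lt (T.height_pos i) one_pos⟩

/-- `S` refines `T`: the base of `S` is contained in the base of `T`, every atom of `T`
is a union of atoms of `S`, and whenever an atom of `S` is contained in a non-top atom
of `T`, the next level of `S` is contained in the next level of `T`. -/
def Refines (S T : KRPartition X K) : Prop :=
  S.base ⊆ T.base ∧
  (∀ (i : Fin T.n) (j : Fin (T.height i)),
    ∃ A : Set ((c : Fin S.n) × Fin (S.height c)),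
      T.atom i j = ⋃ p ∈ A, S.atom p.1 p.2) ∧
  (∀ (c : Fin S.n) (j : Fin (S.height c)) (i : Fin T.n) (k : Fin (T.height i)),
    S.atom c j ⊆ T.atom i k → ∀ hk : (k : ℕ) + 1 < T.height i,
      ∃ hj : (j : ℕ) + 1 < S.height c,
        S.atom c ⟨(j : ℕ) + 1, hj⟩ ⊆ T.atom i ⟨(k : ℕ) + 1, hk⟩)

/-- Column `c` of `S` contains a copy of column `i` of `T` starting at level `j`:
the consecutive levels `j, j+1, …` of column `c` traverse column `i` of `T` from its
base level to its top level. -/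
def IsCopyAt (S T : KRPartition X K) (c : Fin S.n) (i : Fin T.n) (j : ℕ) : Prop :=
  ∀ l : ℕ, ∀ hl : l < T.height i, ∃ hjl : j + l < S.height c,
    S.atom c ⟨j + l, hjl⟩ ⊆ T.atom i ⟨l, hl⟩

/-- The number of copies of column `i` of `T` contained in column `c` of `S`. -/
noncomputable def numCopies (S T : KRPartition X K) (c : Fin S.n) (i : Fin T.n) : ℕ :=
  {j : ℕ | IsCopyAt S T c i j}.ncard

/-- Two columns `c, c'` of `S` are `T`-twins if they have the same repartition, i.e.
for every column `i` of `T` the proportions of copies of `i` (relative to the heights)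
agree. -/
def Twins (S T : KRPartition X K) (c c' : Fin S.n) : Prop :=
  ∀ i : Fin T.n,
    (numCopies S T c i : ℚ) / (S.height c : ℚ) = (numCopies S T c' i : ℚ) / (S.height c' : ℚ)

end KRPartition

section Aux

set_option linter.unusedSectionVars false

variable {X : Type*} [MetricSpace X] [CompactSpace X]
    [TotallyDisconnectedSpace X] [MeasurableSpace X] [BorelSpace X]

theorem aux_diff {Q : Type*} (μ : Measure X) [IsProbabilityMeasure μ] (s : Finset Q)
    (W : Q → Set X) (A : Set X) (hc : ∀ q ∈ s, IsClopen (W q)) (hs : ∀ q ∈ s, W q ⊆ A)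
    (hd : (s : Set Q).PairwiseDisjoint W) :
    μ.real (A \ ⋃ q ∈ s, W q) = μ.real A - ∑ q ∈ s, μ.real (W q) := by
  rw [measureReal_sdiff (by simpa using hs)
    (Finset.measurableSet_biUnion s fun q hq => (hc q hq).isOpen.measurableSet),
    measureReal_biUnion_finset hd (fun q hq => (hc q hq).isOpen.measurableSet)]

theorem aux_gw {K : Set (ProbabilityMeasure X)} (hK : IsDynSimplex K) (U V : Set X)
    (hU : IsClopen U) (hV : IsClopen V)
    (h : ∀ μ ∈ K, (μ : Measure X).real U < (μ : Measure X).real V) :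
    ∃ W : Set X, IsClopen W ∧ W ⊆ V ∧
      ∀ μ ∈ K, (μ : Measure X).real W = (μ : Measure X).real U := by
  obtain ⟨W, h1, h2, h3⟩ := hK.2.2.2.2.2 U V hU hV (fun μ hμ => by
    have := h μ hμ
    exact (ENNReal.toReal_lt_toReal (by finiteness) (by finiteness)).1 this)
  exact ⟨W, h1, h2, fun μ hμ => by simp only [Measure.real, h3 μ hμ]⟩

theorem aux_div {K : Set (ProbabilityMeasure X)} (hK : Divisible K) (U : Set X)
    (hU : IsClopen U) (n : ℕ) (hn : 1 ≤ n) :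
    ∃ V : Set X, IsClopen V ∧ V ⊆ U ∧
      ∀ μ ∈ K, (μ : Measure X).real V = (μ : Measure X).real U / n := by
  obtain ⟨W, h1, h2, h3⟩ := hK U hU n hn
  exact ⟨W, h1, h2, fun μ hμ => by simp [Measure.real, h3 μ hμ]⟩

theorem aux_pos {K : Set (ProbabilityMeasure X)} (hK : IsDynSimplex K) (Y : Set X)
    (hY : IsClopen Y) (hne : Y.Nonempty) :
    ∃ δ : ℝ, 0 < δ ∧ ∀ μ ∈ K, δ ≤ (μ : Measure X).real Y := by
  have hcont : Continuous (fun μ : ProbabilityMeasure X => μ Y) :=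
    continuous_iff_continuousAt.2 fun μ =>
      ProbabilityMeasure.tendsto_measure_of_isClopen_of_tendsto Filter.tendsto_id hY
  have hcont' : Continuous (fun μ : ProbabilityMeasure X => (μ : Measure X).real Y) :=
    NNReal.continuous_coe.comp hcont
  obtain ⟨μ, hμ, hmin⟩ := hK.2.1.exists_isMinOn hK.1 hcont'.continuousOn
  refine ⟨_, ?_, fun ν hν => hmin hν⟩
  have := hK.2.2.2.2.1 μ hμ
  exact ENNReal.toReal_pos (hY.isOpen.measure_pos _ hne).ne' (by finiteness)

theorem aux_split {K : Set (ProbabilityMeasure X)} (hK : IsDynSimplex K) {Q : Type*}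
    (s : Finset Q) (D : Q → Set X) (hD : ∀ q, IsClopen (D q)) (A : Set X) (hA : IsClopen A)
    (h : ∀ μ ∈ K, ∑ q ∈ s, (μ : Measure X).real (D q) < (μ : Measure X).real A) :
    ∃ W : Q → Set X, (∀ q ∈ s, IsClopen (W q)) ∧ (∀ q ∈ s, W q ⊆ A) ∧
      (∀ q ∈ s, ∀ μ ∈ K, (μ : Measure X).real (W q) = (μ : Measure X).real (D q)) ∧
      (s : Set Q).PairwiseDisjoint W := by
  classical
  induction s using Finset.induction_on with
  | empty => exact ⟨fun _ => ∅, by simp⟩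
  | insert a s ha ih =>
    obtain ⟨W, h1, h2, h3, h4⟩ := ih (fun μ hμ => by
      have := h μ hμ
      rw [Finset.sum_insert ha] at this
      have h0 : 0 ≤ (μ : Measure X).real (D a) := measureReal_nonneg
      linarith)
    have hU : IsClopen (⋃ q ∈ s, W q) := s.finite_toSet.isClopen_biUnion h1
    obtain ⟨V, g1, g2, g3⟩ := aux_gw hK (D a) (A \ ⋃ q ∈ s, W q) (hD a) (hA.diff hU)
      (fun μ hμ => by
        rw [aux_diff _ s W A h1 h2 h4, Finset.sum_congr rfl fun q hq => h3 q hq μ hμ]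
        have := h μ hμ
        rw [Finset.sum_insert ha] at this
        linarith)
    have hne : ∀ q ∈ s, q ≠ a := fun q hq e => ha (e ▸ hq)
    refine ⟨fun q => if q = a then V else W q, ?_, ?_, ?_, ?_⟩
    · intro q hq
      by_cases e : q = a
      · simpa [e] using g1
      · simpa [e] using h1 q (by simpa [e] using hq)
    · intro q hq
      by_cases e : q = a
      · simpa [e] using g2.trans sdiff_subset
      · simpa [e] using h2 q (by simpa [e] using hq)
    · intro q hq
      by_cases e : q = a
      · simpa [e] using g3
      · simpa [e] using h3 q (by simpa [e] using hq)
    · have key : ∀ q ∈ s, Disjoint V (W q) := fun q hq =>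
        (disjoint_sdiff_left).mono g2 (subset_biUnion_of_mem (u := W) hq)
      intro p hp q hq hpq
      have hp' : p = a ∨ p ∈ s := by simpa using hp
      have hq' : q = a ∨ q ∈ s := by simpa using hq
      change Disjoint (if p = a then V else W p) (if q = a then V else W q)
      rcases hp' with rfl | hp' <;> rcases hq' with rfl | hq'
      · exact absurd rfl hpq
      · simpa [hne q hq'] using key q hq'
      · simpa [hne p hp'] using (key p hp').symm
      · simpa [hne q hq', hne p hp'] using h4 hp' hq' hpq

theorem aux_split_exact {K : Set (ProbabilityMeasure X)} (hK : IsDynSimplex K) {Q : Type*}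
    [Fintype Q] (P : Finset Q) (D : Q → Set X) (hD : ∀ q, IsClopen (D q))
    (hpos : ∀ q, ∀ μ ∈ K, 0 < (μ : Measure X).real (D q))
    (A Y : Set X) (hA : IsClopen A) (hY : IsClopen Y) (hYA : Y ⊆ A)
    (h : ∀ μ ∈ K, ∑ q, (μ : Measure X).real (D q) = (μ : Measure X).real A)
    (hP : ∀ μ ∈ K, ∑ q ∈ P, (μ : Measure X).real (D q) < (μ : Measure X).real Y) :
    ∃ W : Q → Set X, (∀ q, IsClopen (W q)) ∧
      (∀ q, ∀ μ ∈ K, (μ : Measure X).real (W q) = (μ : Measure X).real (D q)) ∧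
      Pairwise (Function.onFun Disjoint W) ∧ (⋃ q, W q = A) ∧ ∀ q ∈ P, W q ⊆ Y := by
  classical
  obtain ⟨W1, a1, a2, a3, a4⟩ := aux_split hK P D hD Y hY hP
  have hU1 : IsClopen (⋃ q ∈ P, W1 q) := P.finite_toSet.isClopen_biUnion a1
  have hR : ∃ q0, q0 ∉ P := by
    by_contra! hall
    obtain ⟨μ, hμ⟩ := hK.1
    have e : P = Finset.univ := Finset.eq_univ_of_forall hall
    have := hP μ hμ
    rw [e, h μ hμ] at this
    exact absurd (measureReal_mono hYA) (not_le.2 this)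
  obtain ⟨q0, hq0⟩ := hR
  set s' := (Finset.univ \ P).erase q0 with hs'
  have hsum : ∀ f : Q → ℝ, ∑ q, f q = ∑ q ∈ P, f q + (f q0 + ∑ q ∈ s', f q) := by
    intro f
    rw [hs', Finset.add_sum_erase _ _ (by simpa using hq0), add_comm,
      Finset.sum_sdiff (Finset.subset_univ P)]
  set A' := A \ ⋃ q ∈ P, W1 q with hA'
  have hA'c : IsClopen A' := hA.diff hU1
  have mA' : ∀ μ ∈ K, (μ : Measure X).real A' =
      (μ : Measure X).real A - ∑ q ∈ P, (μ : Measure X).real (D q) := by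
    intro μ hμ
    rw [hA', aux_diff _ P W1 A a1 (fun q hq => (a2 q hq).trans hYA) a4,
      Finset.sum_congr rfl fun q hq => a3 q hq μ hμ]
  obtain ⟨W2, b1, b2, b3, b4⟩ := aux_split hK s' D hD A' hA'c (fun μ hμ => by
    rw [mA' μ hμ, ← h μ hμ, hsum]
    have := hpos q0 μ hμ
    linarith)
  have hU2 : IsClopen (⋃ q ∈ s', W2 q) := s'.finite_toSet.isClopen_biUnion b1
  set Z := A' \ ⋃ q ∈ s', W2 q with hZ
  have hZc : IsClopen Z := hA'c.diff hU2
  have mZ : ∀ μ ∈ K, (μ : Measure X).real Z = (μ : Measure X).real (D q0) := by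
    intro μ hμ
    rw [hZ, aux_diff _ s' W2 A' b1 b2 b4, Finset.sum_congr rfl fun q hq => b3 q hq μ hμ,
      mA' μ hμ, ← h μ hμ, hsum]
    ring
  let W : Q → Set X := fun q => if q ∈ P then W1 q else if q = q0 then Z else W2 q
  have w1 : ∀ q ∈ P, W q = W1 q := fun q hq => by simp [W, hq]
  have w0 : W q0 = Z := by simp [W, hq0]
  have w2 : ∀ q ∈ s', W q = W2 q := fun q hq => by
    have : q ≠ q0 ∧ q ∉ P := by simpa [hs'] using hq
    simp [W, this.1, this.2]
  have cases3 : ∀ q, q ∈ P ∨ q = q0 ∨ q ∈ s' := by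
    intro q
    by_cases e : q ∈ P
    · exact Or.inl e
    · by_cases e' : q = q0
      · exact Or.inr (Or.inl e')
      · exact Or.inr (Or.inr (by simp [hs', e, e']))
  have d10 : ∀ q ∈ P, Disjoint (W1 q) A' := fun q hq =>
    (disjoint_sdiff_right).mono_left (subset_biUnion_of_mem (u := W1) hq)
  have d20 : ∀ q ∈ s', Disjoint (W2 q) Z := fun q hq =>
    (disjoint_sdiff_right).mono_left (subset_biUnion_of_mem (u := W2) hq)
  have hZA : Z ⊆ A' := sdiff_subset
  refine ⟨W, ?_, ?_, ?_, ?_, ?_⟩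
  · intro q
    rcases cases3 q with hq | rfl | hq
    · rw [w1 q hq]; exact a1 q hq
    · rw [w0]; exact hZc
    · rw [w2 q hq]; exact b1 q hq
  · intro q
    rcases cases3 q with hq | rfl | hq
    · rw [w1 q hq]; exact a3 q hq
    · rw [w0]; exact mZ
    · rw [w2 q hq]; exact b3 q hq
  · intro p q hpq
    change Disjoint (W p) (W q)
    rcases cases3 p with hp | rfl | hp <;> rcases cases3 q with hq | rfl | hq
    · rw [w1 p hp, w1 q hq]; exact a4 hp hq hpq
    · rw [w1 p hp, w0]; exact (d10 p hp).mono_right hZA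
    · rw [w1 p hp, w2 q hq]; exact (d10 p hp).mono_right (b2 q hq)
    · rw [w1 q hq, w0]; exact ((d10 q hq).mono_right hZA).symm
    · exact absurd rfl hpq
    · rw [w0, w2 q hq]; exact (d20 q hq).symm
    · rw [w1 q hq, w2 p hp]; exact ((d10 q hq).mono_right (b2 p hp)).symm
    · rw [w0, w2 p hp]; exact d20 p hp
    · rw [w2 p hp, w2 q hq]; exact b4 hp hq hpq
  · apply Subset.antisymm
    · refine iUnion_subset fun q => ?_
      rcases cases3 q with hq | rfl | hq
      · rw [w1 q hq]; exact (a2 q hq).trans hYA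
      · rw [w0]; exact hZA.trans sdiff_subset
      · rw [w2 q hq]; exact (b2 q hq).trans sdiff_subset
    · intro x hx
      by_cases x1 : x ∈ ⋃ q ∈ P, W1 q
      · simp only [mem_iUnion] at x1 ⊢
        obtain ⟨q, hq, hx⟩ := x1
        exact ⟨q, by rwa [w1 q hq]⟩
      · by_cases x2 : x ∈ ⋃ q ∈ s', W2 q
        · simp only [mem_iUnion] at x2 ⊢
          obtain ⟨q, hq, hx⟩ := x2
          exact ⟨q, by rwa [w2 q hq]⟩
        · exact mem_iUnion.2 ⟨q0, by rw [w0]; exact ⟨⟨hx, x1⟩, x2⟩⟩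
  · intro q hq
    rw [w1 q hq]; exact a2 q hq

theorem aux_small (A : Set X) (hA : IsClopen A) (hne : A.Nonempty) (ε : ℝ) (hε : 0 < ε) :
    ∃ Y : Set X, IsClopen Y ∧ Y.Nonempty ∧ Y ⊆ A ∧ ∀ B ⊆ Y, Metric.diam B < ε := by
  obtain ⟨x, hx⟩ := hne
  obtain ⟨V, h1, h2, h3⟩ := compact_exists_isClopen_in_isOpen
    (hA.isOpen.inter (Metric.isOpen_ball (x := x) (ε := ε / 3)))
    ⟨hx, Metric.mem_ball_self (by positivity)⟩
  refine ⟨V, h1, ⟨x, h2⟩, h3.trans inter_subset_left, fun B hB => ?_⟩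
  have : Metric.diam B ≤ Metric.diam (Metric.ball x (ε / 3)) :=
    Metric.diam_mono (hB.trans (h3.trans inter_subset_right)) Metric.isBounded_ball
  have := Metric.diam_ball (x := x) (r := ε / 3) (by positivity)
  linarith

end Aux

theorem aux_comb {n : ℕ} (h k : Fin n → ℕ) (hh : ∀ i, 0 < h i) (hk : ∀ i, 0 < k i)
    (i0 i1 : Fin n) (hne : i0 ≠ i1) (H : ℕ) (hH : ∑ i, k i * h i = H) :
    ∃ (_ : 0 < H) (φ : Fin H ≃ (i : Fin n) × (Fin (k i) × Fin (h i))),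
      (∀ (j : Fin H) (i : Fin n) (r : Fin (k i)) (l : Fin (h i)), φ j = ⟨i, (r, l)⟩ →
        ∀ hl : (l : ℕ) + 1 < h i, ∃ hj : (j : ℕ) + 1 < H,
          φ ⟨(j : ℕ) + 1, hj⟩ = ⟨i, (r, ⟨(l : ℕ) + 1, hl⟩)⟩) ∧
      (∀ hj : 0 < H, φ ⟨0, hj⟩ = ⟨i0, (⟨0, hk i0⟩, ⟨0, hh i0⟩)⟩) ∧
      (∀ hj : H - 1 < H, φ ⟨H - 1, hj⟩ =
        ⟨i1, (⟨0, hk i1⟩, ⟨h i1 - 1, Nat.sub_lt (hh i1) one_pos⟩)⟩) := by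
  classical
  let a0 : (i : Fin n) × Fin (k i) := ⟨i0, ⟨0, hk i0⟩⟩
  let a1 : (i : Fin n) × Fin (k i) := ⟨i1, ⟨0, hk i1⟩⟩
  have ha : a0 ≠ a1 := fun e => hne (congrArg Sigma.fst e)
  obtain ⟨N, ⟨e0⟩⟩ := Finite.exists_equiv_fin ((i : Fin n) × Fin (k i))
  have hN : 0 < N := Fin.pos (e0 a0)
  obtain ⟨m, rfl⟩ : ∃ m, N = m + 1 := ⟨N - 1, by omega⟩
  -- reorder
  have hre : ∃ e : Fin (m + 1) ≃ (i : Fin n) × Fin (k i), e 0 = a0 ∧ e (Fin.last m) = a1 := by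
    let e1 := e0.trans (Equiv.swap (e0 a0) 0)
    have h1 : e1 a0 = 0 := by simp [e1]
    let e2 := e1.trans (Equiv.swap (e1 a1) (Fin.last m))
    have h2 : e2 a1 = Fin.last m := by simp [e2]
    have h3 : e2 a0 = 0 := by
      have x1 : e1 a1 ≠ 0 := fun e => ha (e1.injective (h1.trans e.symm))
      have x2 : (0 : Fin (m + 1)) ≠ Fin.last m := by
        intro e
        have : m = 0 := by simpa using (congrArg Fin.val e).symm
        subst this
        exact x1 (Fin.ext (by omega))
      simp only [e2, Equiv.trans_apply]
      rw [h1]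
      exact Equiv.swap_apply_of_ne_of_ne x1.symm x2
    exact ⟨e2.symm, by rw [← h3]; simp, by rw [← h2]; simp⟩
  obtain ⟨e, he0, he1⟩ := hre
  have hsum : ∑ t : Fin (m + 1), h (e t).1 = H := by
    rw [Equiv.sum_comp e (fun x => h x.1), Fintype.sum_sigma, ← hH]
    simp
  subst hsum
  clear hH
  let g : (t : Fin (m + 1)) × Fin (h (e t).1) ≃ (i : Fin n) × (Fin (k i) × Fin (h i)) :=
    (Equiv.sigmaCongrLeft (β := fun x => Fin (h x.1)) e).trans
      ((Equiv.sigmaAssoc (fun i (_ : Fin (k i)) => Fin (h i))).trans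
        (Equiv.sigmaCongrRight fun i => Equiv.sigmaEquivProd _ _))
  have hg : ∀ t l, g ⟨t, l⟩ = ⟨(e t).1, ((e t).2, l)⟩ := fun t l => rfl
  let φ := finSigmaFinEquiv.symm.trans g
  have hφ : ∀ t l, φ (finSigmaFinEquiv ⟨t, l⟩) = ⟨(e t).1, ((e t).2, l)⟩ := fun t l => by
    simp only [φ, Equiv.trans_apply, Equiv.symm_apply_apply, hg]
  have hpos : 0 < ∑ t : Fin (m + 1), h (e t).1 := by
    rw [Fin.sum_univ_succ]
    have := hh (e 0).1
    omega
  refine ⟨hpos, φ, ?_, ?_, ?_⟩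
  · intro j i r l hj hl
    obtain ⟨⟨t, l'⟩, rfl⟩ := finSigmaFinEquiv.surjective j
    rw [hφ] at hj
    have hett : e t = ⟨i, r⟩ := by
      have := congrArg (fun x : (i : Fin n) × (Fin (k i) × Fin (h i)) =>
        (⟨x.1, x.2.1⟩ : (i : Fin n) × Fin (k i))) hj
      simpa using this
    have hgl : (l' : ℕ) = l := by
      have := congrArg (fun x : (i : Fin n) × (Fin (k i) × Fin (h i)) => (x.2.2 : ℕ)) hj
      simpa using this
    have hl' : (l' : ℕ) + 1 < h (e t).1 := by
      rw [hgl]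
      have : (e t).1 = i := congrArg Sigma.fst hett
      rw [this]
      exact hl
    have hval : (finSigmaFinEquiv (⟨t, ⟨l' + 1, hl'⟩⟩ : (t : Fin (m + 1)) × Fin (h (e t).1)) : ℕ)
        = (finSigmaFinEquiv (⟨t, l'⟩ : (t : Fin (m + 1)) × Fin (h (e t).1)) : ℕ) + 1 := by
      rw [finSigmaFinEquiv_apply, finSigmaFinEquiv_apply]
      rfl
    refine ⟨hval ▸ Fin.is_lt _, ?_⟩
    have hF : ∀ pf, (⟨(finSigmaFinEquiv (⟨t, l'⟩ : (t : Fin (m + 1)) × Fin (h (e t).1)) : ℕ) + 1,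
        pf⟩ : Fin (∑ t : Fin (m + 1), h (e t).1)) = finSigmaFinEquiv ⟨t, ⟨l' + 1, hl'⟩⟩ :=
      fun pf => Fin.ext hval.symm
    rw [hF, hφ]
    clear hF hval hj
    generalize e t = x at *
    subst hett
    simp [hgl]
  · intro hj
    have hF : (⟨0, hj⟩ : Fin (∑ t : Fin (m + 1), h (e t).1)) =
        finSigmaFinEquiv (n := fun t => h (e t).1) ⟨0, ⟨0, hh _⟩⟩ := by
      apply Fin.ext
      rw [finSigmaFinEquiv_apply]
      simp only [add_zero]
      symm
      apply Finset.sum_eq_zero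
      intro i
      exact absurd i.2 (by simp)
    rw [hF, hφ]
    clear hF
    generalize e 0 = x at *
    subst he0
    rfl
  · intro hj
    have hF : (⟨∑ t : Fin (m + 1), h (e t).1 - 1, hj⟩ : Fin (∑ t : Fin (m + 1), h (e t).1)) =
        finSigmaFinEquiv (n := fun t => h (e t).1) ⟨Fin.last m, ⟨h (e (Fin.last m)).1 - 1, Nat.sub_lt (hh _) one_pos⟩⟩ := by
      apply Fin.ext
      rw [finSigmaFinEquiv_apply]
      simp only [Fin.sum_univ_castSucc]
      have := hh (e (Fin.last m)).1
      rw [Nat.add_sub_assoc this]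
      rfl
    rw [hF, hφ]
    clear hF
    generalize e (Fin.last m) = x at *
    subst he1
    rfl

theorem aux_build {X : Type*} [MetricSpace X] [MeasurableSpace X] {K : Set (ProbabilityMeasure X)}
    (T : KRPartition X K) (H : ℕ) (hH : 0 < H) (k : Fin T.n → Fin T.n → ℕ)
    (hk : ∀ c i, 0 < k c i) (i0 i1 : Fin T.n)
    (φ : ∀ c, Fin H ≃ (i : Fin T.n) × (Fin (k c i) × Fin (T.height i)))
    (hsucc : ∀ c (j : Fin H) (i : Fin T.n) (r : Fin (k c i)) (l : Fin (T.height i)),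
      φ c j = ⟨i, (r, l)⟩ →
        ∀ hl : (l : ℕ) + 1 < T.height i, ∃ hj : (j : ℕ) + 1 < H,
          φ c ⟨(j : ℕ) + 1, hj⟩ = ⟨i, (r, ⟨(l : ℕ) + 1, hl⟩)⟩)
    (hfirst : ∀ c, ∀ hj : 0 < H, φ c ⟨0, hj⟩ = ⟨i0, (⟨0, hk c i0⟩, ⟨0, T.height_pos i0⟩)⟩)
    (hlast : ∀ c, ∀ hj : H - 1 < H, φ c ⟨H - 1, hj⟩ =
        ⟨i1, (⟨0, hk c i1⟩, ⟨T.height i1 - 1, Nat.sub_lt (T.height_pos i1) one_pos⟩)⟩)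
    (W : ∀ i, Fin (T.height i) → ((c : Fin T.n) × Fin (k c i)) → Set X)
    (hWc : ∀ i l q, IsClopen (W i l q)) (hWne : ∀ i l q, (W i l q).Nonempty)
    (hWd : ∀ i l, Pairwise (Function.onFun Disjoint (W i l)))
    (hWu : ∀ i l, ⋃ q, W i l q = T.atom i l)
    (hWm : ∀ i l c r i' l' r', ∀ μ ∈ K,
      (μ : Measure X) (W i l ⟨c, r⟩) = (μ : Measure X) (W i' l' ⟨c, r'⟩))
    (Y0 Y1 : Set X)
    (hY0 : ∀ c, W i0 ⟨0, T.height_pos i0⟩ ⟨c, ⟨0, hk c i0⟩⟩ ⊆ Y0)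
    (hY1 : ∀ c, W i1 ⟨T.height i1 - 1, Nat.sub_lt (T.height_pos i1) one_pos⟩
      ⟨c, ⟨0, hk c i1⟩⟩ ⊆ Y1) :
    ∃ S : KRPartition X K, ∃ f : Fin S.n ≃ Fin T.n, S.Refines T ∧ S.base ⊆ Y0 ∧ S.top ⊆ Y1 ∧
      (∀ c, S.height c = H) ∧
      (∀ (c : Fin S.n) (i : Fin T.n), ∃ j : ℕ, KRPartition.IsCopyAt S T c i j) ∧
      (∀ c i, KRPartition.numCopies S T c i = k (f c) i) := by
  classical
  have hWs : ∀ i l q, W i l q ⊆ T.atom i l := fun i l q => by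
    rw [← hWu]; exact subset_iUnion _ q
  let V : ∀ c, ((i : Fin T.n) × (Fin (k c i) × Fin (T.height i))) → Set X :=
    fun c p => W p.1 p.2.2 ⟨c, p.2.1⟩
  have hVne : ∀ c p, (V c p).Nonempty := fun c p => hWne _ _ _
  have hloc : ∀ c p i l, V c p ⊆ T.atom i l → ∃ r, p = ⟨i, (r, l)⟩ := by
    rintro c ⟨i', r', l'⟩ i l hs
    by_cases e : (⟨i', l'⟩ : (i : Fin T.n) × Fin (T.height i)) = ⟨i, l⟩
    · cases e
      exact ⟨r', rfl⟩
    · exfalso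
      obtain ⟨x, hx⟩ := hVne c ⟨i', r', l'⟩
      exact Set.disjoint_left.1 (T.disj _ _ e) (hWs _ _ _ hx) (hs hx)
  have hVd : ∀ c c' p p', (c = c' → HEq p p' → False) → Disjoint (V c p) (V c' p') := by
    rintro c c' ⟨i, r, l⟩ ⟨i', r', l'⟩ hne
    by_cases e : (⟨i, l⟩ : (i : Fin T.n) × Fin (T.height i)) = ⟨i', l'⟩
    · cases e
      apply hWd i l
      intro e2
      cases e2
      exact hne rfl HEq.rfl
    · exact (T.disj _ _ e).mono (hWs _ _ _) (hWs _ _ _)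
  let S : KRPartition X K :=
    { n := T.n
      npos := T.npos
      height := fun _ => H
      height_pos := fun _ => hH
      atom := fun c j => V c (φ c j)
      clopen := fun c j => hWc _ _ _
      nonempty := fun c j => hWne _ _ _
      disj := by
        rintro ⟨c, j⟩ ⟨c', j'⟩ hne
        apply hVd
        rintro hc hp
        change c = c' at hc
        subst hc
        have hj : j = j' := (φ c).injective (eq_of_heq hp)
        exact hne (by rw [hj])
      cover := by
        rw [eq_univ_iff_forall]
        intro x
        have hx : x ∈ ⋃ (i) (j), T.atom i j := by rw [T.cover]; trivial
        simp only [mem_iUnion] at hx ⊢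
        obtain ⟨i, l, hx⟩ := hx
        rw [← hWu] at hx
        obtain ⟨⟨c, r⟩, hx⟩ := mem_iUnion.1 hx
        exact ⟨c, (φ c).symm ⟨i, (r, l)⟩, by simpa [V] using hx⟩
      measure_eq := fun c j j' μ hμ => hWm _ _ _ _ _ _ _ μ hμ }
  have hSat : ∀ (c : Fin T.n) (j : Fin H) p, φ c j = p → S.atom c j = V c p := by
    rintro c j p rfl; rfl
  -- climbing
  have hclimb : ∀ (c : Fin T.n) (j : Fin H) i r, φ c j = ⟨i, (r, ⟨0, T.height_pos i⟩)⟩ →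
      ∀ l (hl : l < T.height i), ∃ hj : (j : ℕ) + l < H, φ c ⟨j + l, hj⟩ = ⟨i, (r, ⟨l, hl⟩)⟩ := by
    intro c j i r h0 l
    induction l with
    | zero => intro hl; exact ⟨j.2, h0⟩
    | succ l ih =>
      intro hl
      obtain ⟨hj, e⟩ := ih (by omega)
      exact hsucc c _ i r _ e hl
  have hcopy : ∀ (c : Fin T.n) i r, KRPartition.IsCopyAt S T c i
      ((φ c).symm ⟨i, (r, ⟨0, T.height_pos i⟩)⟩ : Fin H) := by
    intro c i r l hl
    obtain ⟨hj, e⟩ := hclimb c ((φ c).symm ⟨i, (r, ⟨0, T.height_pos i⟩)⟩) i r (by simp) l hl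
    refine ⟨hj, ?_⟩
    rw [hSat c _ _ e]
    exact hWs _ _ _
  refine ⟨S, Equiv.refl _, ⟨?_, ?_, ?_⟩, ?_, ?_, fun _ => rfl, ?_, ?_⟩
  · refine iUnion_subset fun c => ?_
    rw [hSat c ⟨0, hH⟩ _ (hfirst c hH)]
    exact (hWs _ _ _).trans (subset_iUnion (fun i => T.atom i ⟨0, T.height_pos i⟩) i0)
  · intro i l
    refine ⟨{p | S.atom p.1 p.2 ⊆ T.atom i l}, ?_⟩
    apply Subset.antisymm
    · intro x hx
      rw [← hWu] at hx
      obtain ⟨⟨c, r⟩, hx⟩ := mem_iUnion.1 hx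
      have e := hSat c ((φ c).symm ⟨i, (r, l)⟩) ⟨i, (r, l)⟩ (by simp)
      refine mem_iUnion₂.2 ⟨⟨c, (φ c).symm ⟨i, (r, l)⟩⟩, ?_, ?_⟩
      · change S.atom c ((φ c).symm ⟨i, (r, l)⟩) ⊆ _
        rw [e]; exact hWs _ _ _
      · change x ∈ S.atom c ((φ c).symm ⟨i, (r, l)⟩)
        rw [e]; exact hx
    · exact iUnion₂_subset fun p hp => hp
  · intro c j i l hs hl
    obtain ⟨r, hr⟩ := hloc c _ i l hs
    obtain ⟨hj, e⟩ := hsucc c j i r l hr hl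
    refine ⟨hj, ?_⟩
    rw [hSat c _ _ e]
    exact hWs _ _ _
  · refine iUnion_subset fun c => ?_
    rw [hSat c ⟨0, hH⟩ _ (hfirst c hH)]
    exact hY0 c
  · refine iUnion_subset fun c => ?_
    have : H - 1 < H := by omega
    rw [hSat c ⟨H - 1, this⟩ _ (hlast c this)]
    exact hY1 c
  · intro c i
    exact ⟨_, hcopy c i ⟨0, hk c i⟩⟩
  · intro c i
    have : {j : ℕ | KRPartition.IsCopyAt S T c i j} =
        Set.range (fun r : Fin (k c i) =>
          (((φ c).symm ⟨i, (r, ⟨0, T.height_pos i⟩)⟩ : Fin H) : ℕ)) := by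
      ext j
      constructor
      · intro hj
        obtain ⟨hj0, hs⟩ := hj 0 (T.height_pos i)
        obtain ⟨r, hr⟩ := hloc c _ i _ hs
        refine ⟨r, ?_⟩
        simp only
        rw [← hr]
        simp
      · rintro ⟨r, rfl⟩
        exact hcopy c i r
    rw [KRPartition.numCopies, this, ← Set.image_univ, Set.ncard_image_of_injective]
    · simp
    · intro r r' e
      have e' := (φ c).symm.injective (Fin.ext e)
      simpa using e'

/-- given a KR-partition `𝒯` with at least two columns and `ε > 0`, there is a
KR-partition `𝒮` refining `𝒯` whose base and top have diameter `< ε`, all of whose columns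
have the same height, each containing a copy of every column of `𝒯`, and no two of which are
`𝒯`-twins. -/
theorem tower_with_small_base_and_top
    {X : Type*} [MetricSpace X] [CompactSpace X]
    [TotallyDisconnectedSpace X] [Nonempty X] [MeasurableSpace X] [BorelSpace X]
    (hX : Perfect (Set.univ : Set X))
    (K : Set (ProbabilityMeasure X)) (hK : IsDynSimplex K) (hdiv : Divisible K)
    (T : KRPartition X K) (hT : 2 ≤ T.n) (ε : ℝ) (hε : 0 < ε) :
    ∃ S : KRPartition X K, S.Refines T ∧
      Metric.diam S.base < ε ∧ Metric.diam S.top < ε ∧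
      (∀ c c' : Fin S.n, S.height c = S.height c') ∧
      (∀ (c : Fin S.n) (i : Fin T.n), ∃ j : ℕ, KRPartition.IsCopyAt S T c i j) ∧
      (∀ c c' : Fin S.n, c ≠ c' → ¬ KRPartition.Twins S T c c') := by

  classical
  have hn := T.npos
  let h := T.height
  have hh : ∀ i, 0 < h i := T.height_pos
  let B : Fin T.n → Set X := fun i => T.atom i ⟨0, T.height_pos i⟩
  have hB : ∀ μ ∈ K, ∀ i l, (μ : Measure X).real (T.atom i l) = (μ : Measure X).real (B i) :=
    fun μ hμ i l => by simp only [Measure.real, B, T.measure_eq i l ⟨0, T.height_pos i⟩ μ hμ]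
  have hBsum : ∀ μ ∈ K, ∑ i, (h i : ℝ) * (μ : Measure X).real (B i) = 1 := by
    intro μ hμ
    have e1 : (⋃ p : (i : Fin T.n) × Fin (T.height i), T.atom p.1 p.2) = univ := by
      rw [← T.cover, iUnion_sigma]
    have e2 := measureReal_iUnion_fintype (μ := (μ : Measure X))
      (f := fun p : (i : Fin T.n) × Fin (T.height i) => T.atom p.1 p.2)
      (fun p q hpq => T.disj p q hpq) (fun p => (T.clopen p.1 p.2).isOpen.measurableSet)
    rw [e1, Fintype.sum_sigma] at e2
    simp only [hB μ hμ] at e2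
    simpa using e2.symm
  -- multiplicities
  let q : Fin T.n → ℕ := fun i => ∏ j ∈ Finset.univ.erase i, h j
  let P : ℕ := ∏ j, h j
  have hq : ∀ i, 0 < q i := fun i => Finset.prod_pos fun j _ => hh j
  have hP : 0 < P := Finset.prod_pos fun j _ => hh j
  have hqP : ∀ i, q i * h i = P := fun i => Finset.prod_erase_mul _ _ (Finset.mem_univ i)
  have hsm : ∀ p : (i : Fin T.n) × Fin (T.height i), ∃ Y : Set X, IsClopen Y ∧ Y.Nonempty ∧
      Y ⊆ T.atom p.1 p.2 ∧ ∀ B ⊆ Y, Metric.diam B < ε :=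
    fun p => aux_small _ (T.clopen p.1 p.2) (T.nonempty p.1 p.2) ε hε
  choose Y hYc hYne hYs hYd using hsm
  choose δ hδ hδY using fun p => aux_pos hK (Y p) (hYc p) (hYne p)
  choose m hm using fun p => exists_nat_one_div_lt (hδ p)
  choose E hEc hEs hEm using fun i => aux_div hdiv (B i) (T.clopen _ _) (q i) (hq i)
  choose δ' hδ' hδE using fun i => aux_pos hK (B i) (T.clopen _ _) (T.nonempty _ _)
  choose m' hm' using fun i => exists_nat_one_div_lt
    (div_pos (hδ' i) (Nat.cast_pos.2 (hq i) : (0 : ℝ) < q i))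
  let M : ℕ := ∑ p, m p + ∑ i, m' i + 1
  let H : ℕ := P * (M + T.n)
  have hM : 0 < M := Nat.succ_pos _
  have hH : 0 < H := by positivity
  have hMH : M ≤ H := by
    calc M ≤ M + T.n := by omega
      _ ≤ H := Nat.le_mul_of_pos_left _ hP
  have hlt : ∀ (a : ℕ) (η : ℝ), a + 1 ≤ M → 1 / ((a : ℝ) + 1) < η → 1 / (H : ℝ) < η := by
    intro a η ha hη
    refine lt_of_le_of_lt ?_ hη
    apply one_div_le_one_div_of_le (by positivity)
    exact_mod_cast ha.trans hMH
  have hHY : ∀ p, ∀ μ ∈ K, 1 / (H : ℝ) < (μ : Measure X).real (Y p) := by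
    intro p μ hμ
    refine lt_of_lt_of_le (hlt (m p) _ ?_ (hm p)) (hδY p μ hμ)
    have := Finset.single_le_sum (f := m) (fun _ _ => Nat.zero_le _) (Finset.mem_univ p)
    simp only [M]; omega
  have hHE : ∀ i, ∀ μ ∈ K, 1 / (H : ℝ) < (μ : Measure X).real (E i) := by
    intro i μ hμ
    rw [hEm i μ hμ]
    refine lt_of_lt_of_le (hlt (m' i) _ ?_ (hm' i)) ?_
    · have := Finset.single_le_sum (f := m') (fun _ _ => Nat.zero_le _) (Finset.mem_univ i)
      simp only [M]; omega
    · have := hδE i μ hμ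
      gcongr
  obtain ⟨G, hGc, -, hGm⟩ := aux_div hdiv univ isClopen_univ H hH
  have hGm' : ∀ μ ∈ K, (μ : Measure X).real G = 1 / (H : ℝ) := fun μ hμ => by
    rw [hGm μ hμ]; simp
  choose F hFc hFs hFm using fun i => aux_gw hK G (E i) hGc (hEc i)
    (fun μ hμ => by rw [hGm' μ hμ]; exact hHE i μ hμ)
  choose D hDc hDs hDm using fun i => aux_div hdiv (E i \ F i) ((hEc i).diff (hFc i)) M hM
  have hDm' : ∀ i, ∀ μ ∈ K, (μ : Measure X).real (D i) =
      ((μ : Measure X).real (B i) / q i - 1 / (H : ℝ)) / M := by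
    intro i μ hμ
    rw [hDm i μ hμ, measureReal_sdiff (hFs i) (hFc i).isOpen.measurableSet, hFm i μ hμ,
      hGm' μ hμ, hEm i μ hμ]
  have hMr : (0 : ℝ) < M := by exact_mod_cast hM
  have hDpos : ∀ i, ∀ μ ∈ K, 0 < (μ : Measure X).real (D i) := by
    intro i μ hμ
    rw [hDm' i μ hμ, ← hEm i μ hμ]
    exact div_pos (sub_pos.2 (hHE i μ hμ)) hMr
  have hPr : (0 : ℝ) < P := by exact_mod_cast hP
  have hqr : ∀ i, (0 : ℝ) < q i := fun i => by exact_mod_cast hq i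
  have hqPr : ∀ i, (q i : ℝ) * h i = P := fun i => by exact_mod_cast hqP i
  have hHr : (H : ℝ) = P * (M + T.n) := by simp only [H]; push_cast; rfl
  have hDsum : ∀ μ ∈ K, ∑ i, (μ : Measure X).real (D i) = 1 / (H : ℝ) := by
    intro μ hμ
    have e : ∀ i, (μ : Measure X).real (B i) / q i = h i * (μ : Measure X).real (B i) / P := by
      intro i
      rw [← hqPr i]
      have := (hqr i).ne'
      have : (h i : ℝ) ≠ 0 := by exact_mod_cast (hh i).ne'
      field_simp
    simp only [hDm' _ μ hμ, e]
    rw [← Finset.sum_div, Finset.sum_sub_distrib, ← Finset.sum_div, hBsum μ hμ]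
    simp only [Finset.sum_const, Finset.card_univ, Fintype.card_fin, nsmul_eq_mul]
    rw [hHr]
    have : (M : ℝ) + T.n ≠ 0 := by positivity
    field_simp
    ring
  let k : Fin T.n → Fin T.n → ℕ := fun c i => q i * (if i = c then M + 1 else 1)
  have hk : ∀ c i, 0 < k c i := fun c i => Nat.mul_pos (hq i) (by split_ifs <;> omega)
  have hkH : ∀ c, ∑ i, k c i * h i = H := by
    intro c
    have : ∀ i, k c i * h i = P * (if i = c then M + 1 else 1) := fun i => by
      rw [← hqP i]; simp only [k]; ring
    simp only [this, ← Finset.mul_sum]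
    have e : ∀ i, (if i = c then M + 1 else 1) = (if i = c then M else 0) + 1 := fun i => by
      split_ifs <;> rfl
    simp only [e, Finset.sum_add_distrib]
    simp [H]
  have hkD : ∀ i, ∀ μ ∈ K,
      ∑ x : (c : Fin T.n) × Fin (k c i), (μ : Measure X).real (D x.1) =
        (μ : Measure X).real (B i) := by
    intro i μ hμ
    rw [Fintype.sum_sigma]
    simp only [Finset.sum_const, Finset.card_univ, Fintype.card_fin, nsmul_eq_mul]
    have e : ∀ c, (k c i : ℝ) * (μ : Measure X).real (D c) =
        q i * ((if i = c then M * (μ : Measure X).real (D c) else 0) +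
          (μ : Measure X).real (D c)) := fun c => by
      simp only [k]; push_cast; split_ifs <;> ring
    simp only [e, ← Finset.mul_sum, Finset.sum_add_distrib, hDsum μ hμ]
    rw [Finset.sum_ite_eq]
    simp only [Finset.mem_univ, if_true]
    rw [hDm' i μ hμ]
    have := (hqr i).ne'
    field_simp
    ring
  -- split atoms
  have hsplit : ∀ i l, ∃ W : ((c : Fin T.n) × Fin (k c i)) → Set X, (∀ x, IsClopen (W x)) ∧
      (∀ x, ∀ μ ∈ K, (μ : Measure X).real (W x) = (μ : Measure X).real (D x.1)) ∧
      Pairwise (Function.onFun Disjoint W) ∧ (⋃ x, W x = T.atom i l) ∧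
      ∀ c, W ⟨c, ⟨0, hk c i⟩⟩ ⊆ Y ⟨i, l⟩ := by
    intro i l
    let ι : Fin T.n ↪ (c : Fin T.n) × Fin (k c i) :=
      ⟨fun c => ⟨c, ⟨0, hk c i⟩⟩, fun c c' e => congrArg Sigma.fst e⟩
    obtain ⟨W, w1, w2, w3, w4, w5⟩ := aux_split_exact hK (Finset.univ.map ι)
      (fun x : (c : Fin T.n) × Fin (k c i) => D x.1) (fun x => hDc _) (fun x => hDpos _)
      (T.atom i l) (Y ⟨i, l⟩) (T.clopen i l) (hYc _) (hYs ⟨i, l⟩)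
      (fun μ hμ => by rw [hkD i μ hμ]; exact (hB μ hμ i l).symm)
      (fun μ hμ => by
        rw [Finset.sum_map]
        change ∑ c, (μ : Measure X).real (D c) < _
        rw [hDsum μ hμ]
        exact hHY _ μ hμ)
    exact ⟨W, w1, w2, w3, w4, fun c => w5 _ (Finset.mem_map_of_mem ι (Finset.mem_univ c))⟩
  choose W w1 w2 w3 w4 w5 using hsplit
  let i0 : Fin T.n := ⟨0, by omega⟩
  let i1 : Fin T.n := ⟨1, by omega⟩
  have h01 : i0 ≠ i1 := fun e => absurd (congrArg Fin.val e) (by simp [i0, i1])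
  choose _ φ f1 f2 f3 using fun c => aux_comb h (k c) hh (hk c) i0 i1 h01 H (hkH c)
  obtain ⟨S, f, s1, s2, s3, s4, s5, s6⟩ := aux_build T H hH k hk i0 i1 φ f1 f2 f3 W w1
    (fun i l x => by
      obtain ⟨μ, hμ⟩ := hK.1
      have := hDpos x.1 μ hμ
      rw [← w2 i l x μ hμ] at this
      by_contra hc
      rw [not_nonempty_iff_eq_empty.1 hc] at this
      simp at this)
    w3 w4
    (fun i l c r i' l' r' μ hμ => by
      rw [← measureReal_eq_measureReal_iff, w2 _ _ _ μ hμ, w2 _ _ _ μ hμ])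
    (Y ⟨i0, _⟩) (Y ⟨i1, _⟩) (fun c => w5 i0 _ c) (fun c => w5 i1 _ c)
  refine ⟨S, s1, hYd _ _ s2, hYd _ _ s3, fun c c' => by rw [s4, s4], s5, ?_⟩
  intro c c' hcc htw
  have := htw (f c)
  rw [s4, s4, s6, s6] at this
  have hHq : (H : ℚ) ≠ 0 := by exact_mod_cast hH.ne'
  rw [div_left_inj' hHq] at this
  have hkk : k (f c) (f c) = k (f c') (f c) := by exact_mod_cast this
  have hff : f c ≠ f c' := fun e => hcc (f.injective e)
  simp only [k, if_true, if_neg hff] at hkk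
  have := Nat.eq_of_mul_eq_mul_left (hq (f c)) hkk
  omega
end

section
/- Let X be a Cantor space and K a divisible dynamical simplex on X. Let 𝒯 be a KR-partition of X associated to K with at least three columns, and let U, V be clopen subsets of X with U ∼_K V. Then there exists a KR-partition 𝒮 of X associated to K such that: (1) 𝒮 refines 𝒯; (2) 𝒮 is compatible with U and with V (i.e., U and V are unions of atoms of 𝒮); (3) in each column of 𝒮, the number of atoms contained in U equals the number of atoms contained in V; (4) all columns of 𝒮 have the same height, each column of 𝒮 contains at least one copy of every column of 𝒯, and no two columns of 𝒮 are 𝒯-twins. -/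
open MeasureTheory Set
open scoped ENNReal NNReal

structure Sys {X P : Type*} [TopologicalSpace X] (m : P → Set X → ℝ) : Prop where
  ne : Nonempty P
  empty : ∀ μ, m μ ∅ = 0
  univ : ∀ μ, m μ Set.univ = 1
  union : ∀ μ A B, IsClopen A → IsClopen B → Disjoint A B → m μ (A ∪ B) = m μ A + m μ B
  pos : ∀ A, IsClopen A → A.Nonempty → ∃ q : ℚ, 0 < q ∧ ∀ μ, (q : ℝ) ≤ m μ A
  gw : ∀ A B, IsClopen A → IsClopen B → (∀ μ, m μ A < m μ B) →
    ∃ W, IsClopen W ∧ W ⊆ B ∧ ∀ μ, m μ W = m μ A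
  div : ∀ A, IsClopen A → ∀ n : ℕ, 1 ≤ n →
    ∃ W, IsClopen W ∧ W ⊆ A ∧ ∀ μ, m μ W = m μ A / n

/-- positive elements of the value group -/
def GPos {X P : Type*} [TopologicalSpace X] (m : P → Set X → ℝ) (f : P → ℝ) : Prop :=
  ∃ (q : ℚ) (A : Set X), 0 < q ∧ IsClopen A ∧ A.Nonempty ∧ ∀ μ, f μ = q * m μ A

/-- elements of the (rational) value group -/
def GAll {X P : Type*} [TopologicalSpace X] (m : P → Set X → ℝ) (f : P → ℝ) : Prop :=
  ∃ (q : ℚ) (A B : Set X), 0 < q ∧ IsClopen A ∧ IsClopen B ∧ ∀ μ, f μ = q * (m μ A - m μ B)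

namespace Sys

variable {X P : Type*} [TopologicalSpace X] {m : P → Set X → ℝ}

lemma pos' (h : Sys m) {A : Set X} (hA : IsClopen A) (hn : A.Nonempty) (μ : P) : 0 < m μ A := by
  obtain ⟨q, hq, hh⟩ := h.pos A hA hn
  have := hh μ
  have : (0 : ℝ) < q := by exact_mod_cast hq
  linarith

lemma nonneg (h : Sys m) {A : Set X} (hA : IsClopen A) (μ : P) : 0 ≤ m μ A := by
  rcases A.eq_empty_or_nonempty with rfl | hn
  · rw [h.empty]
  · exact (h.pos' hA hn μ).le

lemma diff (h : Sys m) {A B : Set X} (hA : IsClopen A) (hB : IsClopen B) (hs : B ⊆ A) (μ : P) :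
    m μ (A \ B) = m μ A - m μ B := by
  have := h.union μ B (A \ B) hB (hA.diff hB) Set.disjoint_sdiff_right
  rw [Set.union_sdiff_cancel hs] at this
  linarith

lemma mono (h : Sys m) {A B : Set X} (hA : IsClopen A) (hB : IsClopen B) (hs : B ⊆ A) (μ : P) :
    m μ B ≤ m μ A := by
  have := h.diff hA hB hs μ
  have := h.nonneg (hA.diff hB) μ
  linarith

lemma le_one (h : Sys m) {A : Set X} (hA : IsClopen A) (μ : P) : m μ A ≤ 1 := by
  rw [← h.univ μ]
  exact h.mono isClopen_univ hA (Set.subset_univ _) μ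

lemma nonempty_of_pos (h : Sys m) {A : Set X} {μ : P} (hp : 0 < m μ A) : A.Nonempty := by
  rcases A.eq_empty_or_nonempty with rfl | hn
  · rw [h.empty] at hp; exact absurd hp (lt_irrefl _)
  · exact hn

lemma eq_empty_of_zero (h : Sys m) {A : Set X} (hA : IsClopen A) {μ : P} (hp : m μ A = 0) :
    A = ∅ := by
  rcases A.eq_empty_or_nonempty with rfl | hn
  · rfl
  · have := h.pos' hA hn μ; linarith

lemma mul_carve (h : Sys m) {E F : Set X} (hE : IsClopen E) (hF : IsClopen F) (a : ℕ)
    (hlt : ∀ μ, a * m μ E < m μ F) :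
    ∃ W, IsClopen W ∧ W ⊆ F ∧ ∀ μ, m μ W = a * m μ E := by
  induction a with
  | zero => exact ⟨∅, isClopen_empty, Set.empty_subset _, fun μ => by simp [h.empty]⟩
  | succ a ih =>
    have hlt' : ∀ μ, a * m μ E < m μ F := fun μ => by
      have := hlt μ; have := h.nonneg hE μ; push_cast at *; linarith
    obtain ⟨W, hW, hWF, hWm⟩ := ih hlt'
    obtain ⟨W', hW', hWF', hWm'⟩ := h.gw E (F \ W) hE (hF.diff hW) (fun μ => by
      rw [h.diff hF hW hWF, hWm]; have := hlt μ; push_cast at this; linarith)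
    refine ⟨W ∪ W', hW.union hW', Set.union_subset hWF (hWF'.trans Set.sdiff_subset), fun μ => ?_⟩
    rw [h.union μ W W' hW hW' (Set.disjoint_of_subset_right hWF' Set.disjoint_sdiff_right),
      hWm, hWm']
    push_cast; ring

lemma rat_carve (h : Sys m) {E F : Set X} (hE : IsClopen E) (hF : IsClopen F) (q : ℚ) (hq : 0 ≤ q)
    (hlt : ∀ μ, q * m μ E < m μ F) :
    ∃ W, IsClopen W ∧ W ⊆ F ∧ ∀ μ, m μ W = q * m μ E := by
  obtain ⟨E', hE', -, hm⟩ := h.div E hE q.den q.den_pos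
  have key : ∀ μ, (q : ℝ) * m μ E = (q.num.toNat : ℕ) * m μ E' := by
    intro μ
    rw [hm]
    have h1 : ((q.num.toNat : ℕ) : ℝ) = (q.num : ℝ) := by
      have : ((q.num.toNat : ℕ) : ℤ) = q.num := Int.toNat_of_nonneg (Rat.num_nonneg.2 hq)
      exact_mod_cast this
    rw [h1]
    have h2 : (q : ℝ) = q.num / q.den := by exact_mod_cast (Rat.num_div_den q).symm
    rw [h2]; ring
  obtain ⟨W, a, b, c⟩ := h.mul_carve hE' hF q.num.toNat (fun μ => by rw [← key]; exact hlt μ)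
  exact ⟨W, a, b, fun μ => by rw [c, key]⟩

lemma carve (h : Sys m) {f : P → ℝ} (hf : GPos m f) {F : Set X} (hF : IsClopen F)
    (hlt : ∀ μ, f μ < m μ F) : ∃ W, IsClopen W ∧ W ⊆ F ∧ ∀ μ, m μ W = f μ := by
  obtain ⟨q, A, hq, hA, -, hfA⟩ := hf
  obtain ⟨W, a, b, c⟩ := h.rat_carve hA hF q hq.le (fun μ => by rw [← hfA]; exact hlt μ)
  exact ⟨W, a, b, fun μ => by rw [c, hfA]⟩

lemma gpos_pos (h : Sys m) {f : P → ℝ} (hf : GPos m f) (μ : P) : 0 < f μ := by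
  obtain ⟨q, A, hq, hA, hn, hfA⟩ := hf
  rw [hfA]
  have : (0 : ℝ) < q := by exact_mod_cast hq
  exact mul_pos this (h.pos' hA hn μ)

lemma gpos_lower (h : Sys m) {f : P → ℝ} (hf : GPos m f) :
    ∃ r : ℚ, 0 < r ∧ ∀ μ, (r : ℝ) < f μ := by
  obtain ⟨q, A, hq, hA, hn, hfA⟩ := hf
  obtain ⟨s, hs, hh⟩ := h.pos A hA hn
  refine ⟨q * s / 2, by positivity, fun μ => ?_⟩
  rw [hfA]
  have h1 : (0 : ℝ) < q := by exact_mod_cast hq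
  have h2 : (0 : ℝ) < s := by exact_mod_cast hs
  have := mul_le_mul_of_nonneg_left (hh μ) h1.le
  have := mul_pos h1 h2
  push_cast
  linarith

lemma gpos_upper (h : Sys m) {f : P → ℝ} (hf : GPos m f) :
    ∃ r : ℚ, 0 < r ∧ ∀ μ, f μ ≤ (r : ℝ) := by
  obtain ⟨q, A, hq, hA, hn, hfA⟩ := hf
  refine ⟨q, hq, fun μ => ?_⟩
  rw [hfA]
  have h1 : (0 : ℝ) < q := by exact_mod_cast hq
  nlinarith [h.le_one hA μ]

lemma gpos_all (h : Sys m) {f : P → ℝ} (hf : GPos m f) : GAll m f := by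
  obtain ⟨q, A, hq, hA, hn, hfA⟩ := hf
  exact ⟨q, A, ∅, hq, hA, isClopen_empty, fun μ => by rw [hfA, h.empty, sub_zero]⟩

lemma gpos_clopen {A : Set X} (hA : IsClopen A) (hn : A.Nonempty) :
    GPos m (fun μ => m μ A) :=
  ⟨1, A, one_pos, hA, hn, fun μ => by simp⟩

lemma gpos_smul {f : P → ℝ} (hf : GPos m f) (r : ℚ) (hr : 0 < r) :
    GPos m (fun μ => r * f μ) := by
  obtain ⟨q, A, hq, hA, hn, hfA⟩ := hf
  exact ⟨r * q, A, by positivity, hA, hn, fun μ => by simp only [hfA]; push_cast; ring⟩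

lemma gall_pos (h : Sys m) {f : P → ℝ} (hf : GAll m f) (hp : ∀ μ, 0 < f μ) : GPos m f := by
  obtain ⟨q, A, B, hq, hA, hB, hfA⟩ := hf
  have h1 : (0 : ℝ) < q := by exact_mod_cast hq
  have hlt : ∀ μ, m μ B < m μ A := fun μ => by
    have := hp μ; rw [hfA] at this
    have := (mul_pos_iff_of_pos_left h1).1 this
    linarith
  obtain ⟨W, hW, hWA, hWm⟩ := h.gw B A hB hA hlt
  have key : ∀ μ, m μ (A \ W) = m μ A - m μ B := fun μ => by rw [h.diff hA hW hWA, hWm]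
  obtain ⟨μ₀⟩ := h.ne
  refine ⟨q, A \ W, hq, hA.diff hW, h.nonempty_of_pos (μ := μ₀) ?_, fun μ => by rw [hfA, key]⟩
  rw [key]; linarith [hlt μ₀]

lemma two_add (h : Sys m) {A B : Set X} (hA : IsClopen A) (hB : IsClopen B) (p q : ℚ)
    (hp : 0 ≤ p) (hq : 0 ≤ q) :
    ∃ W, IsClopen W ∧ ∀ μ, (p + q + 1 : ℝ) * m μ W = p * m μ A + q * m μ B := by
  have h1 : (0 : ℝ) ≤ p := by exact_mod_cast hp
  have h2 : (0 : ℝ) ≤ q := by exact_mod_cast hq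
  have e1 : ∀ μ, ((p / (p + q + 1) : ℚ) : ℝ) * m μ A ≤ p / (p + q + 1) := fun μ => by
    push_cast
    exact mul_le_of_le_one_right (by positivity) (h.le_one hA μ)
  have e2 : ∀ μ, ((q / (p + q + 1) : ℚ) : ℝ) * m μ B ≤ q / (p + q + 1) := fun μ => by
    push_cast
    exact mul_le_of_le_one_right (by positivity) (h.le_one hB μ)
  have e3 : (p : ℝ) / (p + q + 1) + q / (p + q + 1) < 1 := by
    rw [← add_div, div_lt_one (by positivity)]; linarith
  have e4 : (0 : ℝ) ≤ q / (p + q + 1) := by positivity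
  obtain ⟨W, hW, -, hWm⟩ := h.rat_carve hA isClopen_univ (p / (p + q + 1)) (by positivity)
    (fun μ => by rw [h.univ]; linarith [e1 μ])
  obtain ⟨W', hW', hs, hWm'⟩ := h.rat_carve hB hW.compl (q / (p + q + 1)) (by positivity)
    (fun μ => by
      rw [Set.compl_eq_univ_sdiff, h.diff isClopen_univ hW (Set.subset_univ _), h.univ, hWm]
      linarith [e1 μ, e2 μ])
  refine ⟨W ∪ W', hW.union hW', fun μ => ?_⟩
  rw [h.union μ W W' hW hW' (Set.disjoint_of_subset_right hs disjoint_compl_right), hWm, hWm']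
  push_cast
  field_simp

lemma gall_add (h : Sys m) {f g : P → ℝ} (hf : GAll m f) (hg : GAll m g) :
    GAll m (fun μ => f μ + g μ) := by
  obtain ⟨p, A, B, hp, hA, hB, hfA⟩ := hf
  obtain ⟨q, A', B', hq, hA', hB', hgA⟩ := hg
  obtain ⟨W, hW, e⟩ := h.two_add hA hA' p q hp.le hq.le
  obtain ⟨W', hW', e'⟩ := h.two_add hB hB' p q hp.le hq.le
  refine ⟨p + q + 1, W, W', by positivity, hW, hW', fun μ => ?_⟩
  have := e μ
  have := e' μ
  simp only [hfA, hgA]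
  push_cast
  linarith

lemma gall_zero : GAll m (fun _ => 0) :=
  ⟨1, ∅, ∅, one_pos, isClopen_empty, isClopen_empty, fun μ => by simp⟩

lemma gall_smul {f : P → ℝ} (hf : GAll m f) (r : ℚ) : GAll m (fun μ => r * f μ) := by
  obtain ⟨p, A, B, hp, hA, hB, hfA⟩ := hf
  rcases lt_trichotomy r 0 with hr | rfl | hr
  · exact ⟨-r * p, B, A, mul_pos (by linarith) hp, hB, hA, fun μ => by
      simp only [hfA]; push_cast; ring⟩
  · simpa using gall_zero
  · exact ⟨r * p, A, B, mul_pos hr hp, hA, hB, fun μ => by simp only [hfA]; push_cast; ring⟩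

lemma gall_const (h : Sys m) (r : ℚ) : GAll m (fun _ => (r : ℝ)) := by
  have : GAll m (fun _ => (1 : ℝ)) := ⟨1, Set.univ, ∅, one_pos, isClopen_univ, isClopen_empty,
    fun μ => by simp [h.univ, h.empty]⟩
  simpa using gall_smul this r

/-- exact carving of a clopen set into pieces of prescribed values -/
lemma carve_finset (h : Sys m) {J : Type*} [DecidableEq J] (f : J → P → ℝ)
    (hf : ∀ j, GPos m (f j)) (s : Finset J) :
    ∀ F : Set X, IsClopen F → (∀ μ, ∑ j ∈ s, f j μ = m μ F) →
    ∃ W : J → Set X, (∀ j ∈ s, IsClopen (W j) ∧ (W j).Nonempty ∧ ∀ μ, m μ (W j) = f j μ) ∧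
      (∀ i ∈ s, ∀ j ∈ s, i ≠ j → Disjoint (W i) (W j)) ∧ (⋃ j ∈ s, W j) = F := by
  obtain ⟨μ₀⟩ := h.ne
  induction s using Finset.induction_on with
  | empty =>
    intro F hF hs
    have := h.eq_empty_of_zero hF (μ := μ₀) (by rw [← hs]; simp)
    subst this
    exact ⟨fun _ => ∅, by simp, by simp, by simp⟩
  | insert a s ha ih =>
    intro F hF hs
    rcases s.eq_empty_or_nonempty with rfl | hne
    · have hs' : ∀ μ, f a μ = m μ F := by simpa using hs
      refine ⟨fun _ => F, ?_, ?_, by simp⟩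
      · intro j hj
        simp at hj; subst hj
        exact ⟨hF, h.nonempty_of_pos (μ := μ₀) (by rw [← hs']; exact h.gpos_pos (hf j) _),
          fun μ => (hs' μ).symm⟩
      · intro i hi j hj hij
        simp at hi hj; subst hi; subst hj; exact absurd rfl hij
    · have hs' : ∀ μ, f a μ + ∑ j ∈ s, f j μ = m μ F := fun μ => by
        have := hs μ; rwa [Finset.sum_insert ha] at this
      have hp : ∀ μ, 0 < ∑ j ∈ s, f j μ := fun μ =>
        Finset.sum_pos (fun j _ => h.gpos_pos (hf j) μ) hne
      obtain ⟨A, hA, hAF, hAm⟩ := h.carve (hf a) hF (fun μ => by linarith [hs' μ, hp μ])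
      obtain ⟨W, h1, h2, h3⟩ := ih (F \ A) (hF.diff hA) (fun μ => by
        rw [h.diff hF hA hAF, hAm]; linarith [hs' μ])
      have hsub : ∀ j ∈ s, W j ⊆ F \ A := fun j hj => by
        rw [← h3]; exact Set.subset_biUnion_of_mem (u := W) hj
      have hdj : ∀ j ∈ s, Disjoint A (W j) := fun j hj =>
        Set.disjoint_of_subset_right (hsub j hj) Set.disjoint_sdiff_right
      have hna : ∀ j ∈ s, j ≠ a := fun j hj e => ha (e ▸ hj)
      refine ⟨Function.update W a A, ?_, ?_, ?_⟩
      · intro j hj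
        rcases Finset.mem_insert.1 hj with rfl | hj
        · rw [Function.update_self]
          exact ⟨hA, h.nonempty_of_pos (μ := μ₀) (by rw [hAm]; exact h.gpos_pos (hf _) _), hAm⟩
        · rw [Function.update_of_ne (hna j hj)]; exact h1 j hj
      · intro i hi j hj hij
        rcases Finset.mem_insert.1 hi with hi | hi <;> rcases Finset.mem_insert.1 hj with hj | hj
        · exact absurd (hi.trans hj.symm) hij
        · rw [hi, Function.update_self, Function.update_of_ne (hna j hj)]; exact hdj j hj
        · rw [hj, Function.update_self, Function.update_of_ne (hna i hi)]; exact (hdj i hi).symm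
        · rw [Function.update_of_ne (hna j hj), Function.update_of_ne (hna i hi)]
          exact h2 i hi j hj hij
      · rw [Finset.set_biUnion_insert, Function.update_self]
        have : (⋃ j ∈ s, Function.update W a A j) = ⋃ j ∈ s, W j := by
          refine Set.iUnion₂_congr fun j hj => ?_
          rw [Function.update_of_ne (hna j hj)]
        rw [this, h3, Set.union_sdiff_cancel hAF]

lemma carve_fintype (h : Sys m) {J : Type*} [Fintype J] (f : J → P → ℝ)
    (hf : ∀ j, GPos m (f j)) (F : Set X) (hF : IsClopen F) (hs : ∀ μ, ∑ j, f j μ = m μ F) :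
    ∃ W : J → Set X, (∀ j, IsClopen (W j)) ∧ (∀ j, (W j).Nonempty) ∧
      (∀ j μ, m μ (W j) = f j μ) ∧ (∀ i j, i ≠ j → Disjoint (W i) (W j)) ∧ (⋃ j, W j) = F := by
  classical
  obtain ⟨W, h1, h2, h3⟩ := h.carve_finset f hf Finset.univ F hF hs
  exact ⟨W, fun j => (h1 j (Finset.mem_univ _)).1, fun j => (h1 j (Finset.mem_univ _)).2.1,
    fun j => (h1 j (Finset.mem_univ _)).2.2,
    fun i j => h2 i (Finset.mem_univ _) j (Finset.mem_univ _), by simpa using h3⟩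

lemma sum_iUnion (h : Sys m) {J : Type*} [DecidableEq J] (W : J → Set X) (s : Finset J)
    (hc : ∀ j, IsClopen (W j)) (hd : ∀ i j, i ≠ j → Disjoint (W i) (W j)) (μ : P) :
    m μ (⋃ j ∈ s, W j) = ∑ j ∈ s, m μ (W j) := by
  induction s using Finset.induction_on with
  | empty => simp [h.empty]
  | insert a s ha ih =>
    have hu : IsClopen (⋃ j ∈ s, W j) := isClopen_biUnion_finset fun j _ => hc j
    rw [Finset.set_biUnion_insert, Finset.sum_insert ha, h.union μ _ _ (hc a) hu, ih]
    rw [Set.disjoint_iUnion₂_right]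
    exact fun j hj => hd a j (fun e => ha (e ▸ hj))

lemma sum_fintype (h : Sys m) {J : Type*} [Fintype J] (W : J → Set X)
    (hc : ∀ j, IsClopen (W j)) (hd : ∀ i j, i ≠ j → Disjoint (W i) (W j)) (μ : P) :
    m μ (⋃ j, W j) = ∑ j, m μ (W j) := by
  classical
  simpa using h.sum_iUnion W Finset.univ hc hd μ

end Sys

/-- nonnegative elements of the value group -/
def GNN {X P : Type*} [TopologicalSpace X] (m : P → Set X → ℝ) (f : P → ℝ) : Prop :=
  ∃ (q : ℚ) (A : Set X), 0 ≤ q ∧ IsClopen A ∧ ∀ μ, f μ = q * m μ A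

namespace Sys

variable {X P : Type*} [TopologicalSpace X] {m : P → Set X → ℝ}

lemma gnn_dich (h : Sys m) {f : P → ℝ} (hf : GNN m f) : GPos m f ∨ ∀ μ, f μ = 0 := by
  obtain ⟨q, A, hq, hA, hfA⟩ := hf
  rcases A.eq_empty_or_nonempty with rfl | hn
  · right; intro μ; rw [hfA, h.empty, mul_zero]
  · rcases hq.eq_or_lt with rfl | hq
    · right; intro μ; rw [hfA]; simp
    · exact Or.inl ⟨q, A, hq, hA, hn, hfA⟩

lemma gpos_nn {f : P → ℝ} (hf : GPos m f) : GNN m f := by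
  obtain ⟨q, A, hq, hA, -, hfA⟩ := hf
  exact ⟨q, A, hq.le, hA, hfA⟩

lemma gnn_nonneg (h : Sys m) {f : P → ℝ} (hf : GNN m f) (μ : P) : 0 ≤ f μ := by
  rcases h.gnn_dich hf with hp | hp
  · exact (h.gpos_pos hp μ).le
  · exact (hp μ).ge

lemma gnn_smul {f : P → ℝ} (hf : GNN m f) (r : ℚ) (hr : 0 ≤ r) :
    GNN m (fun μ => r * f μ) := by
  obtain ⟨q, A, hq, hA, hfA⟩ := hf
  exact ⟨r * q, A, by positivity, hA, fun μ => by simp only [hfA]; push_cast; ring⟩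

lemma gnn_clopen {A : Set X} (hA : IsClopen A) : GNN m (fun μ => m μ A) :=
  ⟨1, A, zero_le_one, hA, fun μ => by simp⟩

lemma gnn_add (h : Sys m) {f g : P → ℝ} (hf : GNN m f) (hg : GNN m g) :
    GNN m (fun μ => f μ + g μ) := by
  obtain ⟨p, A, hp, hA, hfA⟩ := hf
  obtain ⟨q, A', hq, hA', hgA⟩ := hg
  obtain ⟨W, hW, e⟩ := h.two_add hA hA' p q hp hq
  refine ⟨p + q + 1, W, by positivity, hW, fun μ => ?_⟩
  simp only [hfA, hgA]
  push_cast
  rw [e]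

lemma gnn_sum (h : Sys m) {J : Type*} (f : J → P → ℝ) (hf : ∀ j, GNN m (f j)) (s : Finset J) :
    GNN m (fun μ => ∑ j ∈ s, f j μ) := by
  classical
  induction s using Finset.induction_on with
  | empty => exact ⟨0, ∅, le_rfl, isClopen_empty, fun μ => by simp⟩
  | insert a s ha ih =>
    simp only [Finset.sum_insert ha]
    exact h.gnn_add (hf a) ih

lemma sum_subtype_eq {J : Type*} [Fintype J] (p : J → Prop) [DecidablePred p] (F : J → ℝ)
    (hF : ∀ j, ¬ p j → F j = 0) : ∑ j : {j // p j}, F j = ∑ j, F j := by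
  rw [← Finset.sum_filter_of_ne (p := p) (fun j _ hj => by by_contra hp; exact hj (hF j hp))]
  exact (Finset.sum_subtype _ (by simp) F).symm

lemma carve_nn (h : Sys m) {J : Type*} [Fintype J] (f : J → P → ℝ)
    (hf : ∀ j, GNN m (f j)) (F : Set X) (hF : IsClopen F) (hs : ∀ μ, ∑ j, f j μ = m μ F) :
    ∃ W : J → Set X, (∀ j, IsClopen (W j)) ∧ 
      (∀ j μ, m μ (W j) = f j μ) ∧ (∀ i j, i ≠ j → Disjoint (W i) (W j)) ∧ (⋃ j, W j) = F := by
  classical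
  have hz : ∀ j, ¬ GPos m (f j) → ∀ μ, f j μ = 0 := fun j hj =>
    (h.gnn_dich (hf j)).resolve_left hj
  obtain ⟨W, h1, -, h3, h4, h5⟩ := h.carve_fintype (J := {j // GPos m (f j)}) (fun j => f j)
    (fun j => j.2) F hF (fun μ => by
      rw [← hs]
      exact sum_subtype_eq (fun j => GPos m (f j)) (fun j => f j μ) (fun j hj => hz j hj μ))
  refine ⟨fun j => if hj : GPos m (f j) then W ⟨j, hj⟩ else ∅, ?_, ?_, ?_, ?_⟩
  · intro j
    dsimp only
    split_ifs with hj
    · exact h1 _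
    · exact isClopen_empty
  · intro j μ
    dsimp only
    split_ifs with hj
    · exact h3 _ _
    · rw [h.empty, hz j hj]
  · intro i j hij
    dsimp only
    split_ifs with hi hj
    · exact h4 _ _ (by simpa using hij)
    all_goals simp
  · rw [← h5]
    ext x
    simp only [Set.mem_iUnion]
    constructor
    · rintro ⟨j, hj⟩
      split_ifs at hj with hp
      · exact ⟨_, hj⟩
      · exact absurd hj (Set.notMem_empty _)
    · rintro ⟨j, hj⟩
      exact ⟨j.1, by rw [dif_pos j.2]; exact hj⟩

lemma ehs_step (h : Sys m) {C : Type} [Fintype C] (z : C → P → ℝ) (hz : ∀ c, GNN m (z c))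
    (a : C → ℚ) (ha : ∀ μ, ∑ c, (a c : ℝ) * z c μ = 0) :
    ∃ (D : Type) (_ : Fintype D) (y : D → P → ℝ) (u : D → C → ℚ),
      (∀ d, GNN m (y d)) ∧ (∀ d c, 0 ≤ u d c) ∧ (∀ d, ∑ c, a c * u d c = 0) ∧
      ∀ c μ, z c μ = ∑ d, (u d c : ℝ) * y d μ := by
  classical
  -- positive and negative parts
  have hf : ∀ c, GNN m (fun μ => ((max (a c) 0 : ℚ) : ℝ) * z c μ) := fun c =>
    gnn_smul (hz c) _ (le_max_right _ _)
  have hg : ∀ c, GNN m (fun μ => ((max (-a c) 0 : ℚ) : ℝ) * z c μ) := fun c =>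
    gnn_smul (hz c) _ (le_max_right _ _)
  obtain ⟨q, A, hq, hA, hqA⟩ := h.gnn_sum _ hf Finset.univ
  replace hqA : ∀ μ, ∑ c, ((max (a c) 0 : ℚ) : ℝ) * z c μ = q * m μ A := hqA
  have hq' : (0 : ℝ) ≤ q := by exact_mod_cast hq
  set ε : ℚ := 1 / (q + 1) with hε
  have hεp : 0 < ε := by positivity
  have hεp' : (0 : ℝ) < ε := by exact_mod_cast hεp
  obtain ⟨F, hF, -, hFm⟩ := h.rat_carve hA isClopen_univ (ε * q) (by positivity) (fun μ => by
    rw [h.univ]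
    have : ((ε * q : ℚ) : ℝ) < 1 := by
      rw [hε]; push_cast; rw [one_div_mul_eq_div, div_lt_one (by positivity)]; linarith
    have h1 : (0 : ℝ) ≤ ((ε * q : ℚ) : ℝ) := by positivity
    nlinarith [h.le_one hA μ])
  have hFm1 : ∀ μ, ∑ c, (ε : ℝ) * (((max (a c) 0 : ℚ) : ℝ) * z c μ) = m μ F := fun μ => by
    rw [← Finset.mul_sum, hqA, hFm]; push_cast; ring
  have hFm2 : ∀ μ, ∑ c, (ε : ℝ) * (((max (-a c) 0 : ℚ) : ℝ) * z c μ) = m μ F := fun μ => by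
    rw [← hFm1, ← sub_eq_zero, ← Finset.sum_sub_distrib, ← mul_zero (-ε : ℝ), ← ha μ,
      Finset.mul_sum]
    refine Finset.sum_congr rfl fun c _ => ?_
    have : max (-a c) 0 - max (a c) 0 = - a c := by
      rcases le_total (a c) 0 with hc | hc
      · rw [max_eq_left (by linarith), max_eq_right hc]; ring
      · rw [max_eq_right (by linarith), max_eq_left hc]; ring
    have : ((max (-a c) 0 : ℚ) : ℝ) - ((max (a c) 0 : ℚ) : ℝ) = - a c := by exact_mod_cast this
    rw [← mul_sub, ← sub_mul, this]; ring
  obtain ⟨W, w1, w2, w3, w4⟩ := h.carve_nn _ (fun c => gnn_smul (hf c) ε hεp.le) F hF hFm1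
  obtain ⟨V, v1, v2, v3, v4⟩ := h.carve_nn _ (fun c => gnn_smul (hg c) ε hεp.le) F hF hFm2
  have hWV : ∀ p μ, m μ (W p) = ∑ r, m μ (W p ∩ V r) := fun p μ => by
    rw [← h.sum_fintype _ (fun r => (w1 p).inter (v1 r)) (fun i j hij =>
      (v3 i j hij).mono Set.inter_subset_right Set.inter_subset_right), ← Set.inter_iUnion, v4,
      Set.inter_eq_left.2]
    rw [← w4]; exact Set.subset_iUnion W p
  have hVW : ∀ r μ, m μ (V r) = ∑ p, m μ (W p ∩ V r) := fun r μ => by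
    rw [← h.sum_fintype _ (fun p => (w1 p).inter (v1 r)) (fun i j hij =>
      (w3 i j hij).mono Set.inter_subset_left Set.inter_subset_left), ← Set.iUnion_inter, w4,
      Set.inter_eq_right.2]
    rw [← v4]; exact Set.subset_iUnion V r
  have hWe : ∀ p, ¬ 0 < a p → W p = ∅ := fun p hp => by
    obtain ⟨μ₀⟩ := h.ne
    refine h.eq_empty_of_zero (w1 p) (μ := μ₀) ?_
    rw [w2, max_eq_right (not_lt.1 hp)]; simp
  have hVe : ∀ p, ¬ a p < 0 → V p = ∅ := fun p hp => by
    obtain ⟨μ₀⟩ := h.ne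
    refine h.eq_empty_of_zero (v1 p) (μ := μ₀) ?_
    rw [v2, max_eq_right (by linarith [not_lt.1 hp])]; simp
  refine ⟨(C × C) ⊕ C, inferInstance,
    Sum.elim (fun d μ => ((1 / ε : ℚ) : ℝ) * m μ (W d.1 ∩ V d.2)) z,
    Sum.elim (fun d c => if 0 < a d.1 ∧ a d.2 < 0 then
        (if c = d.1 then 1 / a d.1 else 0) + (if c = d.2 then 1 / (- a d.2) else 0) else 0)
      (fun d c => if c = d ∧ a d = 0 then 1 else 0), ?_, ?_, ?_, ?_⟩
  · rintro (d | d)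
    · exact gnn_smul (gnn_clopen ((w1 _).inter (v1 _))) _ (by positivity)
    · exact hz d
  · rintro (d | d) c
    · simp only [Sum.elim_inl]
      split_ifs with h1 h2 h3 h3 <;> try rfl
      all_goals
        have e1 : 0 < 1 / a d.1 := one_div_pos.2 h1.1
        have e2 : 0 < 1 / (- a d.2) := one_div_pos.2 (by linarith [h1.2])
        linarith
    · simp only [Sum.elim_inr]
      split_ifs <;> norm_num
  · rintro (d | d)
    · simp only [Sum.elim_inl]
      split_ifs with h1
      · simp only [mul_add, mul_ite, mul_zero, Finset.sum_add_distrib, Finset.sum_ite_eq',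
          Finset.mem_univ, if_true]
        have := h1.1.ne'
        have := h1.2.ne
        field_simp
        norm_num
      · simp
    · simp only [Sum.elim_inr]
      refine Finset.sum_eq_zero fun c _ => ?_
      split_ifs with h1
      · rw [h1.1, h1.2, zero_mul]
      · simp
  · intro c μ
    rw [Fintype.sum_sum_type]
    simp only [Sum.elim_inl, Sum.elim_inr]
    have s2 : ∑ x, (((if c = x ∧ a x = 0 then 1 else 0 : ℚ)) : ℝ) * z x μ
        = if a c = 0 then z c μ else 0 := by
      rw [Finset.sum_eq_single c]
      · by_cases hc : a c = 0 <;> simp [hc]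
      · intro b _ hb
        rw [if_neg (fun hh => hb hh.1.symm)]; simp
      · simp
    have s1 : ∑ d : C × C, (((if 0 < a d.1 ∧ a d.2 < 0 then
        (if c = d.1 then 1 / a d.1 else 0) + (if c = d.2 then 1 / (- a d.2) else 0) else 0 : ℚ))
          : ℝ) * (((1 / ε : ℚ) : ℝ) * m μ (W d.1 ∩ V d.2)) =
        (1 / ε : ℝ) * (1 / a c * m μ (W c)) + (1 / ε : ℝ) * (1 / (-a c) * m μ (V c)) := by
      rw [hWV, hVW, Fintype.sum_prod_type]
      have : ∀ p r, (((if 0 < a p ∧ a r < 0 then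
        (if c = p then 1 / a p else 0) + (if c = r then 1 / (- a r) else 0) else 0 : ℚ))
          : ℝ) * (((1 / ε : ℚ) : ℝ) * m μ (W p ∩ V r)) =
          (if c = p then (1 / ε : ℝ) * (1 / a p * m μ (W p ∩ V r)) else 0) +
          (if c = r then (1 / ε : ℝ) * (1 / (-a r) * m μ (W p ∩ V r)) else 0) := by
        intro p r
        by_cases hpr : 0 < a p ∧ a r < 0
        · rw [if_pos hpr]
          by_cases h1 : c = p <;> by_cases h2 : c = r <;>
            simp only [h1, h2, if_true, if_false] <;> push_cast <;> (try split_ifs) <;> push_cast <;> ring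
        · have he : W p ∩ V r = ∅ := by
            rcases not_and_or.1 hpr with h1 | h1
            · rw [hWe p h1, Set.empty_inter]
            · rw [hVe r h1, Set.inter_empty]
          rw [he, h.empty]; simp
      simp only [this, Finset.sum_add_distrib, Finset.sum_ite_eq, Finset.mem_univ, if_true]
      congr 1
      · rw [Finset.sum_comm]
        simp only [Finset.sum_ite_eq, Finset.mem_univ, if_true, Finset.mul_sum]
      · simp only [Finset.mul_sum]
    rw [s1, s2, w2, v2]
    rcases lt_trichotomy (a c) 0 with hc | hc | hc
    · rw [if_neg hc.ne, max_eq_right hc.le, max_eq_left (by linarith)]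
      have : (a c : ℝ) ≠ 0 := by exact_mod_cast hc.ne
      push_cast
      field_simp
      simp
    · rw [if_pos hc, hc]; simp
    · rw [if_neg hc.ne', max_eq_left hc.le, max_eq_right (by linarith)]
      have : (a c : ℝ) ≠ 0 := by exact_mod_cast hc.ne'
      push_cast
      field_simp
      simp

lemma ehs (h : Sys m) {I : Type} [Fintype I] (x : I → P → ℝ) (hx : ∀ k, GNN m (x k))
    (R : List (I → ℚ)) (hR : ∀ r ∈ R, ∀ μ, ∑ k, (r k : ℝ) * x k μ = 0) :
    ∃ (C : Type) (_ : Fintype C) (z : C → P → ℝ) (w : C → I → ℚ),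
      (∀ c, GNN m (z c)) ∧ (∀ c k, 0 ≤ w c k) ∧ (∀ r ∈ R, ∀ c, ∑ k, r k * w c k = 0) ∧
      ∀ k μ, x k μ = ∑ c, (w c k : ℝ) * z c μ := by
  classical
  induction R with
  | nil =>
    refine ⟨I, inferInstance, x, fun c k => if k = c then 1 else 0, hx, ?_, by simp, ?_⟩
    · intro c k; dsimp only; split_ifs <;> norm_num
    · intro k μ
      rw [Finset.sum_eq_single k] <;> simp +contextual [eq_comm]
  | cons r R ih =>
    obtain ⟨C, _, z, w, h1, h2, h3, h4⟩ := ih (fun r hr => hR r (List.mem_cons_of_mem _ hr))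
    have key : ∀ μ, ∑ c, ((∑ k, r k * w c k : ℚ) : ℝ) * z c μ = 0 := fun μ => by
      rw [← hR r List.mem_cons_self μ]
      simp only [h4, Finset.mul_sum]
      rw [Finset.sum_comm]
      refine Finset.sum_congr rfl fun c _ => ?_
      push_cast
      rw [Finset.sum_mul]
      exact Finset.sum_congr rfl fun k _ => by ring
    obtain ⟨D, _, y, u, e1, e2, e3, e4⟩ := h.ehs_step z h1 _ key
    have comm : ∀ (s : I → ℚ) d, ∑ k, s k * ∑ c, u d c * w c k
        = ∑ c, (∑ k, s k * w c k) * u d c := by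
      intro s d
      simp only [Finset.mul_sum, Finset.sum_mul]
      rw [Finset.sum_comm]
      exact Finset.sum_congr rfl fun k _ => Finset.sum_congr rfl fun c _ => by ring
    refine ⟨D, inferInstance, y, fun d k => ∑ c, u d c * w c k, e1, ?_, ?_, ?_⟩
    · exact fun d k => Finset.sum_nonneg fun c _ => mul_nonneg (e2 _ _) (h2 _ _)
    · intro s hs d
      rw [comm]
      rcases List.mem_cons.1 hs with rfl | hs
      · exact e3 d
      · exact Finset.sum_eq_zero fun c _ => by rw [h3 s hs, zero_mul]
    · intro k μ
      rw [h4]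
      simp only [e4, Finset.mul_sum]
      rw [Finset.sum_comm]
      refine Finset.sum_congr rfl fun d _ => ?_
      push_cast
      rw [Finset.sum_mul]
      exact Finset.sum_congr rfl fun c _ => by ring

lemma ehs_norm (h : Sys m) {I : Type} [Fintype I] (x : I → P → ℝ) (hx : ∀ k, GNN m (x k))
    (R : List (I → ℚ)) (hR : ∀ r ∈ R, ∀ μ, ∑ k, (r k : ℝ) * x k μ = 0) :
    ∃ (C : Type) (_ : Fintype C) (z : C → P → ℝ) (w : C → I → ℚ),
      (∀ c, GPos m (z c)) ∧ (∀ c k, 0 ≤ w c k) ∧ (∀ c, ∑ k, w c k = 1) ∧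
      (∀ r ∈ R, ∀ c, ∑ k, r k * w c k = 0) ∧
      ∀ k μ, x k μ = ∑ c, (w c k : ℝ) * z c μ := by
  classical
  obtain ⟨C, _, z, w, h1, h2, h3, h4⟩ := h.ehs x hx R hR
  have hs0 : ∀ c, 0 ≤ ∑ k, w c k := fun c => Finset.sum_nonneg fun k _ => h2 c k
  refine ⟨{c // GPos m (z c) ∧ 0 < ∑ k, w c k}, inferInstance,
    fun c μ => ((∑ k, w c k : ℚ) : ℝ) * z c μ, fun c k => w c k / ∑ k, w c k, ?_, ?_, ?_, ?_, ?_⟩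
  · exact fun c => gpos_smul c.2.1 _ c.2.2
  · exact fun c k => div_nonneg (h2 _ _) (hs0 _)
  · intro c
    rw [← Finset.sum_div, div_self c.2.2.ne']
  · intro r hr c
    simp only [← mul_div_assoc]
    rw [← Finset.sum_div, h3 r hr, zero_div]
  · intro k μ
    rw [h4, ← sum_subtype_eq (fun c => GPos m (z c) ∧ 0 < ∑ k, w c k)]
    · refine Finset.sum_congr rfl fun c _ => ?_
      have : ((∑ k, w c k : ℚ) : ℝ) ≠ 0 := by exact_mod_cast c.2.2.ne'
      rw [Rat.cast_div]
      field_simp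
    · intro c hc
      by_cases hp : GPos m (z c)
      · have hs : ∑ k, w c k = 0 := le_antisymm (not_lt.1 fun hh => hc ⟨hp, hh⟩) (hs0 c)
        rw [(Finset.sum_eq_zero_iff_of_nonneg fun k _ => h2 c k).1 hs k (Finset.mem_univ _)]
        simp
      · rw [(h.gnn_dich (h1 c)).resolve_left hp, mul_zero]

end Sys

lemma aff_ne (α β : ℚ) (hβ : β ≠ 0) : ∀ᶠ t in nhdsWithin (0 : ℚ) (Set.Ioi 0), α + β * t ≠ 0 := by
  by_cases hα : α = 0
  · filter_upwards [self_mem_nhdsWithin] with t ht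
    rw [hα, zero_add]
    exact mul_ne_zero hβ (ne_of_gt ht)
  · have hc : Continuous fun t : ℚ => α + β * t := by fun_prop
    have : ∀ᶠ t in nhds (0 : ℚ), α + β * t ≠ 0 :=
      hc.continuousAt.eventually_ne (by simpa using hα)
    exact this.filter_mono nhdsWithin_le_nhds

lemma aff_pos (α β : ℚ) (hα : 0 < α) :
    ∀ᶠ t in nhdsWithin (0 : ℚ) (Set.Ioi 0), 0 < α + β * t := by
  have hc : Continuous fun t : ℚ => α + β * t := by fun_prop
  have : ∀ᶠ t in nhds (0 : ℚ), 0 < α + β * t :=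
    hc.continuousAt.eventually (lt_mem_nhds (by simpa using hα))
  exact this.filter_mono nhdsWithin_le_nhds

lemma common_den {J : Type*} [Fintype J] (f : J → ℚ) (hf : ∀ j, 0 ≤ f j) :
    ∃ (N : ℕ) (M : J → ℕ), 0 < N ∧ ∀ j, (M j : ℚ) = N * f j := by
  have key : ∀ j, ∃ a : ℕ, (a : ℚ) = ((∏ i, (f i).den : ℕ) : ℚ) * f j := by
    intro j
    obtain ⟨b, hb⟩ := Finset.dvd_prod_of_mem (fun i => (f i).den) (Finset.mem_univ j)
    refine ⟨b * (f j).num.toNat, ?_⟩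
    rw [hb]
    have h1 : (((f j).num.toNat : ℕ) : ℚ) = ((f j).num : ℚ) := by
      have : (((f j).num.toNat : ℕ) : ℤ) = (f j).num :=
        Int.toNat_of_nonneg (Rat.num_nonneg.2 (hf j))
      exact_mod_cast this
    have h2 : ((f j).den : ℚ) * f j = (f j).num := Rat.den_mul_eq_num (f j)
    push_cast
    rw [h1, ← h2]; ring
  choose M hM using key
  exact ⟨_, M, Finset.prod_pos fun i _ => (f i).den_pos, hM⟩

namespace Sys

variable {X P : Type*} [TopologicalSpace X] {m : P → Set X → ℝ}

lemma arith_aux (h : Sys m) {I : Type} [Fintype I] (x : I → P → ℝ) (hx : ∀ k, GNN m (x k))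
    (hx1 : ∀ μ, ∑ k, x k μ = 1)
    (R : List (I → ℚ)) (hR : ∀ r ∈ R, ∀ μ, ∑ k, (r k : ℝ) * x k μ = 0)
    (d : I → ℚ) (hd0 : ∀ k, d k ≠ 0 → GPos m (x k)) (hdR : ∀ r ∈ R, ∑ k, r k * d k = 0)
    (hd1 : ∑ k, d k = 0) (φ : I → ℚ) (hφ : ∑ k, φ k * d k ≠ 0) :
    ∃ (C : Type) (_ : Fintype C) (v : C → I → ℚ) (y : C → P → ℝ),
      (∀ c, GPos m (y c)) ∧ (∀ c k, 0 ≤ v c k) ∧ (∀ c, ∑ k, v c k = 1) ∧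
      (∀ r ∈ R, ∀ c, ∑ k, r k * v c k = 0) ∧
      (∀ k μ, x k μ = ∑ c, (v c k : ℝ) * y c μ) ∧
      (∀ c c', c ≠ c' → ∑ k, φ k * v c k ≠ ∑ k, φ k * v c' k) ∧
      (∀ c k, GPos m (x k) → 0 < v c k) := by
  classical
  obtain ⟨C, _, z, w, z1, w1, w2, w3, zw⟩ := h.ehs_norm x hx R hR
  obtain ⟨μ₀⟩ := h.ne
  have hz1 : ∀ μ, ∑ c, z c μ = 1 := fun μ => by
    rw [← hx1 μ]
    simp only [zw]
    rw [Finset.sum_comm]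
    refine Finset.sum_congr rfl fun c _ => ?_
    rw [← Finset.sum_mul]
    have : ∑ k, (w c k : ℝ) = 1 := by exact_mod_cast w2 c
    rw [this, one_mul]
  have hC : Nonempty C := by
    by_contra hC
    rw [not_nonempty_iff] at hC
    have := hz1 μ₀
    simp at this
  set s : ℚ := ((Fintype.card C : ℕ) : ℚ) with hs
  have hs1 : 1 ≤ s := by
    have : 1 ≤ Fintype.card C := Fintype.card_pos
    rw [hs]; exact_mod_cast this
  have hs0 : s ≠ 0 := by linarith
  -- mixing parameter
  choose rr r1 r2 using fun c => h.gpos_lower (z1 c)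
  obtain ⟨ε, ⟨hε0, hε1⟩, hε⟩ : ∃ ε : ℚ, (0 < ε ∧ ε < 1) ∧ ∀ c, ε < rr c := by
    have e1 : ∀ᶠ t in nhdsWithin (0 : ℚ) (Set.Ioi 0), ∀ c, 0 < rr c + (-1) * t :=
      Filter.eventually_all.2 fun c => aff_pos _ _ (r1 c)
    have e2 := aff_pos 1 (-1) one_pos
    have e3 : ∀ᶠ t in nhdsWithin (0 : ℚ) (Set.Ioi 0), t ∈ Set.Ioi (0 : ℚ) := self_mem_nhdsWithin
    obtain ⟨t, t1, t2, t3⟩ := (e1.and (e2.and e3)).exists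
    exact ⟨t, ⟨t3, by linarith⟩, fun c => by linarith [t1 c]⟩
  set wb : I → ℚ := fun k => (∑ c, w c k) / s with hwb
  have hwb0 : ∀ k, 0 ≤ wb k := fun k =>
    div_nonneg (Finset.sum_nonneg fun c _ => w1 c k) (by linarith)
  have hwb1 : ∑ k, wb k = 1 := by
    rw [hwb, ← Finset.sum_div, Finset.sum_comm]
    simp only [w2]
    simp [← hs, hs0]
  have hwbR : ∀ r ∈ R, ∑ k, r k * wb k = 0 := fun r hr => by
    simp only [hwb, ← mul_div_assoc]
    rw [← Finset.sum_div]
    simp only [Finset.mul_sum]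
    rw [Finset.sum_comm, Finset.sum_eq_zero, zero_div]
    exact fun c _ => w3 r hr c
  have hwbpos : ∀ k, GPos m (x k) → 0 < wb k := fun k hk => by
    refine lt_of_le_of_ne (hwb0 k) fun h0 => ?_
    have h0' : ∑ c, w c k = 0 := by
      rcases div_eq_zero_iff.1 h0.symm with h' | h'
      · exact h'
      · exact absurd h' hs0
    have := h.gpos_pos hk μ₀
    rw [zw, Finset.sum_eq_zero] at this
    · exact lt_irrefl _ this
    · intro c _
      rw [(Finset.sum_eq_zero_iff_of_nonneg fun c _ => w1 c k).1 h0' c (Finset.mem_univ _)]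
      simp
  set v : C → I → ℚ := fun c k => (1 - ε) * w c k + ε * wb k with hv
  have hv0 : ∀ c k, 0 ≤ v c k := fun c k =>
    add_nonneg (mul_nonneg (by linarith) (w1 _ _)) (mul_nonneg hε0.le (hwb0 _))
  have hvpos : ∀ c k, GPos m (x k) → 0 < v c k := fun c k hk =>
    add_pos_of_nonneg_of_pos (mul_nonneg (by linarith) (w1 _ _)) (mul_pos hε0 (hwbpos _ hk))
  have hv1 : ∀ c, ∑ k, v c k = 1 := fun c => by
    rw [hv]; simp only [Finset.sum_add_distrib, ← Finset.mul_sum, w2, hwb1]; ring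
  have hvR : ∀ r ∈ R, ∀ c, ∑ k, r k * v c k = 0 := fun r hr c => by
    have : ∑ k, r k * v c k = (1 - ε) * ∑ k, r k * w c k + ε * ∑ k, r k * wb k := by
      rw [Finset.mul_sum, Finset.mul_sum, ← Finset.sum_add_distrib]
      exact Finset.sum_congr rfl fun k _ => by rw [hv]; ring
    rw [this, w3 r hr, hwbR r hr]; ring
  have hε1' : (1 - ε : ℝ) ≠ 0 := by
    have : (1 - ε : ℚ) ≠ 0 := by linarith
    exact_mod_cast this
  set y : C → P → ℝ := fun c μ => ((1 / (1 - ε) : ℚ) : ℝ) * (z c μ + ((-(ε / s) : ℚ) : ℝ)) with hy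
  have hy1 : ∀ c, GPos m (y c) := fun c => by
    refine gpos_smul (h.gall_pos (h.gall_add (h.gpos_all (z1 c)) (h.gall_const _)) fun μ => ?_) _
      (one_div_pos.2 (by linarith))
    have e1 : ε / s ≤ ε := div_le_self hε0.le hs1
    have e2 : ((ε / s : ℚ) : ℝ) < z c μ := lt_trans (by exact_mod_cast lt_of_le_of_lt e1 (hε c))
      (r2 c μ)
    push_cast at e2 ⊢
    linarith
  have hxv : ∀ k μ, x k μ = ∑ c, (v c k : ℝ) * y c μ := fun k μ => by
    have hsR : (s : ℝ) ≠ 0 := by exact_mod_cast hs0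
    have hcard : ((Fintype.card C : ℕ) : ℝ) = s := by rw [hs]; simp
    have e1 : (1 - ε : ℝ) * ∑ c, (v c k : ℝ) * y c μ
        = (1 - ε) * ∑ c, (w c k : ℝ) * z c μ - (1 - ε) * (ε / s) * ∑ c, (w c k : ℝ)
          + ε * wb k * (∑ c, z c μ - ∑ c : C, (ε / s : ℝ)) := by
      simp only [Finset.mul_sum, ← Finset.sum_sub_distrib, ← Finset.sum_add_distrib]
      refine Finset.sum_congr rfl fun c _ => ?_
      rw [hv, hy]
      push_cast
      field_simp
      ring
    have e2 : (∑ c, (w c k : ℝ)) = s * wb k := by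
      rw [hwb]; push_cast; field_simp
    rw [hz1, e2, ← zw, Finset.sum_const, Finset.card_univ, nsmul_eq_mul, hcard] at e1
    have e3 : (1 - ε : ℝ) * ∑ c, (v c k : ℝ) * y c μ = (1 - ε) * x k μ := by
      rw [e1]; field_simp; ring
    exact (mul_left_cancel₀ hε1' e3).symm
  -- perturbation
  set e := Fintype.equivFin C with he
  set σ : C × Bool → ℚ := fun p => (if p.2 then 1 else -1) * ((e p.1 : ℕ) + 1 : ℚ) with hσ
  have hσinj : ∀ p q, σ p = σ q → p = q := by
    rintro ⟨c, b⟩ ⟨c', b'⟩ hh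
    have p1 : (0 : ℚ) ≤ ((e c : ℕ) : ℚ) := by positivity
    have p2 : (0 : ℚ) ≤ ((e c' : ℕ) : ℚ) := by positivity
    simp only [hσ] at hh
    cases b <;> cases b' <;> simp at hh
    · rw [e.injective (Fin.ext hh)]
    · linarith
    · linarith
    · rw [e.injective (Fin.ext hh)]
  set D := ∑ k, φ k * d k with hD
  obtain ⟨t, t1, t2⟩ : ∃ t : ℚ, (∀ (p : C × Bool) k, GPos m (x k) → 0 < v p.1 k + σ p * d k * t) ∧
      (∀ p q : C × Bool, p ≠ q → (∑ k, φ k * v p.1 k - ∑ k, φ k * v q.1 k)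
        + (σ p - σ q) * D * t ≠ 0) := by
    have e1 : ∀ᶠ t in nhdsWithin (0 : ℚ) (Set.Ioi 0), ∀ (p : C × Bool) k,
        GPos m (x k) → 0 < v p.1 k + σ p * d k * t := by
      refine Filter.eventually_all.2 fun p => Filter.eventually_all.2 fun k => ?_
      by_cases hk : GPos m (x k)
      · filter_upwards [aff_pos _ (σ p * d k) (hvpos p.1 k hk)] with t ht _ using ht
      · exact Filter.Eventually.of_forall fun t hk' => absurd hk' hk
    have e2 : ∀ᶠ t in nhdsWithin (0 : ℚ) (Set.Ioi 0), ∀ p q : C × Bool, p ≠ q →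
        (∑ k, φ k * v p.1 k - ∑ k, φ k * v q.1 k) + (σ p - σ q) * D * t ≠ 0 := by
      refine Filter.eventually_all.2 fun p => Filter.eventually_all.2 fun q => ?_
      by_cases hpq : p = q
      · exact Filter.Eventually.of_forall fun t hk' => absurd hpq hk'
      · filter_upwards [aff_ne (∑ k, φ k * v p.1 k - ∑ k, φ k * v q.1 k) ((σ p - σ q) * D)
          (mul_ne_zero (sub_ne_zero.2 fun hh => hpq (hσinj _ _ hh)) hφ)] with t ht _ using ht
    obtain ⟨t, t1, t2⟩ := (e1.and e2).exists
    exact ⟨t, t1, t2⟩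
  have lin : ∀ (r : I → ℚ) (p : C × Bool), ∑ k, r k * (v p.1 k + σ p * d k * t)
      = ∑ k, r k * v p.1 k + σ p * t * ∑ k, r k * d k := fun r p => by
    rw [Finset.mul_sum, ← Finset.sum_add_distrib]
    exact Finset.sum_congr rfl fun k _ => by ring
  refine ⟨C × Bool, inferInstance, fun p k => v p.1 k + σ p * d k * t,
    fun p μ => ((1 / 2 : ℚ) : ℝ) * y p.1 μ, ?_, ?_, ?_, ?_, ?_, ?_, ?_⟩
  · exact fun p => gpos_smul (hy1 _) _ (by norm_num)
  · intro p k
    by_cases hk : GPos m (x k)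
    · exact (t1 p k hk).le
    · have : d k = 0 := by by_contra hh; exact hk (hd0 k hh)
      dsimp only
      rw [this]; simpa using hv0 _ _
  · intro p
    have := lin (fun _ => 1) p
    simp only [one_mul, hv1, hd1] at this
    dsimp only
    rw [this]; ring
  · intro r hr p
    rw [lin, hvR r hr, hdR r hr]; ring
  · intro k μ
    rw [Fintype.sum_prod_type, hxv]
    refine Finset.sum_congr rfl fun c _ => ?_
    rw [Fintype.sum_bool]
    simp only [hσ]
    push_cast
    simp
    ring
  · intro p q hpq hh
    rw [lin, lin] at hh
    exact t2 p q hpq (by rw [hD]; linarith)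
  · exact fun p k hk => t1 p k hk

lemma arith (h : Sys m) {I : Type} [Fintype I] (x : I → P → ℝ) (hx : ∀ k, GNN m (x k))
    (hx1 : ∀ μ, ∑ k, x k μ = 1)
    (R : List (I → ℚ)) (hR : ∀ r ∈ R, ∀ μ, ∑ k, (r k : ℝ) * x k μ = 0)
    (d : I → ℚ) (hd0 : ∀ k, d k ≠ 0 → GPos m (x k)) (hdR : ∀ r ∈ R, ∑ k, r k * d k = 0)
    (hd1 : ∑ k, d k = 0) (φ : I → ℚ) (hφ : ∑ k, φ k * d k ≠ 0) :
    ∃ (n N : ℕ) (M : Fin n → I → ℕ) (Y : Fin n → P → ℝ), 0 < n ∧ 0 < N ∧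
      (∀ c, GPos m (Y c)) ∧ (∀ c, ∑ k, M c k = N) ∧
      (∀ r ∈ R, ∀ c, ∑ k, r k * (M c k : ℚ) = 0) ∧
      (∀ k μ, x k μ = ∑ c, (M c k : ℝ) * Y c μ) ∧
      (∀ c c', c ≠ c' → ∑ k, φ k * (M c k : ℚ) ≠ ∑ k, φ k * (M c' k : ℚ)) ∧
      (∀ c k, GPos m (x k) → 0 < M c k) := by
  classical
  obtain ⟨C, _, v, y, h1, h2, h3, h4, h5, h6, h7⟩ := h.arith_aux x hx hx1 R hR d hd0 hdR hd1 φ hφ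
  obtain ⟨N, M, hN, hM⟩ := common_den (fun p : C × I => v p.1 p.2) (fun p => h2 _ _)
  have hNq : (N : ℚ) ≠ 0 := by exact_mod_cast hN.ne'
  have hNr : (N : ℝ) ≠ 0 := by exact_mod_cast hN.ne'
  have lin : ∀ (r : I → ℚ) c, ∑ k, r k * (M (c, k) : ℚ) = N * ∑ k, r k * v c k := fun r c => by
    rw [Finset.mul_sum]
    exact Finset.sum_congr rfl fun k _ => by rw [hM]; ring
  set e := (Fintype.equivFin C).symm with he
  obtain ⟨μ₀⟩ := h.ne
  refine ⟨Fintype.card C, N, fun c k => M (e c, k), fun c μ => ((1 / N : ℚ) : ℝ) * y (e c) μ,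
    ?_, hN, ?_, ?_, ?_, ?_, ?_, ?_⟩
  · by_contra hC
    have hC : Fintype.card C = 0 := by omega
    rw [Fintype.card_eq_zero_iff] at hC
    have := hx1 μ₀
    simp [h5] at this
  · exact fun c => gpos_smul (h1 _) _ (by positivity)
  · intro c
    have := lin (fun _ => 1) (e c)
    simp only [one_mul, h3, mul_one] at this
    exact_mod_cast this
  · intro r hr c
    rw [lin, h4 r hr, mul_zero]
  · intro k μ
    rw [h5, ← e.sum_comp]
    refine Finset.sum_congr rfl fun c _ => ?_
    have : (M (e c, k) : ℝ) = N * v (e c) k := by exact_mod_cast hM (e c, k)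
    rw [this]
    push_cast
    field_simp
  · intro c c' hc hh
    rw [lin, lin] at hh
    exact h6 _ _ (fun hh => hc (e.injective hh)) (mul_left_cancel₀ hNq hh)
  · intro c k hk
    have : (0 : ℚ) < M (e c, k) := by
      rw [hM]; exact mul_pos (by exact_mod_cast hN) (h7 _ _ hk)
    exact_mod_cast this

end Sys

lemma sys_of_dynSimplex {X : Type*} [TopologicalSpace X] [CompactSpace X]
    [TopologicalSpace.MetrizableSpace X] [MeasurableSpace X] [BorelSpace X]
    (K : Set (ProbabilityMeasure X)) (hK : IsDynSimplex K) (hdiv : Divisible K) :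
    Sys (fun (μ : K) (A : Set X) => ((μ : ProbabilityMeasure X) : Measure X).real A) := by
  obtain ⟨hne, hcomp, -, -, hsupp, hgw⟩ := hK
  refine ⟨hne.to_subtype, ?_, ?_, ?_, ?_, ?_, ?_⟩
  · intro μ; simp
  · intro μ; simp
  · intro μ A B hA hB hd
    exact measureReal_union hd hB.2.measurableSet
  · intro A hA hn
    have hcont : Continuous fun μ : ProbabilityMeasure X => (μ : Measure X).real A := by
      have h1 : Continuous fun μ : ProbabilityMeasure X => μ A := by
        rw [continuous_iff_continuousAt]
        intro μ
        exact ProbabilityMeasure.tendsto_measure_of_isClopen_of_tendsto Filter.tendsto_id hA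
      exact NNReal.continuous_coe.comp h1
    obtain ⟨μ, hμ, hmin⟩ := hcomp.exists_isMinOn hne hcont.continuousOn
    have : (0 : ℝ) < (μ : Measure X).real A := by
      have := hsupp μ hμ
      rw [measureReal_def, ENNReal.toReal_pos_iff]
      exact ⟨hA.isOpen.measure_pos _ hn, measure_lt_top _ _⟩
    obtain ⟨q, hq0, hq⟩ := exists_rat_btwn this
    exact ⟨q, by exact_mod_cast hq0, fun ν => hq.le.trans (hmin ν.2)⟩
  · intro A B hA hB hlt
    obtain ⟨W, h1, h2, h3⟩ := hgw A B hA hB (fun μ hμ => by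
      have := hlt ⟨μ, hμ⟩
      exact (ENNReal.toReal_lt_toReal (measure_ne_top _ _) (measure_ne_top _ _)).1 this)
    exact ⟨W, h1, h2, fun μ => by simp only [measureReal_def, h3 μ μ.2]⟩
  · intro A hA n hn
    obtain ⟨W, h1, h2, h3⟩ := hdiv A hA n hn
    exact ⟨W, h1, h2, fun μ => by simp [measureReal_def, h3 μ μ.2]⟩

/-- Data describing a refinement of `T`: each new column is a stack of blocks. -/
structure TowerData {X : Type*} [TopologicalSpace X] [MeasurableSpace X]
    {K : Set (ProbabilityMeasure X)} (T : KRPartition X K) where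
  n : ℕ
  npos : 0 < n
  B : Fin n → ℕ
  Bpos : ∀ c, 0 < B c
  typ : ∀ c, Fin (B c) → Fin T.n
  A : ∀ c (b : Fin (B c)), Fin (T.height (typ c b)) → Set X
  clopen : ∀ c b j, IsClopen (A c b j)
  nonempty : ∀ c b j, (A c b j).Nonempty
  disj : ∀ (p q : (c : Fin n) × (b : Fin (B c)) × Fin (T.height (typ c b))) (x : X),
    x ∈ A p.1 p.2.1 p.2.2 → x ∈ A q.1 q.2.1 q.2.2 → p = q
  cover : ∀ x, ∃ c b j, x ∈ A c b j
  meas : ∀ c b j b' j', ∀ μ ∈ K, (μ : Measure X) (A c b j) = (μ : Measure X) (A c b' j')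
  sub : ∀ c b j, A c b j ⊆ T.atom (typ c b) j

lemma KRPartition.eq_of_mem {X : Type*} [TopologicalSpace X] [MeasurableSpace X]
    {K : Set (ProbabilityMeasure X)} (T : KRPartition X K)
    (p q : (i : Fin T.n) × Fin (T.height i)) {x : X} (hp : x ∈ T.atom p.1 p.2)
    (hq : x ∈ T.atom q.1 q.2) : p = q := by
  by_contra hne
  exact Set.disjoint_left.1 (T.disj p q hne) hp hq

namespace TowerData

variable {X : Type*} [TopologicalSpace X] [MeasurableSpace X]
    {K : Set (ProbabilityMeasure X)} {T : KRPartition X K}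

/-- the height of a column -/
def ht (D : TowerData T) (c : Fin D.n) : ℕ := ∑ b, T.height (D.typ c b)

/-- the enumeration of levels -/
def E (D : TowerData T) (c : Fin D.n) :
    ((b : Fin (D.B c)) × Fin (T.height (D.typ c b))) ≃ Fin (D.ht c) := finSigmaFinEquiv

/-- starting level of a block -/
def off (D : TowerData T) (c : Fin D.n) (b : Fin (D.B c)) : ℕ :=
  ∑ i : Fin b, T.height (D.typ c (Fin.castLE b.2.le i))

lemma E_val (D : TowerData T) (c : Fin D.n) (b) (j) :
    ((D.E c ⟨b, j⟩ : Fin _) : ℕ) = D.off c b + j := finSigmaFinEquiv_apply _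

/-- the KR-partition built from the data -/
def toKR (D : TowerData T) : KRPartition X K where
  n := D.n
  npos := D.npos
  height := D.ht
  height_pos c := Finset.sum_pos (fun b _ => T.height_pos _) ⟨⟨0, D.Bpos c⟩, Finset.mem_univ _⟩
  atom c p := D.A c ((D.E c).symm p).1 ((D.E c).symm p).2
  clopen c p := D.clopen _ _ _
  nonempty c p := D.nonempty _ _ _
  disj := by
    rintro ⟨c, p⟩ ⟨c', p'⟩ hne
    rw [Set.disjoint_left]
    intro x hx hx'
    apply hne
    have := D.disj ⟨c, (D.E c).symm p⟩ ⟨c', (D.E c').symm p'⟩ x hx hx'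
    obtain ⟨rfl, h2⟩ := Sigma.mk.inj_iff.1 this
    have := (D.E c).symm.injective (eq_of_heq h2)
    rw [this]
  cover := by
    rw [Set.eq_univ_iff_forall]
    intro x
    obtain ⟨c, b, j, hx⟩ := D.cover x
    simp only [Set.mem_iUnion]
    refine ⟨c, D.E c ⟨b, j⟩, ?_⟩
    rw [Equiv.symm_apply_apply]
    exact hx
  measure_eq c j k μ hμ := D.meas _ _ _ _ _ _ hμ

lemma atom_E (D : TowerData T) (c : Fin D.n) (b) (j) :
    D.toKR.atom c (D.E c ⟨b, j⟩) = D.A c b j := by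
  change D.A c _ _ = _
  rw [Equiv.symm_apply_apply]

lemma exists_E (D : TowerData T) (c : Fin D.n) (p : Fin (D.toKR.height c)) :
    ∃ b j, p = D.E c ⟨b, j⟩ :=
  ⟨((D.E c).symm p).1, ((D.E c).symm p).2, ((D.E c).apply_symm_apply p).symm⟩

lemma lt_ht (D : TowerData T) (c : Fin D.n) (b) (l : ℕ) (hl : l < T.height (D.typ c b)) :
    D.off c b + l < D.toKR.height c := by
  have := (D.E c ⟨b, ⟨l, hl⟩⟩).2
  rw [D.E_val] at this
  exact this

lemma atom_off (D : TowerData T) (c : Fin D.n) (b) (l : ℕ) (hl : l < T.height (D.typ c b))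
    (h : D.off c b + l < D.toKR.height c) :
    D.toKR.atom c ⟨D.off c b + l, h⟩ = D.A c b ⟨l, hl⟩ := by
  rw [← D.atom_E]
  congr 1
  exact Fin.ext (D.E_val c b ⟨l, hl⟩).symm

lemma sub_iff (D : TowerData T) (c : Fin D.n) (b) (j) (i : Fin T.n) (k : Fin (T.height i))
    (h : D.A c b j ⊆ T.atom i k) :
    (⟨D.typ c b, j⟩ : (i : Fin T.n) × Fin (T.height i)) = ⟨i, k⟩ := by
  obtain ⟨x, hx⟩ := D.nonempty c b j
  exact T.eq_of_mem _ _ (D.sub c b j hx) (h hx)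

lemma base_aux (D : TowerData T) (c : Fin D.n) (x : X)
    (hx : x ∈ D.toKR.atom c ⟨0, D.toKR.height_pos c⟩) :
    ∃ i, x ∈ T.atom i ⟨0, T.height_pos i⟩ := by
  refine ⟨D.typ c ⟨0, D.Bpos c⟩, ?_⟩
  refine D.sub c ⟨0, D.Bpos c⟩ ⟨0, T.height_pos _⟩ ?_
  rw [← D.atom_E]
  have : D.E c ⟨⟨0, D.Bpos c⟩, ⟨0, T.height_pos _⟩⟩ = ⟨0, D.toKR.height_pos c⟩ := by
    apply Fin.ext
    rw [D.E_val]
    simp [off]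
  rw [this]
  exact hx

lemma step_aux (D : TowerData T) (c : Fin D.n) (p : Fin (D.toKR.height c)) (i : Fin T.n)
    (k : Fin (T.height i)) (hsub : D.toKR.atom c p ⊆ T.atom i k) (hk : (k : ℕ) + 1 < T.height i) :
    ∃ hj : (p : ℕ) + 1 < D.toKR.height c,
        D.toKR.atom c ⟨(p : ℕ) + 1, hj⟩ ⊆ T.atom i ⟨(k : ℕ) + 1, hk⟩ := by
  obtain ⟨b, j, rfl⟩ := D.exists_E c p
  rw [D.atom_E] at hsub
  have := D.sub_iff c b j i k hsub
  obtain ⟨rfl, h2⟩ := Sigma.mk.inj_iff.1 this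
  have h3 := eq_of_heq h2
  subst h3
  have hv := D.E_val c b j
  have hlt := D.lt_ht c b (j + 1) hk
  have h4 : D.toKR.atom c ⟨D.off c b + (j + 1), hlt⟩ = _ := D.atom_off c b (j + 1) hk hlt
  refine ⟨by rw [hv]; exact hlt, ?_⟩
  have h5 : (⟨(D.E c ⟨b, j⟩ : Fin (D.ht c)).1 + 1, by rw [hv]; exact hlt⟩ :
      Fin (D.toKR.height c)) = ⟨D.off c b + (j + 1), hlt⟩ := Fin.ext (by simp only [hv]; rfl)
  rw [h5, h4]
  exact D.sub c b _

lemma refines (D : TowerData T) : D.toKR.Refines T := by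
  refine ⟨?_, ?_, ?_⟩
  · intro x hx
    simp only [KRPartition.base, Set.mem_iUnion] at hx ⊢
    obtain ⟨c, hx⟩ := hx
    exact D.base_aux c x hx
  · intro i j
    refine ⟨{p | D.toKR.atom p.1 p.2 ⊆ T.atom i j}, ?_⟩
    apply Set.Subset.antisymm
    · intro x hx
      obtain ⟨c, b, l, hxA⟩ := D.cover x
      simp only [Set.mem_iUnion]
      refine ⟨⟨c, D.E c ⟨b, l⟩⟩, ?_, ?_⟩
      · have := T.eq_of_mem ⟨i, j⟩ ⟨D.typ c b, l⟩ hx (D.sub c b l hxA)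
        change D.toKR.atom c (D.E c ⟨b, l⟩) ⊆ _
        rw [D.atom_E]
        obtain ⟨rfl, h2⟩ := Sigma.mk.inj_iff.1 this
        rw [eq_of_heq h2]
        exact D.sub c b l
      · change x ∈ D.toKR.atom c (D.E c ⟨b, l⟩)
        rw [D.atom_E]
        exact hxA
    · exact Set.iUnion₂_subset fun p hp => hp
  · exact fun c p i k hsub hk => D.step_aux c p i k hsub hk

lemma isCopyAt_iff (D : TowerData T) (c : Fin D.n) (i : Fin T.n) (p : ℕ) :
    KRPartition.IsCopyAt D.toKR T c i p ↔ ∃ b, D.typ c b = i ∧ D.off c b = p := by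
  constructor
  · intro h
    obtain ⟨hp, hsub⟩ := h 0 (T.height_pos i)
    obtain ⟨b, j, hbj⟩ := D.exists_E c ⟨p + 0, hp⟩
    rw [hbj, D.atom_E] at hsub
    have h1 := D.sub_iff c b j i _ hsub
    have hv := D.E_val c b j
    obtain ⟨rfl, h2⟩ := Sigma.mk.inj_iff.1 h1
    have h3 := eq_of_heq h2
    subst h3
    refine ⟨b, rfl, ?_⟩
    have := congrArg Fin.val hbj
    rw [hv] at this
    simpa using this.symm
  · rintro ⟨b, rfl, rfl⟩ l hl
    refine ⟨D.lt_ht c b l hl, ?_⟩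
    have := D.atom_off c b l hl (D.lt_ht c b l hl)
    rw [this]
    exact D.sub _ _ _

lemma off_inj (D : TowerData T) (c : Fin D.n) : Function.Injective (D.off c) := by
  intro b b' h
  have h1 := D.E_val c b ⟨0, T.height_pos _⟩
  have h2 := D.E_val c b' ⟨0, T.height_pos _⟩
  have : D.E c ⟨b, ⟨0, T.height_pos _⟩⟩ = D.E c ⟨b', ⟨0, T.height_pos _⟩⟩ :=
    Fin.ext (by rw [h1, h2, h])
  exact (Sigma.mk.inj_iff.1 ((D.E c).injective this)).1

lemma numCopies_eq (D : TowerData T) (c : Fin D.n) (i : Fin T.n) :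
    KRPartition.numCopies D.toKR T c i = Fintype.card {b // D.typ c b = i} := by
  unfold KRPartition.numCopies
  have : {p : ℕ | KRPartition.IsCopyAt D.toKR T c i p} = Set.image (D.off c) {b | D.typ c b = i} := by
    ext p
    simp only [Set.mem_ofPred_eq, Set.mem_image]
    exact D.isCopyAt_iff c i p
  rw [this, Set.ncard_image_of_injective _ (D.off_inj c), ← Nat.card_coe_set_eq,
    Nat.card_eq_fintype_card]
  rfl

lemma ncard_eq (D : TowerData T) (c : Fin D.n) (Q : Set X → Prop) :
    {p : Fin (D.toKR.height c) | Q (D.toKR.atom c p)}.ncard =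
      Nat.card {q : (b : Fin (D.B c)) × Fin (T.height (D.typ c b)) // Q (D.A c q.1 q.2)} := by
  rw [← Nat.card_coe_set_eq]
  refine (Nat.card_congr ((D.E c).subtypeEquiv ?_)).symm
  rintro ⟨b, j⟩
  have := D.atom_E c b j
  change Q (D.A c b j) ↔ Q (D.toKR.atom c (D.E c ⟨b, j⟩))
  rw [this]

end TowerData


lemma exists_delta (n : ℕ) (hn : 3 ≤ n) (a b : Fin n → ℚ) :
    ∃ (Δ : Fin n → ℚ) (i₀ : Fin n), Δ i₀ ≠ 0 ∧ ∑ i, Δ i * a i = 0 ∧ ∑ i, Δ i * b i = 0 := by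
  let L : (Fin n → ℚ) →ₗ[ℚ] ℚ × ℚ :=
    LinearMap.prod (Fintype.linearCombination ℚ a) (Fintype.linearCombination ℚ b)
  have hk : LinearMap.ker L ≠ ⊥ := by
    apply LinearMap.ker_ne_bot_of_finrank_lt
    simp
    omega
  obtain ⟨Δ, hΔ, hne⟩ := Submodule.exists_mem_ne_zero_of_ne_bot hk
  obtain ⟨i₀, hi⟩ := Function.ne_iff.1 hne
  rw [LinearMap.mem_ker] at hΔ
  have h1 := congrArg Prod.fst hΔ
  have h2 := congrArg Prod.snd hΔ
  simp only [L, LinearMap.prod_apply,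
    Prod.fst_zero, Prod.snd_zero] at h1 h2
  exact ⟨Δ, i₀, hi, h1, h2⟩

open Classical in
/-- membership pattern of a point with respect to two sets -/
noncomputable def pat {X : Type*} (U V : Set X) (x : X) : Bool × Bool :=
  (decide (x ∈ U), decide (x ∈ V))

lemma pat_fst {X : Type*} (U V : Set X) (x : X) : (pat U V x).1 = true ↔ x ∈ U := by
  simp [pat]

lemma pat_snd {X : Type*} (U V : Set X) (x : X) : (pat U V x).2 = true ↔ x ∈ V := by
  simp [pat]

lemma pat_clopen {X : Type*} [TopologicalSpace X] {U V : Set X} (hU : IsClopen U)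
    (hV : IsClopen V) (τ : Bool × Bool) : IsClopen (pat U V ⁻¹' {τ}) := by
  have : pat U V ⁻¹' {τ} =
      (if τ.1 = true then U else Uᶜ) ∩ (if τ.2 = true then V else Vᶜ) := by
    ext x
    obtain ⟨a, b⟩ := τ
    cases a <;> cases b <;> simp [pat]
  rw [this]
  refine IsClopen.inter ?_ ?_
  · split_ifs
    exacts [hU, hU.compl]
  · split_ifs
    exacts [hV, hV.compl]

section Cells

variable {X : Type*} [TopologicalSpace X] [MeasurableSpace X] {K : Set (ProbabilityMeasure X)}

/-- The index type of the cells. -/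
abbrev CellIdx (T : KRPartition X K) : Type := ((i : Fin T.n) × Fin (T.height i)) × (Bool × Bool)

/-- The cells: atoms of `T` cut along `U` and `V`. -/
def cell (T : KRPartition X K) (U V : Set X) (k : CellIdx T) : Set X :=
  T.atom k.1.1 k.1.2 ∩ pat U V ⁻¹' {k.2}

lemma cell_clopen (T : KRPartition X K) {U V : Set X} (hU : IsClopen U) (hV : IsClopen V)
    (k : CellIdx T) : IsClopen (cell T U V k) :=
  (T.clopen _ _).inter (pat_clopen hU hV _)

lemma cell_eq (T : KRPartition X K) {U V : Set X} (k k' : CellIdx T) {x : X}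
    (h : x ∈ cell T U V k) (h' : x ∈ cell T U V k') : k = k' := by
  have h1 := T.eq_of_mem k.1 k'.1 h.1 h'.1
  have h2 : k.2 = k'.2 := by
    have a : pat U V x = k.2 := h.2
    have b : pat U V x = k'.2 := h'.2
    rw [← a, ← b]
  exact Prod.ext h1 h2

lemma cell_disj (T : KRPartition X K) {U V : Set X} (k k' : CellIdx T) (hne : k ≠ k') :
    Disjoint (cell T U V k) (cell T U V k') := by
  rw [Set.disjoint_left]
  exact fun x h h' => hne (cell_eq T k k' h h')

lemma exists_atom (T : KRPartition X K) (x : X) : ∃ i j, x ∈ T.atom i j := by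
  have : x ∈ ⋃ (i) (j), T.atom i j := by rw [T.cover]; trivial
  simpa using this

lemma exists_cell (T : KRPartition X K) (U V : Set X) (x : X) : ∃ k, x ∈ cell T U V k := by
  obtain ⟨i, j, h⟩ := exists_atom T x
  exact ⟨(⟨i, j⟩, pat U V x), h, rfl⟩

lemma iUnion_cell (T : KRPartition X K) (U V : Set X) (p : (i : Fin T.n) × Fin (T.height i)) :
    (⋃ τ, cell T U V (p, τ)) = T.atom p.1 p.2 := by
  ext x
  simp only [Set.mem_iUnion]
  constructor
  · rintro ⟨τ, h⟩; exact h.1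
  · intro h; exact ⟨pat U V x, h, rfl⟩

lemma sum_fst_eq {A B R : Type*} [Fintype A] [Fintype B] [DecidableEq A] [Semiring R] (p : A)
    (g : A × B → R) : ∑ k : A × B, (if k.1 = p then (1 : R) else 0) * g k = ∑ τ, g (p, τ) := by
  rw [Fintype.sum_prod_type]
  simp only [ite_mul, one_mul, zero_mul]
  rw [Finset.sum_eq_single p]
  · simp
  · intro b _ hb
    simp [hb]
  · simp

lemma step1 {P : Type*} (m : P → Set X → ℝ) (h : Sys m) (T : KRPartition X K) (hT : 3 ≤ T.n)
    (hTm : ∀ i j j' μ, m μ (T.atom i j) = m μ (T.atom i j'))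
    (U V : Set X) (hU : IsClopen U) (hV : IsClopen V) (hUV : ∀ μ, m μ U = m μ V) :
    ∃ (n N : ℕ) (M : Fin n → CellIdx T → ℕ) (Y : Fin n → P → ℝ) (i₀ : Fin T.n),
      0 < n ∧ 0 < N ∧ (∀ c, GPos m (Y c)) ∧ (∀ c, ∑ k, M c k = N) ∧
      (∀ c i j j', ∑ τ, M c (⟨i, j⟩, τ) = ∑ τ, M c (⟨i, j'⟩, τ)) ∧
      (∀ c, ∑ k : CellIdx T, (if k.2.1 = true then M c k else 0) =
        ∑ k : CellIdx T, (if k.2.2 = true then M c k else 0)) ∧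
      (∀ k μ, m μ (cell T U V k) = ∑ c, (M c k : ℝ) * Y c μ) ∧
      (∀ c c', c ≠ c' → ∑ τ, M c (⟨i₀, ⟨0, T.height_pos i₀⟩⟩, τ) ≠
        ∑ τ, M c' (⟨i₀, ⟨0, T.height_pos i₀⟩⟩, τ)) ∧
      (∀ c i j, 0 < ∑ τ, M c (⟨i, j⟩, τ)) := by
  classical
  have hcl := cell_clopen T hU hV
  choose pt hpt using T.nonempty
  let τ₀ : ((i : Fin T.n) × Fin (T.height i)) → Bool × Bool := fun p => pat U V (pt p.1 p.2)
  have hτ₀ : ∀ p, (cell T U V (p, τ₀ p)).Nonempty := fun p => ⟨pt p.1 p.2, hpt _ _, rfl⟩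
  let w : Bool × Bool → ℚ := fun τ =>
    (if τ.1 = true then 1 else 0) - (if τ.2 = true then 1 else 0)
  obtain ⟨Δ, i₀, hΔ0, hΔ1, hΔ2⟩ := exists_delta T.n hT (fun i => (T.height i : ℚ))
    (fun i => ∑ j, w (τ₀ ⟨i, j⟩))
  let d : CellIdx T → ℚ := fun k => if k.2 = τ₀ k.1 then Δ k.1.1 else 0
  let r2 : CellIdx T → ℚ := fun k => w k.2
  let r1 : ((i : Fin T.n) × (Fin (T.height i) × Fin (T.height i))) → CellIdx T → ℚ := fun t k =>
    (if k.1 = ⟨t.1, t.2.1⟩ then 1 else 0) - (if k.1 = ⟨t.1, t.2.2⟩ then 1 else 0)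
  let R : List (CellIdx T → ℚ) := r2 :: (Finset.univ.toList.map r1)
  let φ : CellIdx T → ℚ := fun k => if k.1 = ⟨i₀, ⟨0, T.height_pos i₀⟩⟩ then 1 else 0
  have hatom : ∀ p μ, ∑ τ, m μ (cell T U V (p, τ)) = m μ (T.atom p.1 p.2) := fun p μ => by
    rw [← iUnion_cell T U V p, h.sum_fintype _ (fun τ => hcl _)]
    intro τ τ' hne
    exact cell_disj T _ _ (fun e => hne (Prod.mk.inj e).2)
  have hdsum : ∀ p, ∑ τ, d (p, τ) = Δ p.1 := fun p => by simp [d]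
  have hsub : ∀ (Q : Bool × Bool → Prop) [DecidablePred Q] (W : Set X)
      (_ : ∀ x, x ∈ W ↔ Q (pat U V x)) (μ : P),
      ∑ k : CellIdx T, (if Q k.2 then 1 else 0) * m μ (cell T U V k) = m μ W := by
    intro Q _ W hW μ
    have e : W = ⋃ k : CellIdx T, (if Q k.2 then cell T U V k else ∅) := by
      ext x
      simp only [Set.mem_iUnion]
      constructor
      · intro hx
        obtain ⟨k, hk⟩ := exists_cell T U V x
        refine ⟨k, ?_⟩
        have : pat U V x = k.2 := hk.2
        rw [if_pos (this ▸ (hW x).1 hx)]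
        exact hk
      · rintro ⟨k, hk⟩
        split_ifs at hk with hQ
        · have : pat U V x = k.2 := hk.2
          exact (hW x).2 (this ▸ hQ)
        · exact hk.elim
    rw [e, h.sum_fintype]
    · refine Finset.sum_congr rfl fun k _ => ?_
      split_ifs
      · simp
      · simp [h.empty]
    · intro k
      split_ifs
      · exact hcl k
      · exact isClopen_empty
    · intro k k' hne
      split_ifs <;> simp [cell_disj T k k' hne]
  obtain ⟨n, N, M, Y, h1, h2, h3, h4, h5, h6, h7, h8⟩ :=
    h.arith (fun k μ => m μ (cell T U V k)) (fun k => Sys.gnn_clopen (hcl k))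
      (fun μ => by
        have := hsub (fun _ => True) Set.univ (by simp) μ
        simpa [h.univ] using this) R
      (by
        intro r hr μ
        rcases List.mem_cons.1 hr with rfl | hr
        · have e1 := hsub (fun τ => τ.1 = true) U (fun x => (pat_fst U V x).symm) μ
          have e2 := hsub (fun τ => τ.2 = true) V (fun x => (pat_snd U V x).symm) μ
          have := hUV μ
          rw [← e1, ← e2, ← sub_eq_zero, ← Finset.sum_sub_distrib] at this
          rw [← this]
          refine Finset.sum_congr rfl fun k _ => ?_
          simp only [r2, w, Rat.cast_sub, apply_ite (Rat.cast : ℚ → ℝ), Rat.cast_one,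
            Rat.cast_zero]
          ring
        · obtain ⟨t, -, rfl⟩ := List.mem_map.1 hr
          simp only [r1, Rat.cast_sub, apply_ite (Rat.cast : ℚ → ℝ), Rat.cast_one,
            Rat.cast_zero, sub_mul, Finset.sum_sub_distrib]
          rw [sum_fst_eq, sum_fst_eq, hatom, hatom, hTm t.1 t.2.1 t.2.2, sub_self])
      d
      (by
        intro k hk
        simp only [d, ne_eq, ite_eq_right_iff, Classical.not_imp] at hk
        refine Sys.gpos_clopen (hcl k) ?_
        have : k = (k.1, τ₀ k.1) := Prod.ext rfl hk.1
        rw [this]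
        exact hτ₀ _)
      (by
        intro r hr
        rcases List.mem_cons.1 hr with rfl | hr
        · rw [← hΔ2, Fintype.sum_prod_type, Fintype.sum_sigma]
          refine Finset.sum_congr rfl fun i _ => ?_
          rw [Finset.mul_sum]
          refine Finset.sum_congr rfl fun j _ => ?_
          simp only [r2, d, mul_ite, mul_zero, Finset.sum_ite_eq',
            Finset.mem_univ, if_true]
          rw [mul_comm]
        · obtain ⟨t, -, rfl⟩ := List.mem_map.1 hr
          simp only [r1, sub_mul, Finset.sum_sub_distrib]
          rw [sum_fst_eq, sum_fst_eq, hdsum, hdsum, sub_self])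
      (by
        rw [← hΔ1, Fintype.sum_prod_type, Fintype.sum_sigma]
        refine Finset.sum_congr rfl fun i _ => ?_
        simp only [hdsum]
        simp [mul_comm])
      φ
      (by
        simp only [φ]
        rw [sum_fst_eq, hdsum]
        exact hΔ0)
  refine ⟨n, N, M, Y, i₀, h1, h2, h3, h4, ?_, ?_, h6, ?_, ?_⟩
  · intro c i j j'
    have := h5 (r1 ⟨i, j, j'⟩) (List.mem_cons_of_mem _ (List.mem_map_of_mem (by simp))) c
    simp only [r1, sub_mul, Finset.sum_sub_distrib] at this
    rw [sum_fst_eq, sum_fst_eq, sub_eq_zero] at this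
    exact_mod_cast this
  · intro c
    have := h5 r2 List.mem_cons_self c
    simp only [r2, w, sub_mul, Finset.sum_sub_distrib, ite_mul, one_mul, zero_mul] at this
    rw [sub_eq_zero] at this
    exact_mod_cast this
  · intro c c' hne e
    apply h7 c c' hne
    simp only [φ]
    rw [sum_fst_eq, sum_fst_eq]
    exact_mod_cast e
  · intro c i j
    refine Finset.sum_pos' (fun _ _ => Nat.zero_le _) ⟨τ₀ ⟨i, j⟩, Finset.mem_univ _, ?_⟩
    exact h8 _ _ (Sys.gpos_clopen (hcl _) (hτ₀ _))

end Cells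


lemma exists_blocks (r : ℕ) (h : Fin r → ℕ) (M : ((i : Fin r) × Fin (h i)) × (Bool × Bool) → ℕ)
    (κ : Fin r → ℕ) (hκ : ∀ i j, ∑ τ, M (⟨i, j⟩, τ) = κ i) :
    ∃ (typ : Fin (∑ i, κ i) → Fin r)
      (G : ((b : Fin (∑ i, κ i)) × Fin (h (typ b))) ≃ ((k : _) × Fin (M k))),
      (∀ b j, (G ⟨b, j⟩).1.1 = ⟨typ b, j⟩) ∧ ∀ i, Fintype.card {b // typ b = i} = κ i := by
  classical
  let F : Fin (∑ i, κ i) ≃ ((i : Fin r) × Fin (κ i)) := finSigmaFinEquiv.symm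
  have he : ∀ p : (i : Fin r) × Fin (h i),
      Nonempty (Fin (κ p.1) ≃ ((τ : Bool × Bool) × Fin (M (p, τ)))) := fun p =>
    ⟨Fintype.equivOfCardEq (by simp only [Fintype.card_fin, Fintype.card_sigma]; exact (hκ _ _).symm)⟩
  let e := fun p => Classical.choice (he p)
  let e1 : ((b : Fin (∑ i, κ i)) × Fin (h (F b).1)) ≃
      ((q : (i : Fin r) × Fin (κ i)) × Fin (h q.1)) :=
    Equiv.sigmaCongrLeft (β := fun q : (i : Fin r) × Fin (κ i) => Fin (h q.1)) F
  let e2 : ((q : (i : Fin r) × Fin (κ i)) × Fin (h q.1)) ≃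
      ((p : (i : Fin r) × Fin (h i)) × Fin (κ p.1)) :=
    { toFun := fun s => ⟨⟨s.1.1, s.2⟩, s.1.2⟩
      invFun := fun s => ⟨⟨s.1.1, s.2⟩, s.1.2⟩
      left_inv := fun _ => rfl
      right_inv := fun _ => rfl }
  let e3 : ((p : (i : Fin r) × Fin (h i)) × Fin (κ p.1)) ≃
      ((p : (i : Fin r) × Fin (h i)) × (τ : Bool × Bool) × Fin (M (p, τ))) :=
    Equiv.sigmaCongrRight e
  let e4 : ((p : (i : Fin r) × Fin (h i)) × (τ : Bool × Bool) × Fin (M (p, τ))) ≃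
      ((k : ((i : Fin r) × Fin (h i)) × (Bool × Bool)) × Fin (M k)) :=
    { toFun := fun s => ⟨(s.1, s.2.1), s.2.2⟩
      invFun := fun s => ⟨s.1.1, s.1.2, s.2⟩
      left_inv := fun _ => rfl
      right_inv := fun _ => rfl }
  refine ⟨fun b => (F b).1, ((e1.trans e2).trans e3).trans e4, fun b j => rfl, fun i => ?_⟩
  have e5 : {b // (F b).1 = i} ≃ {q : (i : Fin r) × Fin (κ i) // q.1 = i} :=
    F.subtypeEquiv fun _ => Iff.rfl
  rw [Fintype.card_congr (e5.trans (Equiv.sigmaSubtype i)), Fintype.card_fin]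

lemma card_sigma_sub {I : Type*} [Fintype I] (M : I → ℕ) (Q : I → Prop) [DecidablePred Q] :
    Nat.card {s : (k : I) × Fin (M k) // Q s.1} = ∑ k, if Q k then M k else 0 := by
  classical
  rw [Nat.card_eq_fintype_card, Fintype.card_subtype, Finset.card_filter, Fintype.sum_sigma]
  refine Finset.sum_congr rfl fun k _ => ?_
  split_ifs <;> simp


/-- given a KR-partition `𝒯` with at least three columns and clopen sets
`U ∼_K V`, there is a KR-partition `𝒮` refining `𝒯`, compatible with `U` and `V`, such that
each column of `𝒮` has as many atoms contained in `U` as atoms contained in `V`, all columns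
of `𝒮` have the same height, each contains a copy of every column of `𝒯`, and no two columns
of `𝒮` are `𝒯`-twins. -/
theorem tower_compatible_with_equimeasure_sets
    {X : Type*} [TopologicalSpace X] [CompactSpace X] [TopologicalSpace.MetrizableSpace X]
    [TotallyDisconnectedSpace X] [Nonempty X] [MeasurableSpace X] [BorelSpace X]
    (hX : Perfect (Set.univ : Set X))
    (K : Set (ProbabilityMeasure X)) (hK : IsDynSimplex K) (hdiv : Divisible K)
    (T : KRPartition X K) (hT : 3 ≤ T.n)
    (U V : Set X) (hU : IsClopen U) (hV : IsClopen V)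
    (hUV : ∀ μ ∈ K, (μ : Measure X) U = (μ : Measure X) V) :
    ∃ S : KRPartition X K, S.Refines T ∧
      (∀ (c : Fin S.n) (j : Fin (S.height c)), S.atom c j ⊆ U ∨ Disjoint (S.atom c j) U) ∧
      (∀ (c : Fin S.n) (j : Fin (S.height c)), S.atom c j ⊆ V ∨ Disjoint (S.atom c j) V) ∧
      (∀ c : Fin S.n,
        {j : Fin (S.height c) | S.atom c j ⊆ U}.ncard
          = {j : Fin (S.height c) | S.atom c j ⊆ V}.ncard) ∧
      (∀ c c' : Fin S.n, S.height c = S.height c') ∧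
      (∀ (c : Fin S.n) (i : Fin T.n), ∃ j : ℕ, KRPartition.IsCopyAt S T c i j) ∧
      (∀ c c' : Fin S.n, c ≠ c' → ¬ KRPartition.Twins S T c c') := by
  classical
  have hsys := sys_of_dynSimplex K hK hdiv
  set m : K → Set X → ℝ :=
    fun (μ : K) (A : Set X) => ((μ : ProbabilityMeasure X) : Measure X).real A with hm
  have hmeq : ∀ A B : Set X, (∀ μ : K, m μ A = m μ B) → ∀ μ ∈ K,
      (μ : Measure X) A = (μ : Measure X) B := fun A B hAB μ hμ =>
    (ENNReal.toReal_eq_toReal_iff' (measure_ne_top _ _) (measure_ne_top _ _)).1 (hAB ⟨μ, hμ⟩)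
  obtain ⟨n, N, M, Y, i₀, hn, hN, hY, hMN, hMlev, hMbal, hMx, hMdist, hMpos⟩ :=
    step1 m hsys T hT
      (fun i j j' μ => by simp only [hm, measureReal_def, T.measure_eq i j j' μ μ.2])
      U V hU hV (fun μ => by simp only [hm, measureReal_def, hUV μ μ.2])
  have hcarve : ∀ k : CellIdx T, ∃ W : ((c : Fin n) × Fin (M c k)) → Set X,
      (∀ j, IsClopen (W j)) ∧ (∀ j, (W j).Nonempty) ∧ (∀ j μ, m μ (W j) = Y j.1 μ) ∧
      (∀ i j, i ≠ j → Disjoint (W i) (W j)) ∧ (⋃ j, W j) = cell T U V k := by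
    intro k
    refine hsys.carve_fintype 
      (fun j : (c : Fin n) × Fin (M c k) => Y j.1) (fun j => hY j.1) _ (cell_clopen T hU hV k) ?_
    intro μ
    rw [hMx, Fintype.sum_sigma]
    simp
  choose W hWc hWn hWm hWd hWU using hcarve
  let κ : Fin n → Fin T.n → ℕ := fun c i => ∑ τ, M c (⟨i, ⟨0, T.height_pos i⟩⟩, τ)
  choose typ G hG hcard using fun c =>
    exists_blocks T.n T.height (M c) (κ c) (fun i j => hMlev c i j _)
  have hWsub : ∀ k a, W k a ⊆ cell T U V k := fun k a => by
    rw [← hWU k]; exact Set.subset_iUnion (W k) a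
  have hWinj : ∀ (s s' : (c : Fin n) × (k : CellIdx T) × Fin (M c k)) (x : X),
      x ∈ W s.2.1 ⟨s.1, s.2.2⟩ → x ∈ W s'.2.1 ⟨s'.1, s'.2.2⟩ → s = s' := by
    rintro ⟨c, k, l⟩ ⟨c', k', l'⟩ x hx hx'
    dsimp only at hx hx'
    have hk := cell_eq T k k' (hWsub _ _ hx) (hWsub _ _ hx')
    subst hk
    have hcl : (⟨c, l⟩ : (c : Fin n) × Fin (M c k)) = ⟨c', l'⟩ := by
      by_contra hne
      exact Set.disjoint_left.1 (hWd k _ _ hne) hx hx'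
    obtain ⟨rfl, h2⟩ := Sigma.mk.inj_iff.1 hcl
    rw [eq_of_heq h2]
  let D : TowerData T :=
    { n := n
      npos := hn
      B := fun c => ∑ i, κ c i
      Bpos := fun c => Finset.sum_pos (fun i _ => hMpos c i _) ⟨⟨0, T.npos⟩, Finset.mem_univ _⟩
      typ := typ
      A := fun c b j => W (G c ⟨b, j⟩).1 ⟨c, (G c ⟨b, j⟩).2⟩
      clopen := fun c b j => hWc _ _
      nonempty := fun c b j => hWn _ _
      disj := by
        rintro ⟨c, b, j⟩ ⟨c', b', j'⟩ x hx hx'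
        have := hWinj ⟨c, G c ⟨b, j⟩⟩ ⟨c', G c' ⟨b', j'⟩⟩ x hx hx'
        obtain ⟨rfl, h2⟩ := Sigma.mk.inj_iff.1 this
        have h3 := (G c).injective (eq_of_heq h2)
        rw [h3]
      cover := by
        intro x
        obtain ⟨k, hk⟩ := exists_cell T U V x
        rw [← hWU k, Set.mem_iUnion] at hk
        obtain ⟨⟨c, l⟩, hx⟩ := hk
        obtain ⟨⟨b, j⟩, hbj⟩ := (G c).surjective ⟨k, l⟩
        refine ⟨c, b, j, ?_⟩
        rw [hbj]
        exact hx
      meas := fun c b j b' j' => hmeq _ _ fun μ => by rw [hWm, hWm]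
      sub := by
        intro c b j x hx
        have := (hWsub _ _ hx).1
        rw [hG] at this
        exact this }
  have hDA : ∀ (c : Fin n) (q : (b : Fin (∑ i, κ c i)) × Fin (T.height (typ c b))),
      D.A c q.1 q.2 = W (G c q).1 ⟨c, (G c q).2⟩ := fun c q => rfl
  have hAU : ∀ (c : Fin n) (q : (b : Fin (∑ i, κ c i)) × Fin (T.height (typ c b))) (x : X),
      x ∈ D.A c q.1 q.2 → pat U V x = (G c q).1.2 := fun c q x hx => (hWsub _ _ hx).2
  have hUiff : ∀ (c : Fin n) (q : (b : Fin (∑ i, κ c i)) × Fin (T.height (typ c b))),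
      D.A c q.1 q.2 ⊆ U ↔ (G c q).1.2.1 = true := by
    intro c q
    constructor
    · intro hs
      obtain ⟨x, hx⟩ := D.nonempty c q.1 q.2
      rw [← hAU c q x hx]
      exact (pat_fst U V x).2 (hs hx)
    · intro ht x hx
      rw [← hAU c q x hx] at ht
      exact (pat_fst U V x).1 ht
  have hViff : ∀ (c : Fin n) (q : (b : Fin (∑ i, κ c i)) × Fin (T.height (typ c b))),
      D.A c q.1 q.2 ⊆ V ↔ (G c q).1.2.2 = true := by
    intro c q
    constructor
    · intro hs
      obtain ⟨x, hx⟩ := D.nonempty c q.1 q.2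
      rw [← hAU c q x hx]
      exact (pat_snd U V x).2 (hs hx)
    · intro ht x hx
      rw [← hAU c q x hx] at ht
      exact (pat_snd U V x).1 ht
  have hht : ∀ c : Fin n, D.toKR.height c = N := by
    intro c
    have h1 := Fintype.card_congr (G c)
    simp only [Fintype.card_sigma, Fintype.card_fin] at h1
    rw [hMN] at h1
    exact h1
  have hcop : ∀ (c : Fin n) (i : Fin T.n), KRPartition.numCopies D.toKR T c i = κ c i :=
    fun c i => (D.numCopies_eq c i).trans (hcard c i)
  have hexc : ∀ (c : Fin n) (i : Fin T.n), ∃ j : ℕ, KRPartition.IsCopyAt D.toKR T c i j := by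
    intro c i
    have h1 : 0 < Fintype.card {b // typ c b = i} := by
      rw [hcard]; exact hMpos c i _
    obtain ⟨⟨b, hb⟩⟩ := Fintype.card_pos_iff.1 h1
    exact ⟨D.off c b, (D.isCopyAt_iff c i _).2 ⟨b, hb, rfl⟩⟩
  refine ⟨D.toKR, D.refines, ?_, ?_, ?_, ?_, ?_, ?_⟩
  · intro c p
    change D.A c ((D.E c).symm p).1 ((D.E c).symm p).2 ⊆ U ∨
      Disjoint (D.A c ((D.E c).symm p).1 ((D.E c).symm p).2) U
    by_cases ht : (G c ((D.E c).symm p)).1.2.1 = true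
    · exact Or.inl ((hUiff c _).2 ht)
    · refine Or.inr (Set.disjoint_left.2 fun x hx hxU => ht ?_)
      rw [← hAU c _ x hx]
      exact (pat_fst U V x).2 hxU
  · intro c p
    change D.A c ((D.E c).symm p).1 ((D.E c).symm p).2 ⊆ V ∨
      Disjoint (D.A c ((D.E c).symm p).1 ((D.E c).symm p).2) V
    by_cases ht : (G c ((D.E c).symm p)).1.2.2 = true
    · exact Or.inl ((hViff c _).2 ht)
    · refine Or.inr (Set.disjoint_left.2 fun x hx hxV => ht ?_)
      rw [← hAU c _ x hx]
      exact (pat_snd U V x).2 hxV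
  · intro c
    refine (D.ncard_eq c (fun A => A ⊆ U)).trans (Eq.trans ?_ (D.ncard_eq c (fun A => A ⊆ V)).symm)
    have e1 := Nat.card_congr ((G c).subtypeEquiv
      (p := fun q => D.A c q.1 q.2 ⊆ U) (q := fun s => s.1.2.1 = true) (hUiff c))
    have e2 := Nat.card_congr ((G c).subtypeEquiv
      (p := fun q => D.A c q.1 q.2 ⊆ V) (q := fun s => s.1.2.2 = true) (hViff c))
    rw [card_sigma_sub (M c) (fun k => k.2.1 = true)] at e1
    rw [card_sigma_sub (M c) (fun k => k.2.2 = true)] at e2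
    exact e1.trans ((hMbal c).trans e2.symm)
  · exact fun c c' => (hht c).trans (hht c').symm
  · exact hexc
  · intro c c' hne htw
    have h1 := htw i₀
    rw [hht c, hht c', hcop c, hcop c'] at h1
    have hN' : (N : ℚ) ≠ 0 := by exact_mod_cast hN.ne'
    rw [div_left_inj' hN'] at h1
    exact hMdist c c' hne (by exact_mod_cast h1)
end

section
/- Let X be a Cantor space. The set Min(X) of minimal homeomorphisms of X is a Gδ subset of Homeo(X). -/
open MeasureTheory Set

/-- The topology on the homeomorphism group of a compact space: induced by the
(compact-open, i.e. uniform convergence) topology on continuous self-maps, recording both a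
homeomorphism and its inverse. -/
instance homeoGroupTopology {X : Type*} [TopologicalSpace X] : TopologicalSpace (X ≃ₜ X) :=
  TopologicalSpace.induced
    (fun φ : X ≃ₜ X => ((φ : C(X, X)), ((φ.symm : C(X, X))))) inferInstance

/-- A homeomorphism is minimal if every one of its (two-sided) orbits is dense. -/
def IsMinimalHomeo {X : Type*} [TopologicalSpace X] (φ : X ≃ₜ X) : Prop :=
  ∀ x : X, Dense (Set.range fun k : ℤ => (φ.toEquiv ^ k) x)

theorem aux_cont_apply {X : Type*} [TopologicalSpace X] [LocallyCompactSpace X] :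
    Continuous (fun p : (X ≃ₜ X) × X => p.1 p.2) := by
  have h0 : Continuous (fun φ : X ≃ₜ X => ((φ : C(X, X)), ((φ.symm : C(X, X))))) :=
    continuous_induced_dom
  have h1 : Continuous (fun φ : X ≃ₜ X => (φ : C(X, X))) := continuous_fst.comp h0
  have h2 : Continuous (fun p : (X ≃ₜ X) × X => ((p.1 : C(X, X)), p.2)) :=
    (h1.comp continuous_fst).prodMk continuous_snd
  exact (ContinuousEval.continuous_eval (F := C(X, X))).comp h2

theorem aux_cont_symm_apply {X : Type*} [TopologicalSpace X] [LocallyCompactSpace X] :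
    Continuous (fun p : (X ≃ₜ X) × X => p.1.symm p.2) := by
  have h0 : Continuous (fun φ : X ≃ₜ X => ((φ : C(X, X)), ((φ.symm : C(X, X))))) :=
    continuous_induced_dom
  have h1 : Continuous (fun φ : X ≃ₜ X => (φ.symm : C(X, X))) := continuous_snd.comp h0
  have h2 : Continuous (fun p : (X ≃ₜ X) × X => ((p.1.symm : C(X, X)), p.2)) :=
    (h1.comp continuous_fst).prodMk continuous_snd
  exact (ContinuousEval.continuous_eval (F := C(X, X))).comp h2

theorem aux_cont_zpow {X : Type*} [TopologicalSpace X] [LocallyCompactSpace X] (k : ℤ) :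
    Continuous (fun p : (X ≃ₜ X) × X => (p.1.toEquiv ^ k) p.2) := by
  induction k using Int.induction_on with
  | zero => simpa using continuous_snd
  | succ n ih =>
    have h := aux_cont_apply.comp (continuous_fst.prodMk ih)
    refine h.congr fun p => ?_
    rw [add_comm, zpow_add, zpow_one]
    rfl
  | pred n ih =>
    have h := aux_cont_symm_apply.comp (continuous_fst.prodMk ih)
    refine h.congr fun p => ?_
    rw [sub_eq_add_neg, add_comm, zpow_add, zpow_neg_one]
    rfl

theorem aux_isOpen {X : Type*} [TopologicalSpace X] [CompactSpace X] [LocallyCompactSpace X]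
    {U : Set X} (hU : IsOpen U) :
    IsOpen {φ : X ≃ₜ X | ∀ x : X, ∃ k : ℤ, (φ.toEquiv ^ k) x ∈ U} := by
  have h1 : IsOpen (⋃ k : ℤ, {p : (X ≃ₜ X) × X | (p.1.toEquiv ^ k) p.2 ∈ U}) :=
    isOpen_iUnion fun k => hU.preimage (aux_cont_zpow k)
  have h2 := isClosedMap_fst_of_compactSpace (X := X ≃ₜ X) (Y := X) _ h1.isClosed_compl
  rw [← isOpen_compl_iff] at h2
  convert h2 using 1
  ext φ
  simp

/-- the set of minimal homeomorphisms of a Cantor space `X` is a Gδ subset of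
`Homeo(X)`. -/
theorem isGδ_minimalHomeos
    {X : Type*} [TopologicalSpace X] [CompactSpace X] [TopologicalSpace.MetrizableSpace X]
    [TotallyDisconnectedSpace X] [Nonempty X]
    (hX : Perfect (Set.univ : Set X)) :
    IsGδ {φ : X ≃ₜ X | IsMinimalHomeo φ} := by
  have : SecondCountableTopology X := by
    letI := TopologicalSpace.metrizableSpaceMetric X
    infer_instance
  have key : {φ : X ≃ₜ X | IsMinimalHomeo φ} =
      ⋂ U ∈ TopologicalSpace.countableBasis X,
        {φ : X ≃ₜ X | ∀ x : X, ∃ k : ℤ, (φ.toEquiv ^ k) x ∈ U} := by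
    ext φ
    simp only [mem_setOf_eq, mem_iInter, IsMinimalHomeo]
    constructor
    · intro h U hU x
      obtain ⟨_, hy, k, rfl⟩ := (h x).inter_open_nonempty U
        (TopologicalSpace.isOpen_of_mem_countableBasis hU)
        (TopologicalSpace.nonempty_of_mem_countableBasis hU)
      exact ⟨k, hy⟩
    · intro h x
      rw [(TopologicalSpace.isBasis_countableBasis X).dense_iff]
      intro U hU _
      obtain ⟨k, hk⟩ := h U hU x
      exact ⟨_, hk, k, rfl⟩
  rw [key]
  exact IsGδ.biInter (TopologicalSpace.countable_countableBasis X) fun U hU =>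
    (aux_isOpen (TopologicalSpace.isOpen_of_mem_countableBasis hU)).isGδ
end

section
/- Let X be a Cantor space, n ∈ ℕ, U_0,…,U_n clopen subsets of X, and I_0,…,I_n closed subintervals of [0,1]. Then the set A = {φ ∈ Homeo(X) : there exists a Borel probability measure μ on X with φ_*μ = μ and μ(U_j) ∈ I_j for all j ∈ {0,…,n}} is a closed subset of Homeo(X). -/
open MeasureTheory Set

open Filter Topology BoundedContinuousFunction in
theorem pairing_continuous {X : Type*} [TopologicalSpace X] [CompactSpace X]
    [MeasurableSpace X] [BorelSpace X] :
    Continuous (fun p : ProbabilityMeasure X × C(X, ℝ) => ∫ x, p.2 x ∂(p.1 : Measure X)) := by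
  refine continuous_prod_of_continuous_lipschitzWith' _ 1 ?_ ?_
  · intro μ
    refine LipschitzWith.of_dist_le_mul fun f g => ?_
    have hint : ∀ f : C(X, ℝ), Integrable (fun x => f x) (μ : Measure X) := fun f =>
      (BoundedContinuousFunction.mkOfCompact f).integrable _
    simp only [NNReal.coe_one, one_mul]
    rw [Real.dist_eq, ← integral_sub (hint f) (hint g), ← Real.norm_eq_abs]
    refine (norm_integral_le_of_norm_le_const (C := dist f g)
      (Eventually.of_forall fun x => ?_)).trans ?_
    · rw [← dist_eq_norm]
      exact ContinuousMap.dist_apply_le_dist x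
    · simp
  · intro f
    exact ProbabilityMeasure.continuous_integral_boundedContinuousFunction
      (BoundedContinuousFunction.mkOfCompact f)

/-- given clopen sets `U_0, …, U_n` and closed subintervals `I_0, …, I_n` of
`[0,1]`, the set of homeomorphisms `φ` admitting an invariant Borel probability measure `μ`
with `μ(U_j) ∈ I_j` for all `j` is closed in `Homeo(X)`. -/
theorem isClosed_homeos_with_invariant_measure_in_intervals
    {X : Type*} [TopologicalSpace X] [CompactSpace X] [TopologicalSpace.MetrizableSpace X]
    [TotallyDisconnectedSpace X] [Nonempty X] [MeasurableSpace X] [BorelSpace X]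
    (hX : Perfect (Set.univ : Set X))
    (n : ℕ) (U : Fin (n + 1) → Set X) (hU : ∀ j, IsClopen (U j))
    (I : Fin (n + 1) → Set ℝ)
    (hI : ∀ j, ∃ a b : ℝ, 0 ≤ a ∧ b ≤ 1 ∧ I j = Set.Icc a b) :
    IsClosed {φ : X ≃ₜ X | ∃ μ : ProbabilityMeasure X,
      (μ : Measure X).map φ = (μ : Measure X) ∧
      ∀ j : Fin (n + 1), ((μ : Measure X) (U j)).toReal ∈ I j} := by
  have hcl : IsClosed {p : ProbabilityMeasure X × (X ≃ₜ X) |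
      (p.1 : Measure X).map p.2 = (p.1 : Measure X) ∧
      ∀ j : Fin (n + 1), ((p.1 : Measure X) (U j)).toReal ∈ I j} := by
    have hφ : Continuous (fun φ : X ≃ₜ X => (φ : C(X, X))) :=
      continuous_fst.comp (continuous_induced_dom
        (f := fun φ : X ≃ₜ X => ((φ : C(X, X)), (φ.symm : C(X, X)))))
    have key : ∀ p : ProbabilityMeasure X × (X ≃ₜ X),
        (p.1 : Measure X).map p.2 = (p.1 : Measure X) ↔ ∀ f : C(X, ℝ),
          ∫ x, (f.comp (p.2 : C(X, X))) x ∂(p.1 : Measure X) = ∫ x, f x ∂(p.1 : Measure X) := by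
      rintro ⟨μ, φ⟩
      have hm : ∀ f : C(X, ℝ), ∫ x, f x ∂((μ : Measure X).map φ)
          = ∫ x, (f.comp (φ : C(X, X))) x ∂(μ : Measure X) := fun f =>
        φ.measurableEmbedding.integral_map _
      constructor
      · intro h f
        rw [← hm, h]
      · intro h
        have : IsProbabilityMeasure ((μ : Measure X).map φ) :=
          Measure.isProbabilityMeasure_map φ.continuous.measurable.aemeasurable
        letI := TopologicalSpace.metrizableSpaceMetric X
        refine ext_of_forall_integral_eq_of_IsFiniteMeasure fun f => ?_
        exact (hm f.toContinuousMap).trans (h f.toContinuousMap)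
    simp only [key, Set.setOf_and, Set.setOf_forall]
    refine IsClosed.inter (isClosed_iInter fun f => ?_) (isClosed_iInter fun j => ?_)
    · refine isClosed_eq ?_ ?_
      · exact pairing_continuous.comp (continuous_fst.prodMk
          ((f.continuous_postcomp.comp hφ).comp continuous_snd))
      · exact pairing_continuous.comp (continuous_fst.prodMk continuous_const)
    · obtain ⟨a, b, -, -, hab⟩ := hI j
      rw [hab]
      letI := TopologicalSpace.metrizableSpaceMetric X
      have hc : Continuous (fun μ : ProbabilityMeasure X => μ (U j)) :=
        continuous_iff_continuousAt.2 fun μ =>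
          ProbabilityMeasure.tendsto_measure_of_isClopen_of_tendsto Filter.tendsto_id (hU j)
      exact isClosed_Icc.preimage (NNReal.continuous_coe.comp (hc.comp continuous_fst))
  have := isClosedMap_snd_of_compactSpace _ hcl
  convert this using 1
  ext φ
  simp
end

section
/- Let A be a finite alphabet and x ∈ A^ℤ a Toeplitz sequence. Then the Toeplitz subshift associated to x is minimal: the closure F of the S-orbit of x is S-invariant, and for every y ∈ F the S-orbit of y is dense in F. -/
open Set

/-- The `k`-th power of the shift map on `ℤ → A`: `shiftBy k x n = x (n + k)`
(`shiftBy 1` is the shift `S`, with `S x n = x (n + 1)`). -/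
def shiftBy {A : Type*} (k : ℤ) (x : ℤ → A) : ℤ → A := fun n => x (n + k)

/-- `x` is quasiperiodic: every position occurs periodically. -/
def Quasiperiodic {A : Type*} (x : ℤ → A) : Prop :=
  ∀ m : ℤ, ∃ p : ℤ, p ≠ 0 ∧ ∀ n : ℤ, x m = x (m + n * p)

/-- `x` is periodic. -/
def IsPeriodic {A : Type*} (x : ℤ → A) : Prop :=
  ∃ p : ℤ, p ≠ 0 ∧ ∀ m : ℤ, x (m + p) = x m

/-- `x` is a Toeplitz sequence: quasiperiodic but not periodic. -/
def IsToeplitz {A : Type*} (x : ℤ → A) : Prop :=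
  Quasiperiodic x ∧ ¬ IsPeriodic x

/-- The underlying space of the Toeplitz subshift associated to `x`: the closure of the
orbit of `x` under the shift (in the product topology). -/
def orbitClosure {A : Type*} [TopologicalSpace A] (x : ℤ → A) : Set (ℤ → A) :=
  closure {y : ℤ → A | ∃ k : ℤ, y = shiftBy k x}

theorem mem_closure_iff_finset {A : Type*} [TopologicalSpace A] [DiscreteTopology A]
    (T : Set (ℤ → A)) (y : ℤ → A) :
    y ∈ closure T ↔ ∀ I : Finset ℤ, ∃ z ∈ T, ∀ i ∈ I, z i = y i := by
  constructor
  · intro h I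
    have ho : IsOpen ((I : Set ℤ).pi (fun i => ({y i} : Set A))) :=
      isOpen_set_pi I.finite_toSet (fun i _ => isOpen_discrete _)
    obtain ⟨z, hz, hzT⟩ := mem_closure_iff.1 h _ ho (fun i _ => rfl)
    exact ⟨z, hzT, fun i hi => hz i hi⟩
  · intro h
    rw [mem_closure_iff]
    intro o ho hy
    obtain ⟨I, u, hu, hsub⟩ := isOpen_pi_iff.1 ho y hy
    obtain ⟨z, hz, hzi⟩ := h I
    refine ⟨z, hsub ?_, hz⟩
    intro i hi
    rw [hzi i hi]
    exact (hu i hi).2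

theorem Quasiperiodic.common_period {A : Type*} {x : ℤ → A} (hx : Quasiperiodic x)
    (I : Finset ℤ) :
    ∃ p : ℤ, p ≠ 0 ∧ ∀ i ∈ I, ∀ n : ℤ, x i = x (i + n * p) := by
  choose p hp0 hp using hx
  refine ⟨∏ i ∈ I, p i, Finset.prod_ne_zero_iff.2 fun i _ => hp0 i, ?_⟩
  intro i hi n
  obtain ⟨c, hc⟩ := Finset.dvd_prod_of_mem p hi
  rw [hc, hp i (n * c)]
  congr 1
  ring

/-- the Toeplitz subshift associated to a Toeplitz sequence `x` is minimal:
the closure `F` of the shift-orbit of `x` is shift-invariant, and the orbit of every `y ∈ F`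
is dense in `F`. -/
theorem toeplitz_subshift_minimal
    {A : Type*} [Finite A] [TopologicalSpace A] [DiscreteTopology A]
    (x : ℤ → A) (hx : IsToeplitz x) :
    (∀ y ∈ orbitClosure x, ∀ k : ℤ, shiftBy k y ∈ orbitClosure x) ∧
    (∀ y ∈ orbitClosure x,
      orbitClosure x ⊆ closure {z : ℤ → A | ∃ k : ℤ, z = shiftBy k y}) := by
  constructor
  · intro y hy k
    rw [orbitClosure, mem_closure_iff_finset] at hy ⊢
    intro I
    obtain ⟨_, ⟨l, rfl⟩, hl⟩ := hy (I.image (fun i => i + k))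
    refine ⟨_, ⟨l + k, rfl⟩, fun i hi => ?_⟩
    have h := hl (i + k) (Finset.mem_image_of_mem _ hi)
    simp only [shiftBy] at h ⊢
    rw [← h]
    congr 1
    ring
  · intro y hy z hz
    rw [orbitClosure, mem_closure_iff_finset] at hy hz
    rw [mem_closure_iff_finset]
    intro I
    obtain ⟨_, ⟨k, rfl⟩, hk⟩ := hz I
    obtain ⟨p, hp0, hp⟩ := hx.1.common_period (I.image (fun i => i + k))
    obtain ⟨_, ⟨l, rfl⟩, hl⟩ := hy
      ((I ×ˢ Finset.Ico (0 : ℤ) |p|).image (fun q => q.1 + q.2))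
    refine ⟨_, ⟨(k - l) % p, rfl⟩, fun i hi => ?_⟩
    have hr : (k - l) % p ∈ Finset.Ico (0 : ℤ) |p| :=
      Finset.mem_Ico.2 ⟨Int.emod_nonneg _ hp0, Int.emod_lt_abs _ hp0⟩
    have h1 := hl (i + (k - l) % p)
      (Finset.mem_image.2 ⟨(i, (k - l) % p), Finset.mem_product.2 ⟨hi, hr⟩, rfl⟩)
    have h2 := hp (i + k) (Finset.mem_image_of_mem _ hi) (-((k - l) / p))
    have h3 := hk i hi
    simp only [shiftBy] at h1 h3 ⊢
    rw [← h1, ← h3, h2]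
    congr 1
    have h4 := Int.emod_add_mul_ediv (k - l) p
    linear_combination h4
end

section
/- Let X be a Cantor space, K a dynamical simplex on X, and U, V clopen subsets of X. Then μ(U) = μ(V) for all μ ∈ K if and only if there exists a homeomorphism g of X such that g_*μ = μ for all μ ∈ K and g(U) = V. -/
open MeasureTheory Set
open scoped ENNReal NNReal

open Classical in
/-- One half-step of the back-and-forth construction. -/
theorem bf_split {X : Type*} [TopologicalSpace X] [MeasurableSpace X] [BorelSpace X]
    (K : Set (ProbabilityMeasure X)) (hK : IsDynSimplex K)
    (A B C : Set X) (hA : IsClopen A) (hB : IsClopen B) (hC : IsClopen C)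
    (h : ∀ μ ∈ K, (μ : Measure X) A = (μ : Measure X) B) :
    ∃ D : Set X, IsClopen D ∧ D ⊆ B ∧
      ∀ μ ∈ K, (μ : Measure X) D = (μ : Measure X) (A ∩ C) := by
  by_cases h2 : A ⊆ C
  · exact ⟨B, hB, subset_rfl, fun μ hμ => by rw [inter_eq_left.2 h2, h μ hμ]⟩
  have hne : (A \ C).Nonempty := by
    rw [Set.nonempty_iff_ne_empty, Ne, Set.diff_eq_empty]; exact h2
  refine hK.2.2.2.2.2 (A ∩ C) B (hA.inter hC) hB fun μ hμ => ?_
  have hop := hK.2.2.2.2.1 μ hμ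
  have hpos : 0 < (μ : Measure X) (A \ C) :=
    (hA.isOpen.sdiff hC.isClosed).measure_pos _ hne
  rw [← h μ hμ, ← measure_inter_add_diff (μ := (μ : Measure X)) A hC.isOpen.measurableSet]
  exact ENNReal.lt_add_right (measure_ne_top _ _) hpos.ne'

/-- A state of the back-and-forth construction. -/
def BFGood {X : Type*} [TopologicalSpace X] [MeasurableSpace X]
    (K : Set (ProbabilityMeasure X)) (a b : X → List Bool) : Prop :=
  IsLocallyConstant a ∧ IsLocallyConstant b ∧
    ∀ μ ∈ K, ∀ s, (μ : Measure X) (a ⁻¹' {s}) = (μ : Measure X) (b ⁻¹' {s})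

theorem BFGood.symm {X : Type*} [TopologicalSpace X] [MeasurableSpace X]
    {K : Set (ProbabilityMeasure X)} {a b : X → List Bool} (h : BFGood K a b) : BFGood K b a :=
  ⟨h.2.1, h.1, fun μ hμ s => (h.2.2 μ hμ s).symm⟩

theorem bf_clopen_of_locConst {X Y : Type*} [TopologicalSpace X] {a : X → Y}
    (h : IsLocallyConstant a) (s : Set Y) : IsClopen (a ⁻¹' s) :=
  ⟨⟨by rw [← Set.preimage_compl]; exact h _⟩, h _⟩

open Classical in
theorem bf_step {X : Type*} [TopologicalSpace X] [MeasurableSpace X] [BorelSpace X]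
    (K : Set (ProbabilityMeasure X)) (hK : IsDynSimplex K)
    (a b : X → List Bool) (h : BFGood K a b) (C : Set X) (hC : IsClopen C) :
    ∃ d : X → Bool, BFGood K (fun x => decide (x ∈ C) :: a x) (fun x => d x :: b x) := by
  obtain ⟨ha, hb, hm⟩ := h
  choose D hD hDB hDm using fun s => bf_split K hK (a ⁻¹' {s}) (b ⁻¹' {s}) C
    (bf_clopen_of_locConst ha _) (bf_clopen_of_locConst hb _) hC (fun μ hμ => hm μ hμ s)
  have hloc : ∀ (E : Set X), IsClopen E → IsLocallyConstant (fun x => decide (x ∈ E)) := by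
    intro E hE
    rw [IsLocallyConstant.iff_eventually_eq]
    intro x
    by_cases hx : x ∈ E
    · filter_upwards [hE.isOpen.mem_nhds hx] with y hy
      simp [hx, hy]
    · filter_upwards [hE.compl.isOpen.mem_nhds hx] with y hy
      simp only [hx, show y ∉ E from hy]
  have hd : IsLocallyConstant (fun x => decide (x ∈ D (b x))) := by
    rw [IsLocallyConstant.iff_eventually_eq] at hb ⊢
    intro x
    filter_upwards [hb x, (IsLocallyConstant.iff_eventually_eq _).1 (hloc _ (hD (b x))) x]
      with y hy1 hy2
    rw [hy1]; exact hy2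
  refine ⟨fun x => decide (x ∈ D (b x)), ?_, ?_, ?_⟩
  · exact (hloc C hC).comp₂ ha List.cons
  · exact hd.comp₂ hb List.cons
  · intro μ hμ s
    rcases s with _ | ⟨t, s⟩
    · have e1 : (fun x => decide (x ∈ C) :: a x) ⁻¹' {([] : List Bool)} = ∅ := by ext; simp
      have e2 : (fun x => decide (x ∈ D (b x)) :: b x) ⁻¹' {([] : List Bool)} = ∅ := by
        ext; simp
      rw [e1, e2]
    · cases t
      · have e1 : (fun x => decide (x ∈ C) :: a x) ⁻¹' {false :: s}
            = (a ⁻¹' {s}) \ (a ⁻¹' {s} ∩ C) := by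
          ext x; simp; tauto
        have e2 : (fun x => decide (x ∈ D (b x)) :: b x) ⁻¹' {false :: s}
            = (b ⁻¹' {s}) \ D s := by
          ext x
          simp only [mem_preimage, mem_singleton_iff, List.cons.injEq, decide_eq_false_iff_not,
            mem_diff]
          constructor
          · rintro ⟨h1, rfl⟩; exact ⟨rfl, h1⟩
          · rintro ⟨rfl, h1⟩; exact ⟨h1, rfl⟩
        rw [e1, e2, measure_diff inter_subset_left
          ((bf_clopen_of_locConst ha _).inter hC).isOpen.measurableSet.nullMeasurableSet
          (measure_ne_top _ _),
          measure_diff (hDB s) (hD s).isOpen.measurableSet.nullMeasurableSet (measure_ne_top _ _),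
          hDm s μ hμ, hm μ hμ]
      · have e1 : (fun x => decide (x ∈ C) :: a x) ⁻¹' {true :: s} = a ⁻¹' {s} ∩ C := by
          ext x; simp; tauto
        have e2 : (fun x => decide (x ∈ D (b x)) :: b x) ⁻¹' {true :: s} = D s := by
          ext x
          simp only [mem_preimage, mem_singleton_iff, List.cons.injEq, decide_eq_true_eq]
          constructor
          · rintro ⟨h1, rfl⟩; exact h1
          · intro h1
            have : b x = s := hDB s h1
            exact ⟨this ▸ h1, this⟩
        rw [e1, e2, hDm s μ hμ]

theorem bf_measure_ext (μ ν : Measure (ℕ → Bool)) [IsProbabilityMeasure μ]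
    [IsProbabilityMeasure ν]
    (h : ∀ z n, μ (PiNat.cylinder z (n + 1)) = ν (PiNat.cylinder z (n + 1))) : μ = ν := by
  refine ext_of_generate_finite {s | ∃ (x : ℕ → Bool) (n : ℕ), s = PiNat.cylinder x n} ?_ ?_ ?_ ?_
  · rw [BorelSpace.measurable_eq (α := ℕ → Bool)]
    exact (PiNat.isTopologicalBasis_cylinders (fun _ : ℕ => Bool)).borel_eq_generateFrom
  · rintro _ ⟨x, n, rfl⟩ _ ⟨y, m, rfl⟩ ⟨z, hz1, hz2⟩
    rw [← PiNat.mem_cylinder_iff_eq.1 hz1, ← PiNat.mem_cylinder_iff_eq.1 hz2]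
    rcases le_total n m with hnm | hnm
    · exact ⟨z, m, inter_eq_right.2 (PiNat.cylinder_anti z hnm)⟩
    · exact ⟨z, n, inter_eq_left.2 (PiNat.cylinder_anti z hnm)⟩
  · rintro _ ⟨x, n, rfl⟩
    cases n with
    | zero => simp
    | succ n => exact h x n
  · simp

/-- If two continuous injections into the Cantor space push every measure of `K`
to the same measure, they differ by a homeomorphism. -/
theorem bf_homeo {X : Type*} [TopologicalSpace X] [CompactSpace X]
    [MeasurableSpace X] [BorelSpace X] (μ₀ : Measure X)
    [μ₀.IsOpenPosMeasure] (α β : X → ℕ → Bool) (hα : Continuous α) (hβ : Continuous β)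
    (iα : Function.Injective α) (iβ : Function.Injective β)
    (h : μ₀.map α = μ₀.map β) :
    ∃ g : X ≃ₜ X, ∀ x, β (g x) = α x := by
  have key : ∀ (α β : X → ℕ → Bool) (hα : Continuous α) (hβ : Continuous β)
      (h : μ₀.map α = μ₀.map β), range α ⊆ range β := by
    rintro α β hα hβ h _ ⟨x, rfl⟩
    by_contra hx
    have hO : IsOpen (range β)ᶜ := (isCompact_range hβ).isClosed.isOpen_compl
    have h1 : 0 < μ₀ (α ⁻¹' (range β)ᶜ) := (hO.preimage hα).measure_pos _ ⟨x, hx⟩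
    rw [← Measure.map_apply hα.measurable hO.measurableSet, h,
      Measure.map_apply hβ.measurable hO.measurableSet] at h1
    simp at h1
  have hr : range α = range β := (key α β hα hβ h).antisymm (key β α hβ hα h.symm)
  have eα := (hα.isClosedEmbedding iα).isEmbedding
  have eβ := (hβ.isClosedEmbedding iβ).isEmbedding
  refine ⟨(eα.toHomeomorph.trans (Homeomorph.setCongr hr)).trans eβ.toHomeomorph.symm, ?_⟩
  intro x
  have := eβ.toHomeomorph.apply_symm_apply (Homeomorph.setCongr hr (eα.toHomeomorph x))
  exact congrArg Subtype.val this

open Classical in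
theorem bf_forward {X : Type*} [TopologicalSpace X] [CompactSpace X]
    [TopologicalSpace.MetrizableSpace X]
    [TotallyDisconnectedSpace X] [MeasurableSpace X] [BorelSpace X]
    (K : Set (ProbabilityMeasure X)) (hK : IsDynSimplex K)
    (U V : Set X) (hU : IsClopen U) (hV : IsClopen V)
    (hUV : ∀ μ ∈ K, (μ : Measure X) U = (μ : Measure X) V) :
    ∃ g : X ≃ₜ X, (∀ μ ∈ K, (μ : Measure X).map g = (μ : Measure X)) ∧ g '' U = V := by
  letI := TopologicalSpace.metrizableSpaceMetric X
  have hcount : Countable (TopologicalSpace.Clopens X) :=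
    TopologicalSpace.Clopens.countable_iff_secondCountable.2 inferInstance
  obtain ⟨e, he⟩ := exists_surjective_nat (TopologicalSpace.Clopens X × Bool)
  let St := {p : (X → List Bool) × (X → List Bool) // BFGood K p.1 p.2}
  have hstep : ∀ (n : ℕ) (p : St), ∃ q : St,
      (∀ x, q.1.1 x = (q.1.1 x).headI :: p.1.1 x) ∧
      (∀ x, q.1.2 x = (q.1.2 x).headI :: p.1.2 x) ∧
      ((e n).2 = true → ∀ x, (q.1.1 x).headI = decide (x ∈ (e n).1)) ∧
      ((e n).2 = false → ∀ x, (q.1.2 x).headI = decide (x ∈ (e n).1)) := by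
    rintro n ⟨⟨a, b⟩, hab⟩
    rcases hn : (e n).2 with _ | _
    · obtain ⟨d, hd⟩ := bf_step K hK b a hab.symm (e n).1 (e n).1.isClopen
      exact ⟨⟨(_, _), hd.symm⟩, by simp, by simp, by simp, by simp⟩
    · obtain ⟨d, hd⟩ := bf_step K hK a b hab (e n).1 (e n).1.isClopen
      exact ⟨⟨(_, _), hd⟩, by simp, by simp, by simp, by simp⟩
  have hinit : ∃ d : X → Bool, BFGood K (fun x => [decide (x ∈ U)]) (fun x => [decide (x ∈ V)]) := by
    have hloc : ∀ (E : Set X), IsClopen E → IsLocallyConstant (fun x => [decide (x ∈ E)]) := by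
      intro E hE
      rw [IsLocallyConstant.iff_eventually_eq]
      intro x
      by_cases hx : x ∈ E
      · filter_upwards [hE.isOpen.mem_nhds hx] with y hy
        simp [hx, hy]
      · filter_upwards [hE.compl.isOpen.mem_nhds hx] with y hy
        simp only [hx, show y ∉ E from hy]
    refine ⟨fun _ => true, hloc U hU, hloc V hV, fun μ hμ s => ?_⟩
    have hpre : ∀ E : Set X, (fun x => [decide (x ∈ E)]) ⁻¹' {s} =
        if s = [true] then E else if s = [false] then Eᶜ else ∅ := by
      intro E
      split_ifs with h1 h2
      · subst h1; ext; simp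
      · subst h2; ext; simp
      · ext x
        by_cases hx : x ∈ E
        · simp [hx, Ne.symm h1]
        · simp [hx, Ne.symm h2]
    rw [hpre, hpre]
    split_ifs with h1 h2
    · exact hUV μ hμ
    · rw [prob_compl_eq_one_sub hU.isOpen.measurableSet, prob_compl_eq_one_sub hV.isOpen.measurableSet,
        hUV μ hμ]
    · rfl
  obtain ⟨-, hinit⟩ := hinit
  choose nxt hn1 hn2 hn3 hn4 using hstep
  let S : ℕ → St := fun n => Nat.rec ⟨(_, _), hinit⟩ (fun n p => nxt n p) n
  let α : X → ℕ → Bool := fun x n => ((S n).1.1 x).headI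
  let β : X → ℕ → Bool := fun x n => ((S n).1.2 x).headI
  have hSa : ∀ n x, (S n).1.1 x = ((List.range (n + 1)).map (α x)).reverse := by
    intro n x
    induction n with
    | zero => rfl
    | succ n ih =>
      rw [List.range_succ, List.map_append, List.reverse_append, ← ih]
      exact hn1 n (S n) x
  have hSb : ∀ n x, (S n).1.2 x = ((List.range (n + 1)).map (β x)).reverse := by
    intro n x
    induction n with
    | zero => rfl
    | succ n ih =>
      rw [List.range_succ, List.map_append, List.reverse_append, ← ih]
      exact hn2 n (S n) x
  have cα : Continuous α :=
    continuous_pi fun n => ((S n).2.1.comp List.headI).continuous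
  have cβ : Continuous β :=
    continuous_pi fun n => ((S n).2.2.1.comp List.headI).continuous
  have sep : ∀ x y : X, x ≠ y → ∃ C : TopologicalSpace.Clopens X, x ∈ C ∧ y ∉ C := by
    intro x y hxy
    obtain ⟨C, hC, h1, h2⟩ := exists_isClopen_of_totally_separated hxy
    exact ⟨⟨C, hC⟩, h1, h2⟩
  have iα : Function.Injective α := by
    intro x y hxy
    by_contra hne
    obtain ⟨C, hx, hy⟩ := sep x y hne
    obtain ⟨n, hn⟩ := he (C, true)
    have h1 := hn3 n (S n) (by rw [hn]) x
    have h2 := hn3 n (S n) (by rw [hn]) y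
    have h3 : ((nxt n (S n)).1.1 x).headI = ((nxt n (S n)).1.1 y).headI := congrFun hxy (n + 1)
    rw [h1, h2, hn] at h3
    simp [hx, hy] at h3
  have iβ : Function.Injective β := by
    intro x y hxy
    by_contra hne
    obtain ⟨C, hx, hy⟩ := sep x y hne
    obtain ⟨n, hn⟩ := he (C, false)
    have h1 := hn4 n (S n) (by rw [hn]) x
    have h2 := hn4 n (S n) (by rw [hn]) y
    have h3 : ((nxt n (S n)).1.2 x).headI = ((nxt n (S n)).1.2 y).headI := congrFun hxy (n + 1)
    rw [h1, h2, hn] at h3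
    simp [hx, hy] at h3
  have hmap : ∀ μ ∈ K, (μ : Measure X).map α = (μ : Measure X).map β := by
    intro μ hμ
    have := Measure.isProbabilityMeasure_map (μ := (μ : Measure X)) cα.measurable.aemeasurable
    have := Measure.isProbabilityMeasure_map (μ := (μ : Measure X)) cβ.measurable.aemeasurable
    refine bf_measure_ext _ _ fun z n => ?_
    have hcyl : MeasurableSet (PiNat.cylinder z (n + 1)) :=
      (PiNat.isOpen_cylinder (fun _ : ℕ => Bool) z (n + 1)).measurableSet
    rw [Measure.map_apply cα.measurable hcyl, Measure.map_apply cβ.measurable hcyl]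
    have hh : ∀ w : ℕ → Bool, w ∈ PiNat.cylinder z (n + 1) ↔
        ((List.range (n + 1)).map w).reverse = ((List.range (n + 1)).map z).reverse := by
      intro w
      rw [List.reverse_inj, PiNat.mem_cylinder_iff, List.map_inj_left]
      simp
    have h1 := (S n).2.2.2 μ hμ ((List.range (n + 1)).map z).reverse
    convert h1 using 2
    · ext x
      rw [mem_preimage, hh, mem_preimage, mem_singleton_iff, hSa]
    · ext x
      rw [mem_preimage, hh, mem_preimage, mem_singleton_iff, hSb]
  obtain ⟨μ₀, hμ₀⟩ := hK.1
  have := hK.2.2.2.2.1 μ₀ hμ₀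
  obtain ⟨g, hg⟩ := bf_homeo (μ₀ : Measure X) α β cα cβ iα iβ (hmap μ₀ hμ₀)
  have hmemb : MeasurableEmbedding β := (cβ.isClosedEmbedding iβ).measurableEmbedding
  refine ⟨g, fun μ hμ => ?_, ?_⟩
  · have h1 : ((μ : Measure X).map g).map β = (μ : Measure X).map β := by
      rw [Measure.map_map cβ.measurable g.continuous.measurable, ← hmap μ hμ]
      congr 1
      exact funext hg
    have h2 := congrArg (Measure.comap β) h1
    rwa [hmemb.comap_map, hmemb.comap_map] at h2
  · have hgU : ∀ x, g x ∈ V ↔ x ∈ U := by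
      intro x
      have h0 : decide (g x ∈ V) = decide (x ∈ U) := congrFun (hg x) 0
      simpa using h0
    ext y
    constructor
    · rintro ⟨x, hx, rfl⟩; exact (hgU x).2 hx
    · intro hy
      exact ⟨g.symm y, (hgU _).1 (by simpa using hy), by simp⟩

/-- for a dynamical simplex `K` and clopen sets `U, V`, one has `μ(U) = μ(V)`
for all `μ ∈ K` iff there is a homeomorphism `g` of `X` preserving every measure in `K` with
`g(U) = V`. -/
theorem equimeasure_iff_exists_measure_preserving_homeo
    {X : Type*} [TopologicalSpace X] [CompactSpace X] [TopologicalSpace.MetrizableSpace X]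
    [TotallyDisconnectedSpace X] [Nonempty X] [MeasurableSpace X] [BorelSpace X]
    (hX : Perfect (Set.univ : Set X))
    (K : Set (ProbabilityMeasure X)) (hK : IsDynSimplex K)
    (U V : Set X) (hU : IsClopen U) (hV : IsClopen V) :
    (∀ μ ∈ K, (μ : Measure X) U = (μ : Measure X) V) ↔
      ∃ g : X ≃ₜ X, (∀ μ ∈ K, (μ : Measure X).map g = (μ : Measure X)) ∧ g '' U = V := by
  constructor
  · exact bf_forward K hK U V hU hV
  · rintro ⟨g, hg, rfl⟩ μ hμ
    conv_rhs => rw [← hg μ hμ]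
    rw [Measure.map_apply g.continuous.measurable
      ((g.isOpen_image).2 hU.isOpen).measurableSet, g.injective.preimage_image]
end

section
/- Let Y be a nonempty compact metrizable zero-dimensional space. Suppose f_1,…,f_n and g_1,…,g_m are continuous functions Y → ℝ, each taking only finitely many values, all of which are rational and strictly positive, and suppose Σ_{i=1}^n f_i = Σ_{j=1}^m g_j. Then there exist continuous functions h_{i,j} : Y → ℝ (1 ≤ i ≤ n, 1 ≤ j ≤ m), each taking only finitely many values, all rational and strictly positive, such that f_i = Σ_{j=1}^m h_{i,j} for every i and g_j = Σ_{i=1}^n h_{i,j} for every j. -/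
open Set

/-- `f` takes only finitely many values, all of which are rational and strictly positive,
and is continuous. -/
def ContFinRatPos {Y : Type*} [TopologicalSpace Y] (f : Y → ℝ) : Prop :=
  Continuous f ∧ (Set.range f).Finite ∧ ∀ y : Y, ∃ q : ℚ, f y = (q : ℝ) ∧ 0 < q

/-- the finite sum property for continuous functions on a nonempty compact
metrizable zero-dimensional space taking finitely many strictly positive rational values:
if `Σ f_i = Σ g_j` then there are `h_{i,j}` of the same kind with `f_i = Σ_j h_{i,j}` and
`g_j = Σ_i h_{i,j}`. -/
theorem finite_sum_property
    {Y : Type*} [TopologicalSpace Y] [CompactSpace Y] [TopologicalSpace.MetrizableSpace Y]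
    [TotallyDisconnectedSpace Y] [Nonempty Y]
    (n m : ℕ) (f : Fin n → Y → ℝ) (g : Fin m → Y → ℝ)
    (hf : ∀ i, ContFinRatPos (f i)) (hg : ∀ j, ContFinRatPos (g j))
    (hsum : ∀ y : Y, ∑ i, f i y = ∑ j, g j y) :
    ∃ h : Fin n → Fin m → Y → ℝ,
      (∀ i j, ContFinRatPos (h i j)) ∧
      (∀ i, ∀ y : Y, f i y = ∑ j, h i j y) ∧
      (∀ j, ∀ y : Y, g j y = ∑ i, h i j y) := by
  have fpos : ∀ i y, 0 < f i y := by
    intro i y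
    obtain ⟨q, hq, hq0⟩ := (hf i).2.2 y
    rw [hq]; exact_mod_cast hq0
  have gpos : ∀ j y, 0 < g j y := by
    intro j y
    obtain ⟨q, hq, hq0⟩ := (hg j).2.2 y
    rw [hq]; exact_mod_cast hq0
  have Spos : ∀ (_ : Fin n) y, 0 < ∑ k, f k y := fun i y =>
    Finset.sum_pos (fun k _ => fpos k y) ⟨i, Finset.mem_univ i⟩
  have Spos' : ∀ (_ : Fin m) y, 0 < ∑ k, f k y := fun j y => by
    rw [hsum]
    exact Finset.sum_pos (fun k _ => gpos k y) ⟨j, Finset.mem_univ j⟩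
  refine ⟨fun i j y => f i y * g j y / ∑ k, f k y, ?_, ?_, ?_⟩
  · intro i j
    refine ⟨?_, ?_, ?_⟩
    · exact ((hf i).1.mul (hg j).1).div (continuous_finsetSum _ fun k _ => (hf k).1)
        fun y => (Spos i y).ne'
    · have h1 : (Set.pi Set.univ fun k => Set.range (f k)).Finite :=
        Set.Finite.pi fun k => (hf k).2.1
      refine ((h1.prod (hg j).2.1).image
        (fun p : (Fin n → ℝ) × ℝ => p.1 i * p.2 / ∑ k, p.1 k)).subset ?_
      rintro _ ⟨y, rfl⟩
      exact ⟨(fun k => f k y, g j y), ⟨fun k _ => ⟨y, rfl⟩, ⟨y, rfl⟩⟩, rfl⟩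
    · intro y
      choose q hq hq0 using fun k => (hf k).2.2 y
      obtain ⟨r, hr, hr0⟩ := (hg j).2.2 y
      refine ⟨q i * r / ∑ k, q k, ?_, ?_⟩
      · simp only [hq, hr]
        push_cast
        rfl
      · exact div_pos (mul_pos (hq0 i) hr0)
          (Finset.sum_pos (fun k _ => hq0 k) ⟨i, Finset.mem_univ i⟩)
  · intro i y
    rw [← Finset.sum_div, ← Finset.mul_sum, ← hsum, mul_div_cancel_right₀ _ (Spos i y).ne']
  · intro j y
    rw [← Finset.sum_div, ← Finset.sum_mul, mul_div_cancel_left₀ _ (Spos' j y).ne']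
end

section
/- Let C be a Cantor space and X a nonempty closed subset of C. Let f_1,…,f_n ∈ G(X) and f ∈ G(C) be such that f(x) = Σ_{i=1}^n f_i(x) for all x ∈ X. Then there exist g_1,…,g_n ∈ G(C) such that g_i(x) = f_i(x) for all x ∈ X and all i, and f = Σ_{i=1}^n g_i on C. -/
open Set

/-- `f` belongs to `G(Y)`: it is continuous and takes only finitely many values, all of
which are rational and lie in the open interval `(0,1)`. -/
def MemG {Y : Type*} [TopologicalSpace Y] (f : Y → ℝ) : Prop :=
  Continuous f ∧ (Set.range f).Finite ∧
    ∀ y : Y, ∃ q : ℚ, f y = (q : ℝ) ∧ 0 < q ∧ q < 1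

theorem MemG.extend {C : Type*} [TopologicalSpace C] [CompactSpace C] [T2Space C]
    [TotallyDisconnectedSpace C] (X : Set C) (hX : IsClosed X) (hXne : X.Nonempty)
    (f : X → ℝ) (hf : MemG f) : ∃ k : C → ℝ, MemG k ∧ ∀ x : X, k x = f x := by
  obtain ⟨hc, hfin, hq⟩ := hf
  have : Finite (Set.range f) := hfin
  obtain ⟨x0, hx0⟩ := hXne
  obtain ⟨D, hDcl, hZD, -, hcov, hdis⟩ := exists_clopen_partition_of_clopen_cover
    (X := C) (I := Set.range f) (Z := fun v => Subtype.val '' (f ⁻¹' {(v : ℝ)}))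
    (D := fun _ => Set.univ)
    (fun v => hX.isClosedEmbedding_subtypeVal.isClosedMap _ (isClosed_singleton.preimage hc))
    (fun _ => isClopen_univ) (fun _ => Set.subset_univ _) (by
      intro v _ w _ hvw
      refine Set.disjoint_left.2 ?_
      rintro _ ⟨a, ha, rfl⟩ ⟨b, hb, hab⟩
      have hab' := Subtype.ext hab
      subst hab'
      exact hvw (Subtype.ext ((show f b = v from ha).symm.trans hb)))
  have hmem : ∀ y : C, ∃ v : Set.range f, y ∈ D v := fun y =>
    Set.mem_iUnion.1 (hcov (Set.mem_iUnion.2 ⟨⟨f ⟨x0, hx0⟩, _, rfl⟩, Set.mem_univ y⟩))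
  choose k hk using hmem
  have huniq : ∀ y v, y ∈ D v → k y = v := by
    intro y v hv
    by_contra hne
    exact Set.disjoint_left.1 (hdis (Set.mem_univ _) (Set.mem_univ _) hne) (hk y) hv
  refine ⟨fun y => k y, ⟨?_, ?_, ?_⟩, ?_⟩
  · have : IsLocallyConstant (fun y => (k y : ℝ)) := by
      rw [IsLocallyConstant.iff_exists_open]
      intro y
      exact ⟨D (k y), (hDcl _).isOpen, hk y, fun z hz => by rw [huniq z _ hz]⟩
    exact this.continuous
  · refine hfin.subset ?_
    rintro _ ⟨y, rfl⟩
    exact (k y).2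
  · intro y
    obtain ⟨x, hx⟩ := (k y).2
    obtain ⟨q, h⟩ := hq x
    exact ⟨q, hx.symm.trans h.1, h.2⟩
  · intro x
    have := huniq x ⟨f x, x, rfl⟩ (hZD _ ⟨x, rfl, rfl⟩)
    simp [this]

/-- sum-splitting extension property for `G`. Given a Cantor space `C`, a
nonempty closed subset `X ⊆ C`, functions `f₁, …, f_n ∈ G(X)` and `f ∈ G(C)` with
`f|_X = Σ_i f_i`, there are `g₁, …, g_n ∈ G(C)` extending the `f_i` with `f = Σ_i g_i`. -/
theorem G_sum_extension
    {C : Type*} [TopologicalSpace C] [CompactSpace C] [TopologicalSpace.MetrizableSpace C]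
    [TotallyDisconnectedSpace C] [Nonempty C]
    (hC : Perfect (Set.univ : Set C))
    (X : Set C) (hXcl : IsClosed X) (hXne : X.Nonempty)
    (n : ℕ) (f' : Fin n → X → ℝ) (hf' : ∀ i, MemG (f' i))
    (f : C → ℝ) (hf : MemG f)
    (hsum : ∀ x : X, f (x : C) = ∑ i, f' i x) :
    ∃ g : Fin n → C → ℝ,
      (∀ i, MemG (g i)) ∧
      (∀ i, ∀ x : X, g i (x : C) = f' i x) ∧
      (∀ y : C, f y = ∑ i, g i y) := by
  obtain ⟨x0, hx0⟩ := id hXne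
  choose k hk hkX using fun i => MemG.extend X hXcl hXne (f' i) (hf' i)
  have kpos : ∀ i y, 0 < k i y := by
    intro i y
    obtain ⟨q, h1, h2, -⟩ := (hk i).2.2 y
    rw [h1]; exact_mod_cast h2
  have fpos : ∀ y, 0 < f y ∧ f y < 1 := by
    intro y
    obtain ⟨q, h1, h2, h3⟩ := hf.2.2 y
    rw [h1]; exact ⟨by exact_mod_cast h2, by exact_mod_cast h3⟩
  have hn : Nonempty (Fin n) := by
    by_contra h
    rw [not_nonempty_iff] at h
    have h1 := hsum ⟨x0, hx0⟩
    rw [Finset.univ_eq_empty, Finset.sum_empty] at h1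
    exact (fpos x0).1.ne' h1
  have spos : ∀ y, 0 < ∑ j, k j y := fun y =>
    Finset.sum_pos (fun i _ => kpos i y) Finset.univ_nonempty
  refine ⟨fun i y => k i y * f y / ∑ j, k j y, fun i => ⟨?_, ?_, ?_⟩, ?_, ?_⟩
  · exact ((hk i).1.mul hf.1).div (continuous_finsetSum _ fun j _ => (hk j).1)
      fun y => (spos y).ne'
  · have h1 : (Set.pi Set.univ fun j => Set.range (k j)).Finite :=
      Set.Finite.pi fun j => (hk j).2.1
    refine ((h1.prod hf.2.1).image
      (fun p : (Fin n → ℝ) × ℝ => p.1 i * p.2 / ∑ j, p.1 j)).subset ?_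
    rintro _ ⟨y, rfl⟩
    exact ⟨(fun j => k j y, f y), ⟨fun j _ => ⟨y, rfl⟩, ⟨y, rfl⟩⟩, rfl⟩
  · intro y
    choose q hq using fun j => (hk j).2.2 y
    obtain ⟨r, hr, -⟩ := hf.2.2 y
    have e : k i y * f y / ∑ j, k j y = ((q i * r / ∑ j, q j : ℚ) : ℝ) := by
      push_cast
      rw [hr, (hq i).1, Finset.sum_congr rfl fun j _ => (hq j).1]
    have h0 : 0 < k i y * f y / ∑ j, k j y :=
      div_pos (mul_pos (kpos i y) (fpos y).1) (spos y)
    have h1 : k i y * f y / ∑ j, k j y < 1 := by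
      rw [div_lt_one (spos y)]
      have hle : k i y ≤ ∑ j, k j y :=
        Finset.single_le_sum (f := fun j => k j y) (fun j _ => (kpos j y).le) (Finset.mem_univ i)
      nlinarith [kpos i y, (fpos y).2]
    rw [e] at h0 h1
    exact ⟨_, e, by exact_mod_cast h0, by exact_mod_cast h1⟩
  · intro i x
    simp only [hkX, ← hsum]
    exact mul_div_cancel_right₀ _ (fpos x).1.ne'
  · intro y
    rw [← Finset.sum_div, ← Finset.sum_mul, mul_div_cancel_left₀ _ (spos y).ne']
end
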